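/- arXiv:math/0602452 — 2 statements merged into one kernel-verified Lean document; each statement's English description precedes it below -/
import Mathlib

section
/- For every n ≥ 1 and every l ≥ 0, the integral group cohomology of O*ₙ is: H^(1+4l)(O*ₙ) = 0, H^(2+4l)(O*ₙ) ≅ ℤ/2, H^(3+4l)(O*ₙ) = 0, and H^(4+4l)(O*ₙ) ≅ ℤ/(16·3ⁿ). -/
/-- Generators `X, P, Q, R` of the generalized binary octahedral group. -/
inductive OGen : Type
  | X : OGen
  | P : OGen
  | Q : OGen
  | R : OGen
  deriving DecidableEq

open OGen FreeGroup in
/-- The relations of the generalized binary octahedral group `O*ₙ`: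
`X^(3^n) = P⁴ = 1`, `P² = Q² = R²`, `PQP⁻¹ = Q⁻¹`, `XPX⁻¹ = Q`, `XQX⁻¹ = PQ`,
`RXR⁻¹ = X⁻¹`, `RPR⁻¹ = QP`, `RQR⁻¹ = Q⁻¹`. -/
def ostarRels (n : ℕ) : Set (FreeGroup OGen) :=
  { of X ^ 3 ^ n,
    of P ^ 4,
    of P ^ 2 * (of Q ^ 2)⁻¹,
    of Q ^ 2 * (of R ^ 2)⁻¹,
    of P * of Q * (of P)⁻¹ * of Q,
    of X * of P * (of X)⁻¹ * (of Q)⁻¹,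
    of X * of Q * (of X)⁻¹ * (of P * of Q)⁻¹,
    of R * of X * (of R)⁻¹ * of X,
    of R * of P * (of R)⁻¹ * (of Q * of P)⁻¹,
    of R * of Q * (of R)⁻¹ * of Q }

/-- The generalized binary octahedral group `O*ₙ`, given by the presentation above. -/
abbrev Ostar (n : ℕ) := PresentedGroup (ostarRels n)

/-- The k-th group cohomology of G with coefficients in ℤ with trivial G-action. -/
abbrev intGroupCohomology (G : Type) [Group G] (k : ℕ) : Type :=
  groupCohomology (Rep.trivial ℤ G ℤ) k

namespace OstarProof
open CategoryTheory CategoryTheory.Limits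

section Generic
variable {k : Type} [CommRing k] {G : Type} [Group G]

/-- Vanishing of all positive degree cohomology. -/
def Acyc (A : Rep.{0} k G) : Prop := ∀ j : ℕ, IsZero (groupCohomology A (j + 1))

lemma acyc_retract {A B : Rep.{0} k G} (i : A ⟶ B) (p : B ⟶ A) (h : i ≫ p = 𝟙 A)
    (hB : Acyc B) : Acyc A := by
  intro j
  have h1 : (groupCohomology.functor k G (j + 1)).map i ≫
      (groupCohomology.functor k G (j + 1)).map p = 𝟙 _ := by
    rw [← Functor.map_comp, h, CategoryTheory.Functor.map_id]
  have h2 : (groupCohomology.functor k G (j + 1)).map i = 0 := (hB j).eq_of_tgt _ _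
  rw [h2, zero_comp] at h1
  exact (IsZero.iff_id_eq_zero _).2 h1.symm

lemma acyc_of_trace [Fintype G] (A : Rep.{0} k G) (t : A.V →ₗ[k] A.V)
    (ht : ∀ a : A.V, ∑ g : G, A.ρ g⁻¹ (t (A.ρ g a)) = a) : Acyc A := by
  let S : Subgroup G := ⊥
  let T : Rep.{0} k S := Rep.trivial k S A.V
  have hS : Subsingleton S := inferInstanceAs (Subsingleton (⊥ : Subgroup G))
  have hB : Acyc (Rep.coind S.subtype T) := fun j =>
    (isZero_groupCohomology_succ_of_subsingleton T j).of_iso (groupCohomology.coindIso T (j + 1))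
  let i : A ⟶ Rep.coind S.subtype T := Rep.ofHom (LinearMap.intertwiningMap_of_isIntertwiningMap
    A.ρ (Representation.coind S.subtype T.ρ)
    { toFun := fun a => ⟨fun g => A.ρ g a, by
        intro g h
        have : g = 1 := Subsingleton.elim _ _
        subst this
        simp⟩
      map_add' := fun a b => by ext; simp
      map_smul' := fun a b => by ext; simp } (by
        intro g v
        ext h
        change A.ρ h (A.ρ g v) = A.ρ (h * g) v
        simp))
  let p : Rep.coind S.subtype T ⟶ A := Rep.ofHom (LinearMap.intertwiningMap_of_isIntertwiningMap
    (Representation.coind S.subtype T.ρ) A.ρ 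
    { toFun := fun f => ∑ g : G, A.ρ g⁻¹ (t (f.1 g))
      map_add' := fun a b => by simp [Finset.sum_add_distrib]
      map_smul' := fun a b => by simp [Finset.smul_sum] } (by
        intro g v
        simp only [LinearMap.coe_mk, AddHom.coe_mk, map_sum]
        refine Fintype.sum_equiv (Equiv.mulRight g) _ _ ?_
        intro h
        change A.ρ h⁻¹ (t (v.1 (h * g))) = A.ρ g (A.ρ (h * g)⁻¹ (t (v.1 (h * g))))
        rw [← Module.End.mul_apply (A.ρ g), ← map_mul]
        simp))
  refine acyc_retract i p ?_ hB
  refine Rep.hom_ext (Representation.IntertwiningMap.ext (LinearMap.ext fun a => ?_))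
  exact ht a

lemma shortExact_of {A B C : Rep.{0} k G} (f : A ⟶ B) (g : B ⟶ C)
    (hf : Function.Injective f.hom) (hg : Function.Surjective g.hom)
    (hfg : Function.Exact f.hom g.hom) :
    ∃ w : f ≫ g = 0, (ShortComplex.mk f g w).ShortExact := by
  have w : f ≫ g = 0 := by
    refine Rep.hom_ext (Representation.IntertwiningMap.ext (LinearMap.ext fun a => ?_))
    exact hfg.apply_apply_eq_zero a
  refine ⟨w, ?_⟩
  have h1 : ((ShortComplex.mk f g w).map (forget₂ (Rep.{0} k G) (ModuleCat.{0} k))).Exact := by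
    rw [ShortComplex.moduleCat_exact_iff]
    intro x hx
    exact (hfg x).1 hx
  rw [ShortComplex.exact_map_iff_of_faithful] at h1
  exact { exact := h1
          mono_f := (Rep.mono_iff_injective _).2 hf
          epi_g := (Rep.epi_iff_surjective _).2 hg }

lemma shift {A B C : Rep.{0} k G} (f : A ⟶ B) (g : B ⟶ C)
    (hf : Function.Injective f.hom) (hg : Function.Surjective g.hom)
    (hfg : Function.Exact f.hom g.hom) (hB : Acyc B) (j : ℕ) :
    Nonempty (groupCohomology C (j + 1) ≃+ groupCohomology A (j + 2)) := by
  obtain ⟨w, hs⟩ := shortExact_of f g hf hg hfg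
  have := groupCohomology.isIso_δ_of_isZero hs (j + 1) (hB j) (hB (j + 1))
  exact ⟨((asIso (groupCohomology.δ hs (j + 1) (j + 2) rfl)).toLinearEquiv).toAddEquiv⟩

lemma H0_map {B C : Rep.{0} k G} (g : B ⟶ C) (y : groupCohomology B 0) :
    ((groupCohomology.H0Iso C).hom ((groupCohomology.map (MonoidHom.id G) g 0) y)).1 =
      g.hom ((groupCohomology.H0Iso B).hom y).1 := by
  have h3 := groupCohomology.map_id_comp_H0Iso_hom g
  have h4 := congr($h3 y)
  exact congrArg Subtype.val h4

lemma shift_zero {A B C : Rep.{0} k G} (f : A ⟶ B) (g : B ⟶ C)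
    (hf : Function.Injective f.hom) (hg : Function.Surjective g.hom)
    (hfg : Function.Exact f.hom g.hom) (hB : Acyc B) :
    ∃ φ : C.ρ.invariants →+ groupCohomology A 1, Function.Surjective φ ∧
      ∀ x, φ x = 0 ↔ ∃ y : B.ρ.invariants, g.hom y.1 = x.1 := by
  obtain ⟨w, hs⟩ := shortExact_of f g hf hg hfg
  have he := groupCohomology.epi_δ_of_isZero hs 0 (hB 0)
  have hsur : Function.Surjective (groupCohomology.δ hs 0 1 rfl) :=
    (ModuleCat.epi_iff_surjective _).1 he
  have hex := (ShortComplex.moduleCat_exact_iff _).1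
    (groupCohomology.mapShortComplex₃_exact hs (i := 0) (j := 1) rfl)
  have hz := (groupCohomology.mapShortComplex₃ hs (i := 0) (j := 1) rfl).zero
  have hz' : ∀ y : groupCohomology B 0, (groupCohomology.δ hs 0 1 rfl)
      ((groupCohomology.map (MonoidHom.id G) g 0) y) = 0 := fun y => congr($hz y)
  have hex' : ∀ x : groupCohomology C 0, (groupCohomology.δ hs 0 1 rfl) x = 0 →
      ∃ y : groupCohomology B 0, (groupCohomology.map (MonoidHom.id G) g 0) y = x :=
    fun x hx => hex x hx
  refine ⟨((groupCohomology.δ hs 0 1 rfl).hom.comp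
    (groupCohomology.H0Iso C).inv.hom).toAddMonoidHom, ?_, ?_⟩
  · intro y
    obtain ⟨x, rfl⟩ := hsur y
    refine ⟨(groupCohomology.H0Iso C).hom x, ?_⟩
    change (groupCohomology.δ hs 0 1 rfl) ((groupCohomology.H0Iso C).inv
      ((groupCohomology.H0Iso C).hom x)) = _
    rw [CategoryTheory.Iso.hom_inv_id_apply]
  · intro x
    change (groupCohomology.δ hs 0 1 rfl) ((groupCohomology.H0Iso C).inv x) = 0 ↔ _
    constructor
    · intro h
      obtain ⟨y, hy⟩ := hex' ((groupCohomology.H0Iso C).inv x) h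
      refine ⟨(groupCohomology.H0Iso B).hom y, ?_⟩
      rw [← H0_map, hy, CategoryTheory.Iso.inv_hom_id_apply]
    · rintro ⟨y, hy⟩
      have h1 := H0_map g ((groupCohomology.H0Iso B).inv y)
      rw [CategoryTheory.Iso.inv_hom_id_apply, hy] at h1
      have h2 : (groupCohomology.H0Iso C).inv x = (groupCohomology.map (MonoidHom.id G) g 0)
          ((groupCohomology.H0Iso B).inv y) := by
        rw [← Subtype.ext h1, CategoryTheory.Iso.hom_inv_id_apply]
      rw [h2]
      exact hz' _

end Generic
end OstarProof

namespace OstarProof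
open CategoryTheory CategoryTheory.Limits

section Generic2
variable {k : Type} [CommRing k] {G : Type} [Group G]

lemma equiv_of_same_ker {A B C : Type} [AddCommGroup A] [AddCommGroup B] [AddCommGroup C]
    (φ : A →+ B) (ψ : A →+ C) (hφ : Function.Surjective φ) (hψ : Function.Surjective ψ)
    (h : ∀ x, φ x = 0 ↔ ψ x = 0) : Nonempty (B ≃+ C) := by
  have hk : φ.ker = ψ.ker := by
    ext x
    exact h x
  exact ⟨(QuotientAddGroup.quotientKerEquivOfSurjective φ hφ).symm.trans
    ((QuotientAddGroup.quotientAddEquivOfEq hk).trans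
      (QuotientAddGroup.quotientKerEquivOfSurjective ψ hψ))⟩

lemma subsingleton_of_acyc {A : Rep.{0} k G} (h : Acyc A) (j : ℕ) :
    Subsingleton (groupCohomology A (j + 1)) :=
  (ModuleCat.subsingleton_of_isZero (h j))

/-- The kernel of a morphism of representations. -/
noncomputable abbrev kerRep {A B : Rep.{0} k G} (f : A ⟶ B) : Rep.{0} k G :=
  A.subrepresentation (LinearMap.ker f.hom.toLinearMap) (fun g x hx => by
    have hx' : f.hom x = 0 := hx
    change f.hom (A.ρ g x) = 0
    rw [Rep.hom_comm_apply, hx', map_zero])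

/-- The inclusion of the kernel. -/
noncomputable abbrev kerι {A B : Rep.{0} k G} (f : A ⟶ B) : kerRep f ⟶ A :=
  A.subtype _ _

/-- Lift of a morphism to the kernel. -/
noncomputable def kerLift {A B C : Rep.{0} k G} (f : A ⟶ B) (g : B ⟶ C)
    (h : ∀ x, g.hom (f.hom x) = 0) : A ⟶ kerRep g :=
  Rep.ofHom (LinearMap.intertwiningMap_of_isIntertwiningMap A.ρ (kerRep g).ρ
    (f.hom.toLinearMap.codRestrict _ h) (fun a v => Subtype.ext (Rep.hom_comm_apply f a v)))

lemma kerLift_apply {A B C : Rep.{0} k G} (f : A ⟶ B) (g : B ⟶ C)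
    (h : ∀ x, g.hom (f.hom x) = 0) (x : A.V) : ((kerLift f g h).hom x).1 = f.hom x := rfl

/-- The elements of the kernel that are invariant. -/
lemma mem_inv_ker {A B : Rep.{0} k G} (f : A ⟶ B) (x : (kerRep f).ρ.invariants) :
    x.1.1 ∈ A.ρ.invariants ∧ f.hom x.1.1 = 0 :=
  ⟨fun g => congrArg Subtype.val (x.2 g), x.1.2⟩

variable {M E0 E1 E2 E3 : Rep.{0} k G} (i : M ⟶ E0) (d0 : E0 ⟶ E1) (d1 : E1 ⟶ E2) (d2 : E2 ⟶ E3)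
  (p : E3 ⟶ M)

/-- An exact sequence 0 → M → E0 → E1 → E2 → E3 → M → 0 with acyclic middle terms. -/
structure FourTerm : Prop where
  hi : Function.Injective i.hom
  e0 : Function.Exact i.hom d0.hom
  e1 : Function.Exact d0.hom d1.hom
  e2 : Function.Exact d1.hom d2.hom
  e3 : Function.Exact d2.hom p.hom
  hp : Function.Surjective p.hom
  a0 : Acyc E0
  a1 : Acyc E1
  a2 : Acyc E2
  a3 : Acyc E3

/-- A short exact sequence with acyclic middle term. -/
structure SES {A B C : Rep.{0} k G} (f : A ⟶ B) (g : B ⟶ C) : Prop where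
  hf : Function.Injective f.hom
  hg : Function.Surjective g.hom
  hfg : Function.Exact f.hom g.hom
  hB : Acyc B

lemma ses_ker {A B C : Rep.{0} k G} (f : A ⟶ B) (g : B ⟶ C) (hA : Acyc A)
    (h : Function.Exact f.hom g.hom) :
    SES (kerι f) (kerLift f g h.apply_apply_eq_zero) where
  hf := Subtype.val_injective
  hg := by
    rintro ⟨x, hx⟩
    obtain ⟨y, rfl⟩ := (h x).1 hx
    exact ⟨y, rfl⟩
  hfg := by
    intro x
    constructor
    · intro hx
      exact ⟨⟨x, congrArg Subtype.val hx⟩, rfl⟩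
    · rintro ⟨y, rfl⟩
      exact Subtype.ext y.2
  hB := hA

lemma SES.shift {A B C : Rep.{0} k G} {f : A ⟶ B} {g : B ⟶ C} (h : SES f g) (j : ℕ) :
    Nonempty (groupCohomology C (j + 1) ≃+ groupCohomology A (j + 2)) :=
  OstarProof.shift f g h.hf h.hg h.hfg h.hB j

lemma SES.shift_zero {A B C : Rep.{0} k G} {f : A ⟶ B} {g : B ⟶ C} (h : SES f g) :
    ∃ φ : C.ρ.invariants →+ groupCohomology A 1, Function.Surjective φ ∧
      ∀ x, φ x = 0 ↔ ∃ y : B.ρ.invariants, g.hom y.1 = x.1 :=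
  OstarProof.shift_zero f g h.hf h.hg h.hfg h.hB

variable {i d0 d1 d2 p}

lemma FourTerm.s0 (h : FourTerm i d0 d1 d2 p) : SES i (kerLift d0 d1 h.e1.apply_apply_eq_zero) where
  hf := h.hi
  hg := (ses_ker d0 d1 h.a0 h.e1).hg
  hfg := by
    intro x
    rw [← h.e0 x]
    exact ⟨fun hx => congrArg Subtype.val hx, fun hx => Subtype.ext hx⟩
  hB := h.a0

lemma FourTerm.s1 (h : FourTerm i d0 d1 d2 p) :
    SES (kerι d1) (kerLift d1 d2 h.e2.apply_apply_eq_zero) := ses_ker d1 d2 h.a1 h.e2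

lemma FourTerm.s2 (h : FourTerm i d0 d1 d2 p) :
    SES (kerι d2) (kerLift d2 p h.e3.apply_apply_eq_zero) := ses_ker d2 p h.a2 h.e3

lemma FourTerm.s3 (h : FourTerm i d0 d1 d2 p) : SES (kerι p) p where
  hf := Subtype.val_injective
  hg := h.hp
  hfg := by
    intro x
    constructor
    · intro hx
      exact ⟨⟨x, hx⟩, rfl⟩
    · rintro ⟨y, rfl⟩
      exact y.2
  hB := h.a3

lemma FourTerm.periodic (h : FourTerm i d0 d1 d2 p) (j : ℕ) :
    Nonempty (groupCohomology M (j + 1) ≃+ groupCohomology M (j + 5)) := by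
  obtain ⟨e3⟩ := h.s3.shift j
  obtain ⟨e2⟩ := h.s2.shift (j + 1)
  obtain ⟨e1⟩ := h.s1.shift (j + 2)
  obtain ⟨e0⟩ := h.s0.shift (j + 3)
  exact ⟨e3.trans (e2.trans (e1.trans e0))⟩

lemma subsingleton_of_inv {A B C D : Rep.{0} k G} {f : A ⟶ B} {d : C ⟶ D} {g : B ⟶ kerRep d}
    (h : SES f g) (h0 : ∀ x ∈ C.ρ.invariants, d.hom x = 0 → x = 0) :
    Subsingleton (groupCohomology A 1) := by
  obtain ⟨φ, hφ, -⟩ := h.shift_zero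
  refine ⟨fun a b => ?_⟩
  obtain ⟨x, rfl⟩ := hφ a
  obtain ⟨y, rfl⟩ := hφ b
  congr 1
  apply Subtype.ext
  apply Subtype.ext
  rw [h0 _ (mem_inv_ker d x).1 (mem_inv_ker d x).2, h0 _ (mem_inv_ker d y).1 (mem_inv_ker d y).2]

lemma FourTerm.h1 (h : FourTerm i d0 d1 d2 p)
    (h0 : ∀ x ∈ E1.ρ.invariants, d1.hom x = 0 → x = 0) : Subsingleton (groupCohomology M 1) :=
  subsingleton_of_inv h.s0 h0

lemma FourTerm.h2' (h : FourTerm i d0 d1 d2 p)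
    (h0 : ∀ x ∈ E2.ρ.invariants, d2.hom x = 0 → x = 0) : Subsingleton (groupCohomology M 2) := by
  have := subsingleton_of_inv h.s1 h0
  obtain ⟨e⟩ := h.s0.shift 0
  exact e.symm.toEquiv.subsingleton

lemma FourTerm.h3 (h : FourTerm i d0 d1 d2 p)
    (h0 : ∀ x ∈ E3.ρ.invariants, p.hom x = 0 → x = 0) : Subsingleton (groupCohomology M 3) := by
  have := subsingleton_of_inv h.s2 h0
  obtain ⟨e⟩ := h.s1.shift 0
  obtain ⟨e'⟩ := h.s0.shift 1
  exact (e.trans e').symm.toEquiv.subsingleton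

lemma FourTerm.h2 (h : FourTerm i d0 d1 d2 p) {C : Type} [AddCommGroup C]
    (ψ : E2.V →+ C) (hψ : ∀ c, ∃ x ∈ E2.ρ.invariants, d2.hom x = 0 ∧ ψ x = c)
    (hk : ∀ x ∈ E2.ρ.invariants, d2.hom x = 0 → (ψ x = 0 ↔ ∃ y ∈ E1.ρ.invariants, d1.hom y = x)) :
    Nonempty (groupCohomology M 2 ≃+ C) := by
  obtain ⟨φ, hφ, hφk⟩ := h.s1.shift_zero
  obtain ⟨e⟩ := h.s0.shift 0
  obtain ⟨e'⟩ := equiv_of_same_ker φ (ψ.comp ((kerι d2).hom.toLinearMap.toAddMonoidHom.comp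
    (kerRep d2).ρ.invariants.subtype.toAddMonoidHom)) hφ (by
      intro c
      obtain ⟨x, hx, hx', rfl⟩ := hψ c
      exact ⟨⟨⟨x, hx'⟩, fun g => Subtype.ext (hx g)⟩, rfl⟩) (by
      intro x
      rw [hφk]
      refine Iff.trans ?_ (hk x.1.1 (mem_inv_ker d2 x).1 (mem_inv_ker d2 x).2).symm
      constructor
      · rintro ⟨y, hy⟩
        exact ⟨y.1, y.2, congrArg Subtype.val hy⟩
      · rintro ⟨y, hy, hy'⟩
        exact ⟨⟨y, hy⟩, Subtype.ext hy'⟩)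
  exact ⟨e.symm.trans e'⟩

lemma FourTerm.h4 (h : FourTerm i d0 d1 d2 p) {C : Type} [AddCommGroup C]
    (ψ : M.V →+ C) (hψ : ∀ c, ∃ x ∈ M.ρ.invariants, ψ x = c)
    (hk : ∀ x ∈ M.ρ.invariants, (ψ x = 0 ↔ ∃ y ∈ E3.ρ.invariants, p.hom y = x)) :
    Nonempty (groupCohomology M 4 ≃+ C) := by
  obtain ⟨φ, hφ, hφk⟩ := h.s3.shift_zero
  obtain ⟨e0⟩ := h.s0.shift 2
  obtain ⟨e1⟩ := h.s1.shift 1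
  obtain ⟨e2⟩ := h.s2.shift 0
  obtain ⟨eq⟩ := equiv_of_same_ker φ (ψ.comp M.ρ.invariants.subtype.toAddMonoidHom) hφ (by
      intro c
      obtain ⟨x, hx, rfl⟩ := hψ c
      exact ⟨⟨x, hx⟩, rfl⟩) (by
      intro x
      rw [hφk]
      refine Iff.trans ?_ (hk x.1 x.2).symm
      constructor
      · rintro ⟨y, hy⟩
        exact ⟨y.1, y.2, hy⟩
      · rintro ⟨y, hy, hy'⟩
        exact ⟨⟨y, hy⟩, hy'⟩)
  exact ⟨(e2.trans (e1.trans e0)).symm.trans eq⟩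

/-- Cohomology of a split extension. -/
lemma split_equiv {A B C : Rep.{0} k G} (f : A ⟶ B) (g : B ⟶ C)
    (hf : Function.Injective f.hom) (hg : Function.Surjective g.hom)
    (hfg : Function.Exact f.hom g.hom) (r : B ⟶ A) (s : C ⟶ B) (hr : f ≫ r = 𝟙 A)
    (hs : s ≫ g = 𝟙 C) (j : ℕ) :
    Nonempty (groupCohomology B j ≃+ groupCohomology A j × groupCohomology C j) := by
  obtain ⟨w, hse⟩ := shortExact_of f g hf hg hfg
  let F := groupCohomology.functor k G j
  have h1 : ∀ x, F.map r (F.map f x) = x := by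
    intro x
    rw [← ModuleCat.comp_apply, ← CategoryTheory.Functor.map_comp, hr,
      CategoryTheory.Functor.map_id]
    rfl
  have h2 : ∀ x, F.map g (F.map s x) = x := by
    intro x
    rw [← ModuleCat.comp_apply, ← CategoryTheory.Functor.map_comp, hs,
      CategoryTheory.Functor.map_id]
    rfl
  have hex := (ShortComplex.moduleCat_exact_iff _).1
    (groupCohomology.mapShortComplex₂_exact hse j)
  have hz := (groupCohomology.mapShortComplex₂ (ShortComplex.mk f g w) j).zero
  have h3 : ∀ x, F.map g (F.map f x) = 0 := fun x => congr($hz x)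
  have h4 : ∀ x, F.map g x = 0 → ∃ y, F.map f y = x := fun x hx => hex x hx
  let T : F.obj B →+ F.obj A × F.obj C :=
    (F.map r).hom.toAddMonoidHom.prod (F.map g).hom.toAddMonoidHom
  have hT : ∀ x, T x = (F.map r x, F.map g x) := fun x => rfl
  suffices hh : Nonempty (F.obj B ≃+ F.obj A × F.obj C) from hh
  refine ⟨AddEquiv.ofBijective T ⟨?_, ?_⟩⟩
  · rw [injective_iff_map_eq_zero]
    intro x hx
    rw [hT, Prod.mk_eq_zero] at hx
    obtain ⟨y, rfl⟩ := h4 x hx.2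
    have := hx.1
    rw [h1] at this
    rw [this, map_zero]
  · rintro ⟨a, c⟩
    refine ⟨F.map f (a - F.map r (F.map s c)) + F.map s c, ?_⟩
    rw [hT, map_add, map_add, h1, h3, h2]
    simp

/-- Mayer-Vietoris type shift. -/
lemma equiv_of_acyc_right {A B C : Rep.{0} k G} (f : A ⟶ B) (g : B ⟶ C)
    (hf : Function.Injective f.hom) (hg : Function.Surjective g.hom)
    (hfg : Function.Exact f.hom g.hom) (hC : Acyc C) (j : ℕ) :
    Nonempty (groupCohomology A (j + 2) ≃+ groupCohomology B (j + 2)) := by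
  obtain ⟨w, hse⟩ := shortExact_of f g hf hg hfg
  let F := groupCohomology.functor k G (j + 2)
  have s1 := subsingleton_of_acyc hC j
  have s2 := subsingleton_of_acyc hC (j + 1)
  have hex := (ShortComplex.moduleCat_exact_iff _).1
    (groupCohomology.mapShortComplex₂_exact hse (j + 2))
  have hex' := (ShortComplex.moduleCat_exact_iff _).1
    (groupCohomology.mapShortComplex₁_exact hse (i := j + 1) (j := j + 2) rfl)
  have h4 : ∀ x : groupCohomology B (j + 2), ∃ y, F.map f y = x :=
    fun x => hex x (s2.elim _ _)
  have h5 : ∀ x, F.map f x = 0 → x = 0 := by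
    intro x hx
    obtain ⟨y, hy⟩ := hex' x hx
    have hy0 : y = 0 := s1.elim _ _
    rw [← hy, hy0, map_zero]
    rfl
  suffices hh : Nonempty (F.obj A ≃+ F.obj B) from hh
  refine ⟨AddEquiv.ofBijective (F.map f).hom.toAddMonoidHom ⟨?_, h4⟩⟩
  rw [injective_iff_map_eq_zero]
  exact h5

end Generic2
end OstarProof

namespace OstarProof
open CategoryTheory CategoryTheory.Limits

section GroupOrder
variable {G : Type} [Group G]

/-- Elements satisfying the relations, in a convenient form. -/
structure Rel (N : ℕ) (X P Q R : G) : Prop where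
  XN : X ^ N = 1
  P4 : P ^ 4 = 1
  PQ2 : P ^ 2 = Q ^ 2
  QR2 : Q ^ 2 = R ^ 2
  QP : Q * P = P ^ 3 * Q
  XP : X * P = Q * X
  XQ : X * Q = P * Q * X
  RX : R * X = X⁻¹ * R
  RP : R * P = Q * P * R
  RQ : R * Q = Q ^ 3 * R

/-- Normal forms. -/
def nf (X P Q R : G) : Set G := {x | ∃ a b c d : ℕ, x = P ^ a * Q ^ b * X ^ c * R ^ d}

variable {N : ℕ} {X P Q R : G}

lemma pull_pow {x y z : G} (h : x * y = z * x) (a : ℕ) : x * y ^ a = z ^ a * x :=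
  (SemiconjBy.pow_right (show SemiconjBy x y z from h) a)

lemma nf_P {x : G} (hx : x ∈ nf X P Q R) : P * x ∈ nf X P Q R := by
  obtain ⟨a, b, c, d, rfl⟩ := hx
  exact ⟨a + 1, b, c, d, by simp only [pow_succ', mul_assoc]⟩

lemma nf_Q (h : Rel N X P Q R) {x : G} (hx : x ∈ nf X P Q R) : Q * x ∈ nf X P Q R := by
  obtain ⟨a, b, c, d, rfl⟩ := hx
  refine ⟨3 * a, b + 1, c, d, ?_⟩
  have := pull_pow h.QP a
  rw [← pow_mul] at this
  simp only [← mul_assoc]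
  rw [this]
  simp only [pow_succ', mul_assoc]

lemma nf_pow {x y : G} (hy : ∀ x ∈ nf X P Q R, y * x ∈ nf X P Q R) (hx : x ∈ nf X P Q R) (a : ℕ) :
    y ^ a * x ∈ nf X P Q R := by
  induction a with
  | zero => simpa using hx
  | succ a ih => rw [pow_succ', mul_assoc]; exact hy _ ih

lemma nf_X (h : Rel N X P Q R) {x : G} (hx : x ∈ nf X P Q R) : X * x ∈ nf X P Q R := by
  obtain ⟨a, b, c, d, rfl⟩ := hx
  have e : X * (P ^ a * Q ^ b * X ^ c * R ^ d) =
      Q ^ a * ((P * Q) ^ b * (X ^ (c + 1) * R ^ d)) := by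
    simp only [← mul_assoc]
    rw [pull_pow h.XP a, mul_assoc (Q ^ a) X, pull_pow h.XQ b]
    simp only [pow_succ', mul_assoc]
  rw [e]
  refine nf_pow (fun x hx => nf_Q h hx) (nf_pow (fun x hx => ?_) ?_ _) _
  · rw [mul_assoc]
    exact nf_P (nf_Q h hx)
  · exact ⟨0, 0, c + 1, d, by simp⟩

lemma nf_R (hN : 0 < N) (h : Rel N X P Q R) {x : G} (hx : x ∈ nf X P Q R) :
    R * x ∈ nf X P Q R := by
  obtain ⟨a, b, c, d, rfl⟩ := hx
  have hX : X⁻¹ = X ^ (N - 1) := by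
    rw [inv_eq_iff_mul_eq_one, ← pow_succ', Nat.sub_add_cancel hN, h.XN]
  have e : R * (P ^ a * Q ^ b * X ^ c * R ^ d) =
      (Q * P) ^ a * ((Q ^ 3) ^ b * (X ^ ((N - 1) * c) * R ^ (d + 1))) := by
    simp only [← mul_assoc]
    rw [pull_pow h.RP a, mul_assoc _ R, pull_pow h.RQ b, mul_assoc _ (_ * R), mul_assoc _ R,
      pull_pow h.RX c, hX, ← pow_mul X]
    simp only [pow_succ', mul_assoc]
  rw [e]
  refine nf_pow (fun x hx => ?_) (nf_pow (fun x hx => nf_pow (fun x hx => nf_Q h hx) hx 3) ?_ _) _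
  · rw [mul_assoc]
    exact nf_Q h (nf_P hx)
  · exact ⟨0, 0, (N - 1) * c, d + 1, by simp⟩

lemma nf_all (hN : 0 < N) (h : Rel N X P Q R) (hg : Subgroup.closure {X, P, Q, R} = ⊤) (x : G) :
    x ∈ nf X P Q R := by
  have key : ∀ y : G, ∀ x ∈ nf X P Q R, y * x ∈ nf X P Q R := by
    intro y
    have hy : y ∈ Subgroup.closure {X, P, Q, R} := by rw [hg]; trivial
    have inv_ok : ∀ z : G, ∀ m : ℕ, 0 < m → z ^ m = 1 → (∀ x ∈ nf X P Q R, z * x ∈ nf X P Q R) →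
        ∀ x ∈ nf X P Q R, z⁻¹ * x ∈ nf X P Q R := by
      intro z m hm hz hc x hx
      have : z⁻¹ = z ^ (m - 1) := by
        rw [inv_eq_iff_mul_eq_one, ← pow_succ', Nat.sub_add_cancel hm, hz]
      rw [this]
      exact nf_pow hc hx _
    have hQ4 : Q ^ 4 = 1 := by
      rw [show 4 = 2 * 2 from rfl, pow_mul, ← h.PQ2, ← pow_mul, h.P4]
    have hR4 : R ^ 4 = 1 := by
      rw [show 4 = 2 * 2 from rfl, pow_mul, ← h.QR2, ← pow_mul, hQ4]
    induction hy using Subgroup.closure_induction'' with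
    | one => intro x hx; simpa using hx
    | mul y z _ _ hy hz => intro x hx; rw [mul_assoc]; exact hy _ (hz _ hx)
    | mem y hy =>
      rcases hy with rfl | rfl | rfl | rfl
      · exact fun x hx => nf_X h hx
      · exact fun x hx => nf_P hx
      · exact fun x hx => nf_Q h hx
      · exact fun x hx => nf_R hN h hx
    | inv_mem y hy =>
      rcases hy with rfl | rfl | rfl | rfl
      · exact inv_ok _ N hN h.XN fun x hx => nf_X h hx
      · exact inv_ok _ 4 (by norm_num) h.P4 fun x hx => nf_P hx
      · exact inv_ok _ 4 (by norm_num) hQ4 fun x hx => nf_Q h hx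
      · exact inv_ok _ 4 (by norm_num) hR4 fun x hx => nf_R hN h hx
  have := key x 1 ⟨0, 0, 0, 0, by simp⟩
  simpa using this

lemma nf_surj (hN : 0 < N) (h : Rel N X P Q R) (hg : Subgroup.closure {X, P, Q, R} = ⊤) :
    Function.Surjective (fun t : Fin 4 × Fin 2 × Fin N × Fin 2 =>
      P ^ t.1.val * Q ^ t.2.1.val * X ^ t.2.2.1.val * R ^ t.2.2.2.val) := by
  intro x
  obtain ⟨a, b, c, d, rfl⟩ := nf_all hN h hg x
  have c1 : Commute (P ^ 2) P := (Commute.refl P).pow_left 2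
  have c2 : Commute (P ^ 2) Q := by rw [h.PQ2]; exact (Commute.refl Q).pow_left 2
  have c3 : Commute (P ^ 2) X := by
    change _ * _ = _ * _
    rw [pull_pow h.XP 2, h.PQ2]
  have eb : Q ^ b = (P ^ 2) ^ (b / 2) * Q ^ (b % 2) := by
    rw [h.PQ2, ← pow_mul, ← pow_add, Nat.div_add_mod]
  have ed : R ^ d = (P ^ 2) ^ (d / 2) * R ^ (d % 2) := by
    rw [h.PQ2, h.QR2, ← pow_mul, ← pow_add, Nat.div_add_mod]
  have ea : ∀ a, P ^ a = P ^ (a % 4) := by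
    intro a
    conv_lhs => rw [← Nat.div_add_mod a 4, pow_add, pow_mul, h.P4, one_pow, one_mul]
  have ec : X ^ c = X ^ (c % N) := by
    conv_lhs => rw [← Nat.div_add_mod c N, pow_add, pow_mul, h.XN, one_pow, one_mul]
  refine ⟨(⟨(a + 2 * (b / 2) + 2 * (d / 2)) % 4, Nat.mod_lt _ (by norm_num)⟩,
    ⟨b % 2, Nat.mod_lt _ (by norm_num)⟩, ⟨c % N, Nat.mod_lt _ hN⟩,
    ⟨d % 2, Nat.mod_lt _ (by norm_num)⟩), ?_⟩
  dsimp only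
  rw [← ea, ← ec, eb, ed, pow_add, pow_add, pow_mul, pow_mul]
  have k1 : Commute ((P ^ 2) ^ (d / 2)) (Q ^ (b % 2) * X ^ c) :=
    ((c2.pow_left _).pow_right _).mul_right ((c3.pow_left _).pow_right _)
  calc _ = P ^ a * (P ^ 2) ^ (b / 2) * ((P ^ 2) ^ (d / 2) * (Q ^ (b % 2) * X ^ c)) * R ^ (d % 2) := by
        simp only [mul_assoc]
    _ = _ := by rw [k1.eq]; simp only [mul_assoc]

end GroupOrder

/-- The images of the generators. -/
def gen (n : ℕ) (x : OGen) : Ostar n := PresentedGroup.of x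

lemma ostar_rel (n : ℕ) : Rel (3 ^ n) (gen n .X) (gen n .P) (gen n .Q) (gen n .R) := by
  have H : ∀ r ∈ ostarRels n, PresentedGroup.mk (ostarRels n) r = 1 := fun r hr =>
    PresentedGroup.one_of_mem hr
  have h1 := H _ (by unfold ostarRels; left; rfl)
  have h2 := H _ (by unfold ostarRels; right; left; rfl)
  have h3 := H _ (by unfold ostarRels; right; right; left; rfl)
  have h4 := H _ (by unfold ostarRels; right; right; right; left; rfl)
  have h5 := H _ (by unfold ostarRels; right; right; right; right; left; rfl)
  have h6 := H _ (by unfold ostarRels; right; right; right; right; right; left; rfl)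
  have h7 := H _ (by unfold ostarRels; right; right; right; right; right; right; left; rfl)
  have h8 := H _ (by unfold ostarRels; right; right; right; right; right; right; right; left; rfl)
  have h9 := H _ (by
    unfold ostarRels; right; right; right; right; right; right; right; right; left; rfl)
  have h10 := H _ (by
    unfold ostarRels; right; right; right; right; right; right; right; right; right; rfl)
  simp only [map_mul, map_pow, map_inv] at h1 h2 h3 h4 h5 h6 h7 h8 h9 h10
  change gen n .X ^ 3 ^ n = 1 at h1
  change gen n .P ^ 4 = 1 at h2
  change gen n .P ^ 2 * (gen n .Q ^ 2)⁻¹ = 1 at h3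
  change gen n .Q ^ 2 * (gen n .R ^ 2)⁻¹ = 1 at h4
  change gen n .P * gen n .Q * (gen n .P)⁻¹ * gen n .Q = 1 at h5
  change gen n .X * gen n .P * (gen n .X)⁻¹ * (gen n .Q)⁻¹ = 1 at h6
  change gen n .X * gen n .Q * (gen n .X)⁻¹ * (gen n .P * gen n .Q)⁻¹ = 1 at h7
  change gen n .R * gen n .X * (gen n .R)⁻¹ * gen n .X = 1 at h8
  change gen n .R * gen n .P * (gen n .R)⁻¹ * (gen n .Q * gen n .P)⁻¹ = 1 at h9
  change gen n .R * gen n .Q * (gen n .R)⁻¹ * gen n .Q = 1 at h10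
  generalize gen n .X = X at *
  generalize gen n .P = P at *
  generalize gen n .Q = Q at *
  generalize gen n .R = R at *
  have h3' : P ^ 2 = Q ^ 2 := mul_inv_eq_one.1 h3
  have hQ3 : Q⁻¹ = P ^ 2 * Q := by
    rw [inv_eq_iff_mul_eq_one, h3', ← mul_assoc, ← pow_succ', ← pow_succ]
    rw [show 2 + 1 + 1 = 2 * 2 from rfl, pow_mul, ← h3', ← pow_mul, h2]
  exact
  { XN := h1
    P4 := h2
    PQ2 := h3'
    QR2 := mul_inv_eq_one.1 h4
    QP := by
      have : Q * P = P * Q⁻¹ := by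
        have a : P * Q = Q⁻¹ * P := mul_inv_eq_iff_eq_mul.1 (mul_eq_one_iff_eq_inv.1 h5)
        rw [eq_mul_inv_iff_mul_eq, mul_assoc, a, mul_inv_cancel_left]
      rw [this, hQ3, ← mul_assoc, ← pow_succ']
    XP := mul_inv_eq_iff_eq_mul.1 (mul_inv_eq_one.1 h6)
    XQ := mul_inv_eq_iff_eq_mul.1 (mul_inv_eq_one.1 h7)
    RX := mul_inv_eq_iff_eq_mul.1 (mul_eq_one_iff_eq_inv.1 h8)
    RP := mul_inv_eq_iff_eq_mul.1 (mul_inv_eq_one.1 h9)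
    RQ := by
      rw [mul_inv_eq_iff_eq_mul.1 (mul_eq_one_iff_eq_inv.1 h10), hQ3, h3', ← pow_succ] }

lemma ostar_closure (n : ℕ) :
    Subgroup.closure {gen n .X, gen n .P, gen n .Q, gen n .R} = ⊤ := by
  rw [← PresentedGroup.closure_range_of (ostarRels n)]
  congr 1
  ext x
  simp only [Set.mem_insert_iff, Set.mem_singleton_iff, Set.mem_range]
  constructor
  · rintro (rfl | rfl | rfl | rfl)
    exacts [⟨_, rfl⟩, ⟨_, rfl⟩, ⟨_, rfl⟩, ⟨_, rfl⟩]
  · rintro ⟨y, rfl⟩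
    cases y
    exacts [Or.inl rfl, Or.inr (Or.inl rfl), Or.inr (Or.inr (Or.inl rfl)),
      Or.inr (Or.inr (Or.inr rfl))]

instance ostar_finite (n : ℕ) : Finite (Ostar n) :=
  Finite.of_surjective _ (nf_surj (by positivity) (ostar_rel n) (ostar_closure n))

lemma ostar_card_le (n : ℕ) : Nat.card (Ostar n) ≤ 16 * 3 ^ n := by
  have := Nat.card_le_card_of_surjective _
    (nf_surj (by positivity) (ostar_rel n) (ostar_closure n))
  refine this.trans (le_of_eq ?_)
  simp
  ring

/-- Homomorphisms out of `Ostar n`. -/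
def ostarHom (n : ℕ) {H : Type} [Group H] (X P Q R : H) (h1 : X ^ 3 ^ n = 1) (h2 : P ^ 4 = 1)
    (h3 : P ^ 2 = Q ^ 2) (h4 : Q ^ 2 = R ^ 2) (h5 : P * Q * P⁻¹ = Q⁻¹) (h6 : X * P * X⁻¹ = Q)
    (h7 : X * Q * X⁻¹ = P * Q) (h8 : R * X * R⁻¹ = X⁻¹) (h9 : R * P * R⁻¹ = Q * P)
    (h10 : R * Q * R⁻¹ = Q⁻¹) : Ostar n →* H :=
  PresentedGroup.toGroup (f := fun o => match o with
    | .X => X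
    | .P => P
    | .Q => Q
    | .R => R) (by
    rintro r (rfl | rfl | rfl | rfl | rfl | rfl | rfl | rfl | rfl | rfl) <;>
      simp only [map_mul, map_pow, map_inv, FreeGroup.lift_apply_of]
    exacts [h1, h2, mul_inv_eq_one.2 h3, mul_inv_eq_one.2 h4, mul_eq_one_iff_eq_inv.2 h5,
      mul_inv_eq_one.2 h6, mul_inv_eq_one.2 h7, mul_eq_one_iff_eq_inv.2 h8, mul_inv_eq_one.2 h9,
      mul_eq_one_iff_eq_inv.2 h10])

lemma ostar_induction {n : ℕ} {p : Ostar n → Prop} (h1 : p 1)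
    (hm : ∀ x y, p x → p y → p (x * y)) (hi : ∀ x, p x → p x⁻¹) (hg : ∀ o, p (gen n o))
    (x : Ostar n) : p x := by
  have hx : x ∈ Subgroup.closure (Set.range (PresentedGroup.of (rels := ostarRels n))) := by
    rw [PresentedGroup.closure_range_of]
    trivial
  induction hx using Subgroup.closure_induction with
  | mem x hx => obtain ⟨o, rfl⟩ := hx; exact hg o
  | one => exact h1
  | mul x y _ _ hx hy => exact hm _ _ hx hy
  | inv x _ hx => exact hi _ hx

/-- Orbit counting for transitive actions. -/
lemma fibre_card {G : Type} [Group G] [Fintype G] {ι : Type} [Fintype ι] [DecidableEq ι]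
    (φ : G →* Equiv.Perm ι) (i0 : ι) (ht : ∀ j, ∃ g, φ g i0 = j) (j : ι) :
    (Finset.univ.filter (fun g : G => φ g j = i0)).card * Fintype.card ι = Fintype.card G := by
  have hc : ∀ j', (Finset.univ.filter (fun g : G => φ g j = j')).card =
      (Finset.univ.filter (fun g : G => φ g j = i0)).card := by
    intro j'
    obtain ⟨h, rfl⟩ := ht j'
    refine Finset.card_bij (fun g _ => h⁻¹ * g) ?_ ?_ ?_
    · intro g hg
      simp only [Finset.mem_filter, Finset.mem_univ, true_and] at hg ⊢
      rw [map_mul, Equiv.Perm.mul_apply, hg, map_inv, Equiv.Perm.inv_eq_iff_eq]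
    · intro a _ b _ hab
      exact mul_left_cancel hab
    · intro g hg
      simp only [Finset.mem_filter, Finset.mem_univ, true_and] at hg ⊢
      exact ⟨h * g, by rw [map_mul, Equiv.Perm.mul_apply, hg], by group⟩
  have := Finset.card_eq_sum_card_fiberwise (s := (Finset.univ : Finset G))
    (t := (Finset.univ : Finset ι)) (f := fun g => φ g j) (fun _ _ => Finset.mem_univ _)
  rw [← Finset.card_univ (α := G), this, Finset.sum_congr rfl (fun j' _ => hc j')]
  simp [mul_comm]

end OstarProof

namespace OstarProof
open CategoryTheory CategoryTheory.Limits

section FunRep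
variable {G : Type} [Group G] {ι : Type}

/-- The representation on functions twisted by a sign. -/
def funρ (R : Type) [CommRing R] (φ : G →* Equiv.Perm ι) (s : G →* ℤˣ) :
    Representation ℤ G (ι → R) where
  toFun g :=
    { toFun := fun f j => ((s g : ℤˣ) : ℤ) • f (φ g⁻¹ j)
      map_add' := fun f f' => by ext j; simp
      map_smul' := fun c f => by ext j; simp [mul_left_comm] }
  map_one' := by ext f j; simp
  map_mul' g h := by
    refine LinearMap.ext fun f => funext fun j => ?_
    simp [mul_assoc]

variable (R : Type) [CommRing R] (φ : G →* Equiv.Perm ι) (s : G →* ℤˣ)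

/-- The representation on functions twisted by a sign. -/
abbrev funRep : Rep.{0} ℤ G := Rep.of (funρ R φ s)

lemma funρ_apply (g : G) (f : ι → R) (j : ι) :
    funρ R φ s g f j = ((s g : ℤˣ) : ℤ) • f (φ g⁻¹ j) := rfl

lemma funRep_acyc [Fintype G] [Fintype ι] [DecidableEq ι] (i0 : ι) (ht : ∀ j, ∃ g, φ g i0 = j)
    (m : ℕ) (hm : m * Fintype.card ι = Fintype.card G) (c : R) (hc : (m : R) * c = 1) :
    Acyc (funRep R φ s) := by
  have hpos : 0 < Fintype.card ι := Fintype.card_pos_iff.2 ⟨i0⟩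
  have hf : ∀ j, (Finset.univ.filter (fun g : G => φ g j = i0)).card = m := fun j =>
    Nat.eq_of_mul_eq_mul_right hpos ((fibre_card φ i0 ht j).trans hm.symm)
  let t : (ι → R) →ₗ[ℤ] (ι → R) :=
    { toFun := fun f => Pi.single i0 (c * f i0)
      map_add' := fun f f' => by rw [← Pi.single_add]; simp [mul_add]
      map_smul' := fun a f => by ext j; by_cases h : j = i0 <;> simp [h, mul_left_comm] }
  refine acyc_of_trace (funRep R φ s) t ?_
  intro (f : ι → R)
  refine funext fun (j : ι) => ?_
  have key : ∀ g : G, (funρ R φ s g⁻¹ (t (funρ R φ s g f))) j =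
      if φ g j = i0 then c * f j else 0 := by
    intro g
    rw [funρ_apply, inv_inv]
    change _ • (Pi.single i0 (c * (funρ R φ s g f i0)) : ι → R) (φ g j) = _
    rw [Pi.single_apply]
    split_ifs with h
    · rw [funρ_apply]
      have : φ g⁻¹ i0 = j := by rw [← h, map_inv]; simp
      rw [this, mul_smul_comm, smul_smul, map_inv, ← Units.val_mul, inv_mul_cancel]
      simp
    · simp
  have : (∑ g : G, (funρ R φ s g⁻¹ (t (funρ R φ s g f)))) j = f j := by
    rw [Finset.sum_apply, Finset.sum_congr rfl (fun g _ => key g), ← Finset.sum_filter,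
      Finset.sum_const, hf j, nsmul_eq_mul, ← mul_assoc, hc, one_mul]
  exact this

/-- Invariants. -/
lemma funRep_inv {f : ι → R} (hf : f ∈ (funρ R φ s).invariants) (g : G) (j : ι) :
    ((s g : ℤˣ) : ℤ) • f (φ g⁻¹ j) = f j := congrFun (hf g) j

end FunRep

/-- The subring of `ℚ` of fractions with denominators in `T`. -/
def Rloc (T : Submonoid ℕ) : Subring ℚ where
  carrier := {q | ∃ d ∈ T, ∃ z : ℤ, (d : ℚ) * q = z}
  mul_mem' := by
    rintro a b ⟨d, hd, z, hz⟩ ⟨e, he, w, hw⟩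
    exact ⟨d * e, T.mul_mem hd he, z * w, by push_cast; rw [← hz, ← hw]; ring⟩
  one_mem' := ⟨1, T.one_mem, 1, by simp⟩
  add_mem' := by
    rintro a b ⟨d, hd, z, hz⟩ ⟨e, he, w, hw⟩
    exact ⟨d * e, T.mul_mem hd he, e * z + d * w, by push_cast; rw [← hz, ← hw]; ring⟩
  zero_mem' := ⟨1, T.one_mem, 0, by simp⟩
  neg_mem' := by
    rintro a ⟨d, hd, z, hz⟩
    exact ⟨d, hd, -z, by push_cast; rw [← hz]; ring⟩

lemma Rloc_inv (T : Submonoid ℕ) {m : ℕ} (hm : m ∈ T) (h0 : m ≠ 0) :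
    ∃ c : Rloc T, (m : Rloc T) * c = 1 := by
  have : (m : ℚ) ≠ 0 := by exact_mod_cast h0
  refine ⟨⟨(m : ℚ)⁻¹, m, hm, 1, by simp [this]⟩, ?_⟩
  apply Subtype.ext
  simp [this]

/-- Reduction modulo `m`. -/
lemma Rloc_quot (T : Submonoid ℕ) (m : ℕ) (hm : ∀ d ∈ T, Nat.Coprime d m) :
    ∃ ψ : Rloc T →+ ZMod m, Function.Surjective ψ ∧
      ∀ x, ψ x = 0 ↔ ∃ y : Rloc T, (m : Rloc T) * y = x := by
  let I : Ideal (Rloc T) := Ideal.span {(m : Rloc T)}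
  have hI : ∀ x, x ∈ I ↔ ∃ y : Rloc T, (m : Rloc T) * y = x := by
    intro x
    rw [Ideal.mem_span_singleton']
    simp only [mul_comm]
  let φ : ℤ →+ (Rloc T ⧸ I) := (Int.castRingHom (Rloc T ⧸ I)).toAddMonoidHom
  have hφ : ∀ z : ℤ, φ z = Ideal.Quotient.mk I (z : Rloc T) := fun z => by
    simp [φ]
  obtain ⟨e⟩ := equiv_of_same_ker φ (Int.castAddHom (ZMod m)) (by
    intro x
    obtain ⟨⟨r, d, hd, z, hz⟩, rfl⟩ := Ideal.Quotient.mk_surjective x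
    have hc : IsCoprime (d : ℤ) (m : ℤ) := Nat.isCoprime_iff_coprime.2 (hm d hd)
    obtain ⟨u, v, huv⟩ := hc
    refine ⟨z * u, ?_⟩
    rw [hφ, Ideal.Quotient.eq, hI]
    refine ⟨- v * ⟨r, d, hd, z, hz⟩, ?_⟩
    apply Subtype.ext
    have huv' : (u : ℚ) * d + v * m = 1 := by exact_mod_cast huv
    push_cast
    rw [← hz]
    linear_combination (-r) * huv') ZMod.intCast_surjective (by
    intro z
    rw [hφ, Ideal.Quotient.eq_zero_iff_mem, hI, Int.coe_castAddHom, ZMod.intCast_zmod_eq_zero_iff_dvd]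
    constructor
    · rintro ⟨⟨r, d, hd, w, hw⟩, h⟩
      have h' : (m : ℚ) * r = z := congrArg Subtype.val h
      have h2 : (d : ℤ) * z = m * w := by
        have : (d : ℚ) * z = m * w := by rw [← h', ← hw]; ring
        exact_mod_cast this
      have hc : IsCoprime (m : ℤ) (d : ℤ) := (Nat.isCoprime_iff_coprime.2 (hm d hd)).symm
      exact hc.dvd_of_dvd_mul_left ⟨w, h2⟩
    · rintro ⟨w, rfl⟩
      exact ⟨w, by push_cast; rfl⟩)
  refine ⟨e.toAddMonoidHom.comp (Ideal.Quotient.mk I).toAddMonoidHom, ?_, ?_⟩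
  · exact e.surjective.comp Ideal.Quotient.mk_surjective
  · intro x
    rw [← hI, ← Ideal.Quotient.eq_zero_iff_mem]
    exact e.map_eq_zero_iff

/-- Powers of two. -/
def T1 : Submonoid ℕ := Submonoid.powers 2

/-- Odd numbers. -/
def T2 : Submonoid ℕ where
  carrier := {m | Odd m}
  mul_mem' := fun ha hb => Odd.mul ha hb
  one_mem' := odd_one

section MV
variable {G : Type} [Group G]

lemma mv [Fintype G] (j : ℕ) :
    Nonempty (groupCohomology (Rep.trivial ℤ G ℤ) (j + 2) ≃+
      groupCohomology (Rep.trivial ℤ G (Rloc T1)) (j + 2) ×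
        groupCohomology (Rep.trivial ℤ G (Rloc T2)) (j + 2)) := by
  let B : Rep.{0} ℤ G := Rep.trivial ℤ G (Rloc T1 × Rloc T2)
  let A1 : Rep.{0} ℤ G := Rep.trivial ℤ G (Rloc T1)
  let A2 : Rep.{0} ℤ G := Rep.trivial ℤ G (Rloc T2)
  let tr : ∀ {V W : Type} [AddCommGroup V] [AddCommGroup W], (V →ₗ[ℤ] W) →
    (Rep.trivial ℤ G V ⟶ Rep.trivial ℤ G W) := fun f =>
      Rep.ofHom (LinearMap.intertwiningMap_of_isIntertwiningMap _ _ f (fun _ _ => rfl))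
  let f : Rep.trivial ℤ G ℤ ⟶ B := tr
    ((Int.castAddHom (Rloc T1)).prod (Int.castAddHom (Rloc T2))).toIntLinearMap
  let g : B ⟶ Rep.trivial ℤ G ℚ := tr
    (((Rloc T1).subtype.toAddMonoidHom.comp (AddMonoidHom.fst _ _)) -
      ((Rloc T2).subtype.toAddMonoidHom.comp (AddMonoidHom.snd _ _))).toIntLinearMap
  have hQ : Acyc (Rep.trivial ℤ G ℚ) := by
    refine acyc_of_trace _ (((Fintype.card G : ℚ)⁻¹ • (LinearMap.id : ℚ →ₗ[ℚ] ℚ)).restrictScalars ℤ) ?_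
    intro (a : ℚ)
    change ∑ g : G, ((Fintype.card G : ℚ)⁻¹ * a) = a
    have : (Fintype.card G : ℚ) ≠ 0 := by exact_mod_cast Fintype.card_ne_zero
    simp [this]
  obtain ⟨e1⟩ := equiv_of_acyc_right f g (by
    intro (a : ℤ) (b : ℤ) (h : ((a : Rloc T1), (a : Rloc T2)) = ((b : Rloc T1), (b : Rloc T2)))
    have := congrArg (fun x => x.1.1) h
    simpa using this) (by
    intro (q : ℚ)
    obtain ⟨k, d, hd, hkd⟩ := Nat.exists_eq_two_pow_mul_odd (n := q.den) q.den_nz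
    have hc : IsCoprime ((2 ^ k : ℕ) : ℤ) (d : ℤ) := Nat.isCoprime_iff_coprime.2
      (Nat.Coprime.pow_left _ (Nat.coprime_two_left.2 hd))
    obtain ⟨u, v, huv⟩ := hc
    have huv' : (u : ℚ) * 2 ^ k + v * d = 1 := by exact_mod_cast huv
    have hq : q * (2 ^ k * d) = q.num := by
      have := Rat.mul_den_eq_num q
      rw [hkd] at this
      exact_mod_cast this
    refine ⟨(⟨v * d * q, 2 ^ k, ⟨k, rfl⟩, v * q.num, by push_cast; rw [← hq]; ring⟩,
      ⟨- (u * 2 ^ k * q), d, hd, - (u * q.num), by push_cast; rw [← hq]; ring⟩), ?_⟩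
    change (v * d * q : ℚ) - (- (u * 2 ^ k * q)) = q
    linear_combination q * huv') (by
    rintro ⟨⟨a, d, ⟨k, hk⟩, z, hz⟩, ⟨b, e, he, w, hw⟩⟩
    constructor
    · intro (h : a - b = 0)
      have hab : a = b := by linarith
      subst hab
      dsimp only at hk
      subst hk
      have hc : IsCoprime ((2 ^ k : ℕ) : ℤ) (e : ℤ) := Nat.isCoprime_iff_coprime.2
        (Nat.Coprime.pow_left _ (Nat.coprime_two_left.2 he))
      obtain ⟨u, v, huv⟩ := hc
      have huv' : (u : ℚ) * ((2 ^ k : ℕ) : ℚ) + v * e = 1 := by exact_mod_cast huv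
      have ha : ((u * z + v * w : ℤ) : ℚ) = a := by
        push_cast
        rw [← hz, ← hw]
        linear_combination a * huv'
      refine ⟨(u * z + v * w : ℤ), ?_⟩
      refine Prod.ext (Subtype.ext ?_) (Subtype.ext ?_)
      · exact (Subring.coe_intCast _ _).trans ha
      · exact (Subring.coe_intCast _ _).trans ha
    · rintro ⟨(y : ℤ), hy⟩
      have h1 : (y : ℚ) = a :=
        (Subring.coe_intCast _ _).symm.trans (congrArg (fun x : Rloc T1 × Rloc T2 => x.1.1) hy)
      have h2 : (y : ℚ) = b :=
        (Subring.coe_intCast _ _).symm.trans (congrArg (fun x : Rloc T1 × Rloc T2 => x.2.1) hy)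
      change a - b = 0
      rw [← h1, ← h2, sub_self]) hQ j
  obtain ⟨e2⟩ := split_equiv (A := A1) (B := B) (C := A2) (tr (LinearMap.inl ℤ _ _))
    (tr (LinearMap.snd ℤ _ _))
    (LinearMap.inl_injective (R := ℤ) (M := Rloc T1) (M₂ := Rloc T2))
    (LinearMap.snd_surjective (R := ℤ) (M := Rloc T1) (M₂ := Rloc T2))
    (Function.Exact.inl_snd (R := ℤ) (M := Rloc T1) (N := Rloc T2))
    (tr (LinearMap.fst ℤ _ _)) (tr (LinearMap.inr ℤ _ _)) rfl rfl (j + 2)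
  exact ⟨e1.trans e2⟩

lemma h1_trivial [Finite G] : Subsingleton (groupCohomology (Rep.trivial ℤ G ℤ) 1) := by
  have e := (groupCohomology.H1IsoOfIsTrivial (Rep.trivial ℤ G ℤ)).toLinearEquiv
  suffices h : Subsingleton (Additive G →+ ℤ) from
    (show Subsingleton (groupCohomology (Rep.trivial ℤ G ℤ) 1) from
      @Equiv.subsingleton _ _ e.toEquiv h)
  have hz : ∀ f : Additive G →+ ℤ, f = 0 := by
    intro f
    refine AddMonoidHom.ext fun x => ?_
    have h1 : Nat.card G • f x = 0 := by
      rw [← map_nsmul]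
      have : Nat.card G • x = 0 := (pow_card_eq_one' (x := x.toMul))
      rw [this, map_zero]
    have h2 : Nat.card G ≠ 0 := Nat.card_pos.ne'
    simpa [h2] using h1
  exact ⟨fun a b => (hz a).trans (hz b).symm⟩

end MV
end OstarProof

namespace OstarProof
open CategoryTheory CategoryTheory.Limits

lemma intertwine_of_gens {n : ℕ} {V W : Type} [AddCommGroup V] [AddCommGroup W]
    (ρ : Representation ℤ (Ostar n) V) (σ : Representation ℤ (Ostar n) W) (d : V →ₗ[ℤ] W)
    (h : ∀ o v, d (ρ (gen n o) v) = σ (gen n o) (d v)) (g : Ostar n) :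
    ∀ v, d (ρ g v) = σ g (d v) := by
  induction g using ostar_induction with
  | h1 => intro v; simp
  | hm x y hx hy => intro v; rw [map_mul, map_mul, Module.End.mul_apply, hx, hy]; rfl
  | hi x hx =>
    intro v
    have h1 : d v = σ x (d (ρ x⁻¹ v)) := by
      rw [← hx, ← Module.End.mul_apply, ← map_mul, mul_inv_cancel, map_one]; rfl
    rw [h1, ← Module.End.mul_apply, ← map_mul, inv_mul_cancel, map_one]; rfl
  | hg o => exact h o

/-- A morphism of representations from a linear map commuting with the generators. -/
noncomputable def homOfGens {n : ℕ} {V W : Type} [AddCommGroup V] [AddCommGroup W]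
    {ρ : Representation ℤ (Ostar n) V} {σ : Representation ℤ (Ostar n) W} (d : V →ₗ[ℤ] W)
    (h : ∀ o v, d (ρ (gen n o) v) = σ (gen n o) (d v)) : Rep.of ρ ⟶ Rep.of σ :=
  Rep.ofHom (LinearMap.intertwiningMap_of_isIntertwiningMap ρ σ d (intertwine_of_gens ρ σ d h))

section Three
variable (n : ℕ)

lemma addRight_pow {N : ℕ} (m : ℕ) (x : ZMod N) : ((Equiv.addRight (1 : ZMod N)) ^ m) x = x + m := by
  induction m generalizing x with
  | zero => simp
  | succ m ih => rw [pow_succ, Equiv.Perm.mul_apply, ih]; simp; ring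

/-- The action on `ZMod (3 ^ n)` through the dihedral group. -/
def φ3 : Ostar n →* Equiv.Perm (ZMod (3 ^ n)) :=
  ostarHom n (Equiv.addRight 1) 1 1 (Equiv.neg _)
    (by ext x; rw [addRight_pow]; simp)
    (by simp) (by simp) (by ext x; simp [pow_two]) (by simp) (by rw [mul_one, mul_inv_cancel])
    (by rw [mul_one, mul_inv_cancel, mul_one])
    (by
      rw [mul_inv_eq_iff_eq_mul, eq_inv_mul_iff_mul_eq]
      ext x
      simp) (by simp) (by simp)

/-- The sign character. -/
def sgn : Ostar n →* ℤˣ :=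
  ostarHom n 1 1 1 (-1) (by simp) (by simp) (by simp) (by simp) (by simp) (by simp) (by simp)
    (by simp) (by simp) (by simp)

lemma φ3_X (x : ZMod (3 ^ n)) : φ3 n (gen n .X)⁻¹ x = x - 1 := by
  rw [map_inv, Equiv.Perm.inv_eq_iff_eq]
  change x = (x - 1) + 1
  ring

lemma φ3_P (x : ZMod (3 ^ n)) : φ3 n (gen n .P)⁻¹ x = x := by
  rw [map_inv, Equiv.Perm.inv_eq_iff_eq]
  rfl

lemma φ3_Q (x : ZMod (3 ^ n)) : φ3 n (gen n .Q)⁻¹ x = x := by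
  rw [map_inv, Equiv.Perm.inv_eq_iff_eq]
  rfl

lemma φ3_R (x : ZMod (3 ^ n)) : φ3 n (gen n .R)⁻¹ x = -x := by
  rw [map_inv, Equiv.Perm.inv_eq_iff_eq]
  change x = - -x
  ring

lemma sgn_X : sgn n (gen n .X) = 1 := rfl
lemma sgn_P : sgn n (gen n .P) = 1 := rfl
lemma sgn_Q : sgn n (gen n .Q) = 1 := rfl
lemma sgn_R : sgn n (gen n .R) = -1 := rfl

lemma φ3_trans (j : ZMod (3 ^ n)) : ∃ g, φ3 n g 0 = j := by
  refine ⟨gen n .X ^ j.val, ?_⟩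
  rw [map_pow]
  change ((Equiv.addRight (1 : ZMod (3 ^ n))) ^ j.val) 0 = j
  rw [addRight_pow]
  simp

variable (R : Type) [CommRing R]

/-- plus functions -/
abbrev Ap : Rep.{0} ℤ (Ostar n) := funRep R (φ3 n) 1
/-- minus functions -/
abbrev Am : Rep.{0} ℤ (Ostar n) := funRep R (φ3 n) (sgn n)

/-- The map `f(x+1) - f(x-1)`. -/
def αlin : (ZMod (3 ^ n) → R) →ₗ[ℤ] (ZMod (3 ^ n) → R) where
  toFun f x := f (x + 1) - f (x - 1)
  map_add' f f' := by ext x; simp; ring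
  map_smul' c f := by ext x; simp; ring

/-- The sum as a linear map. -/
def sumlin {ι : Type} [Fintype ι] (R : Type) [CommRing R] : (ι → R) →ₗ[ℤ] R where
  toFun f := ∑ x, f x
  map_add' f f' := by simp [Finset.sum_add_distrib]
  map_smul' c f := by simp [Finset.mul_sum]

/-- Constants as a linear map. -/
def constlin {ι : Type} (R : Type) [CommRing R] : R →ₗ[ℤ] (ι → R) where
  toFun c := fun _ => c
  map_add' f f' := rfl
  map_smul' c f := rfl

lemma sum_zmod {N : ℕ} [NeZero N] (f : ZMod N → R) : ∑ x, f x = ∑ i ∈ Finset.range N, f i := by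
  symm
  refine Finset.sum_bij (fun i _ => (i : ZMod N)) (fun _ _ => Finset.mem_univ _) ?_ ?_ ?_
  · intro a ha b hb h
    have := congrArg ZMod.val h
    rwa [ZMod.val_natCast_of_lt (Finset.mem_range.1 ha),
      ZMod.val_natCast_of_lt (Finset.mem_range.1 hb)] at this
  · intro b _
    exact ⟨b.val, Finset.mem_range.2 (ZMod.val_lt b), by simp⟩
  · intro a _
    rfl

/-- Discrete integration on a cyclic group. -/
lemma integrate {N : ℕ} [NeZero N] (F : ZMod N → R) (hF : ∑ x, F x = 0) :
    ∃ S : ZMod N → R, ∀ y, S (y + 1) - S y = F y := by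
  refine ⟨fun y => ∑ i ∈ Finset.range y.val, F i, ?_⟩
  intro y
  have hy : ((y.val : ℕ) : ZMod N) = y := by simp
  have hsucc : ∑ i ∈ Finset.range (y.val + 1), F i = ∑ i ∈ Finset.range y.val, F i + F y := by
    rw [Finset.sum_range_succ, hy]
  rcases Nat.lt_or_ge (y.val + 1) N with h | h
  · have : (y + 1).val = y.val + 1 := by
      rw [← hy]
      rw [← Nat.cast_succ, ZMod.val_natCast_of_lt h, hy]
    dsimp only
    rw [this, hsucc]
    ring
  · have hN : y.val + 1 = N := le_antisymm (ZMod.val_lt y) h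
    have : y + 1 = 0 := by
      rw [← hy, ← Nat.cast_succ, Nat.succ_eq_add_one, hN]
      simp
    dsimp only
    rw [this, ZMod.val_zero, Finset.sum_range_zero]
    rw [sum_zmod] at hF
    rw [hN] at hsucc
    rw [hsucc] at hF
    linear_combination -hF

lemma two_unit : ∃ h : ZMod (3 ^ n), 2 * h = 1 := by
  have : IsUnit ((2 : ℕ) : ZMod (3 ^ n)) :=
    (ZMod.isUnit_iff_coprime 2 (3 ^ n)).2 (Nat.Coprime.pow_right _ (by norm_num))
  obtain ⟨h, hh⟩ := this.exists_right_inv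
  exact ⟨h, by simpa using hh⟩

lemma const_of_step {N : ℕ} [NeZero N] {f : ZMod N → R} (hf : ∀ x, f (x + 1) = f x) (x : ZMod N) :
    f x = f 0 := by
  have : ∀ m : ℕ, f (m : ZMod N) = f 0 := by
    intro m
    induction m with
    | zero => simp
    | succ m ih => rw [Nat.cast_succ, hf, ih]
  have h := this x.val
  simpa using h

lemma α_ker {f : ZMod (3 ^ n) → R} (hf : αlin n R f = 0) (x : ZMod (3 ^ n)) : f x = f 0 := by
  obtain ⟨h, hh⟩ := two_unit n
  have hf' : ∀ x, f (x + 1) - f (x - 1) = 0 := fun x => congrFun hf x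
  have key : ∀ y, (fun y => f (2 * y)) (y + 1) = (fun y => f (2 * y)) y := by
    intro y
    have := hf' (2 * y + 1)
    dsimp only
    rw [show 2 * y + 1 - 1 = 2 * y by ring] at this
    rw [show 2 * (y + 1) = 2 * y + 1 + 1 by ring]
    exact sub_eq_zero.1 this
  have := const_of_step R (f := fun y => f (2 * y)) key (h * x)
  rw [← mul_assoc, hh, one_mul, mul_zero] at this
  exact this

lemma α_range {F : ZMod (3 ^ n) → R} (hF : ∑ x, F x = 0) : ∃ f, αlin n R f = F := by
  obtain ⟨h, hh⟩ := two_unit n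
  let e : ZMod (3 ^ n) ≃ ZMod (3 ^ n) :=
    { toFun := fun y => 2 * y + 1
      invFun := fun x => h * (x - 1)
      left_inv := fun y => by
        linear_combination y * hh
      right_inv := fun x => by
        linear_combination (x - 1) * hh }
  obtain ⟨S, hS⟩ := integrate R (fun y => F (2 * y + 1)) (by
    rw [← hF]
    exact Equiv.sum_comp e F)
  refine ⟨fun x => S (h * x), ?_⟩
  ext x
  have := hS (h * (x - 1))
  change S (h * (x + 1)) - S (h * (x - 1)) = F x
  rw [show h * (x + 1) = h * (x - 1) + 1 by linear_combination hh, this]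
  congr 1
  linear_combination (x - 1) * hh

/-- First map. -/
noncomputable def i3 : Rep.trivial ℤ (Ostar n) R ⟶ Ap n R :=
  homOfGens (constlin R) (by
    rintro (_ | _ | _ | _) v <;> funext x <;> rw [funρ_apply] <;> simp [constlin])

/-- α from plus to minus. -/
noncomputable def α3 : Ap n R ⟶ Am n R :=
  homOfGens (αlin n R) (by
    rintro (_ | _ | _ | _) v <;> funext x <;> rw [funρ_apply] <;>
      simp only [αlin, LinearMap.coe_mk, AddHom.coe_mk, funρ_apply, φ3_X, φ3_P, φ3_Q, φ3_R,
        sgn_X, sgn_P, sgn_Q, sgn_R, MonoidHom.one_apply, Units.val_one, one_smul, Units.val_neg,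
        neg_smul]
    · ring_nf
    · ring_nf)

/-- α from minus to plus. -/
noncomputable def α3' : Am n R ⟶ Ap n R :=
  homOfGens (αlin n R) (by
    rintro (_ | _ | _ | _) v <;> funext x <;> rw [funρ_apply] <;>
      simp only [αlin, LinearMap.coe_mk, AddHom.coe_mk, funρ_apply, φ3_X, φ3_P, φ3_Q, φ3_R,
        sgn_X, sgn_P, sgn_Q, sgn_R, MonoidHom.one_apply, Units.val_one, one_smul, Units.val_neg,
        neg_smul]
    · ring_nf
    · ring_nf)

/-- The norm map. -/
noncomputable def N3 : Am n R ⟶ Am n R :=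
  homOfGens ((constlin R).comp (sumlin R)) (by
    rintro (_ | _ | _ | _) v <;> funext x <;> rw [funρ_apply] <;>
      simp only [constlin, sumlin, LinearMap.comp_apply, LinearMap.coe_mk, AddHom.coe_mk,
        funρ_apply, ← Finset.smul_sum] <;> congr 1 <;> exact Equiv.sum_comp _ _)

/-- The sum map. -/
noncomputable def p3 : Ap n R ⟶ Rep.trivial ℤ (Ostar n) R :=
  homOfGens (sumlin R) (by
    rintro (_ | _ | _ | _) v <;>
      simp only [sumlin, LinearMap.comp_apply, LinearMap.coe_mk, AddHom.coe_mk,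
        funρ_apply, MonoidHom.one_apply, Units.val_one, one_smul] <;>
      exact Equiv.sum_comp _ _)

lemma sum_α (f : ZMod (3 ^ n) → R) : ∑ x, αlin n R f x = 0 := by
  change ∑ x, (f (x + 1) - f (x - 1)) = 0
  have h1 : ∑ x, f (x + 1) = ∑ x, f x := Equiv.sum_comp (Equiv.addRight 1) f
  have h2 : ∑ x, f (x - 1) = ∑ x, f x := Equiv.sum_comp (Equiv.subRight 1) f
  rw [Finset.sum_sub_distrib, h1, h2, sub_self]

lemma fourTerm3 [Fintype (Ostar n)] (hcard : Fintype.card (Ostar n) = 16 * 3 ^ n)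
    (c : R) (hc : ((16 : ℕ) : R) * c = 1) :
    FourTerm (i3 n R) (α3 n R) (N3 n R) (α3' n R) (p3 n R) := by
  have ha : ∀ s, Acyc (funRep R (φ3 n) s) := fun s =>
    funRep_acyc R (φ3 n) s 0 (φ3_trans n) 16 (by rw [ZMod.card, hcard]) c hc
  have hconst : ∀ f : ZMod (3 ^ n) → R, (∀ x, f x = f 0) → αlin n R f = 0 := by
    intro f hf
    funext x
    change f (x + 1) - f (x - 1) = 0
    rw [hf, hf (x - 1), sub_self]
  refine ⟨?_, ?_, ?_, ?_, ?_, ?_, ha _, ha _, ha _, ha _⟩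
  · intro (a : R) (b : R) h
    exact congrFun h (0 : ZMod (3 ^ n))
  · intro (f : ZMod (3 ^ n) → R)
    constructor
    · intro h
      exact ⟨f 0, funext fun x => (α_ker n R h x).symm⟩
    · rintro ⟨(a : R), rfl⟩
      exact hconst _ fun x => rfl
  · intro (f : ZMod (3 ^ n) → R)
    constructor
    · intro h
      exact α_range n R (congrFun h (0 : ZMod (3 ^ n)))
    · rintro ⟨(f : ZMod (3 ^ n) → R), rfl⟩
      funext x
      exact sum_α n R f
  · intro (f : ZMod (3 ^ n) → R)
    constructor
    · intro h
      refine ⟨(Pi.single 0 (f 0) : ZMod (3 ^ n) → R), funext fun (x : ZMod (3 ^ n)) => ?_⟩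
      change ∑ y, (Pi.single 0 (f 0) : ZMod (3 ^ n) → R) y = f x
      rw [α_ker n R h x]
      simp
    · rintro ⟨(f : ZMod (3 ^ n) → R), rfl⟩
      exact hconst _ fun x => rfl
  · intro (f : ZMod (3 ^ n) → R)
    constructor
    · intro h
      exact α_range n R h
    · rintro ⟨(f : ZMod (3 ^ n) → R), rfl⟩
      exact sum_α n R f
  · intro (a : R)
    refine ⟨(Pi.single 0 a : ZMod (3 ^ n) → R), ?_⟩
    change ∑ y, (Pi.single 0 a : ZMod (3 ^ n) → R) y = a
    simp

lemma inv3 {s : Ostar n →* ℤˣ} (hs : s (gen n .X) = 1) {f : ZMod (3 ^ n) → R}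
    (hf : f ∈ (funρ R (φ3 n) s).invariants) (x : ZMod (3 ^ n)) : f x = f 0 := by
  refine const_of_step R (fun y => ?_) x
  have := funRep_inv R (φ3 n) s hf (gen n .X) (y + 1)
  rw [hs, φ3_X] at this
  simpa using this.symm

lemma inv3_minus (h2 : ∀ x : R, x + x = 0 → x = 0) {f : ZMod (3 ^ n) → R}
    (hf : f ∈ (funρ R (φ3 n) (sgn n)).invariants) : f = 0 := by
  have h0 : f 0 = 0 := by
    apply h2
    have := funRep_inv R (φ3 n) (sgn n) hf (gen n .R) 0
    rw [sgn_R, φ3_R] at this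
    simp at this
    linear_combination -this
  funext x
  rw [inv3 n R (sgn_X n) hf x, h0]
  rfl

theorem part3 [Fintype (Ostar n)] (hcard : Fintype.card (Ostar n) = 16 * 3 ^ n) (l : ℕ) :
    Subsingleton (groupCohomology (Rep.trivial ℤ (Ostar n) (Rloc T1)) (1 + 4 * l)) ∧
    Subsingleton (groupCohomology (Rep.trivial ℤ (Ostar n) (Rloc T1)) (2 + 4 * l)) ∧
    Subsingleton (groupCohomology (Rep.trivial ℤ (Ostar n) (Rloc T1)) (3 + 4 * l)) ∧
    Nonempty (groupCohomology (Rep.trivial ℤ (Ostar n) (Rloc T1)) (4 + 4 * l) ≃+ ZMod (3 ^ n)) := by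
  obtain ⟨c, hc⟩ := Rloc_inv T1 (m := 16) ⟨4, rfl⟩ (by norm_num)
  have H := fourTerm3 n (Rloc T1) hcard c hc
  have h2 : ∀ x : Rloc T1, x + x = 0 → x = 0 := by
    intro x hx
    have : x.1 + x.1 = 0 := congrArg Subtype.val hx
    apply Subtype.ext
    change x.1 = 0
    linarith
  have key : ∀ x : Rloc T1, ∀ y : ZMod (3 ^ n) → Rloc T1, (∀ t, y t = y 0) →
      (∑ t, y t = x ↔ ((3 ^ n : ℕ) : Rloc T1) * y 0 = x) := by
    intro x y hy
    rw [Finset.sum_congr rfl (fun t _ => hy t)]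
    simp [ZMod.card]
  induction l with
  | zero =>
    refine ⟨H.h1 fun x hx _ => inv3_minus n _ h2 hx, H.h2' fun x hx _ => inv3_minus n _ h2 hx,
      H.h3 ?_, ?_⟩
    · intro (x : ZMod (3 ^ n) → Rloc T1) hx (h : ∑ t, x t = 0)
      have hx' := inv3 n (Rloc T1) rfl hx
      rw [key 0 x hx'] at h
      have h0 : x 0 = 0 := by
        have h' : (((3 ^ n : ℕ) : Rloc T1) : ℚ) * (x 0).1 = 0 := congrArg Subtype.val h
        apply Subtype.ext
        simpa using h'
      funext t
      exact (hx' t).trans h0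
    · obtain ⟨ψ, hψ, hk⟩ := Rloc_quot T1 (3 ^ n) (by
        rintro d ⟨k, rfl⟩
        exact Nat.Coprime.pow _ _ (by norm_num))
      refine H.h4 ψ (fun c => ?_) ?_
      · obtain ⟨x, hx⟩ := hψ c
        exact ⟨x, fun g => rfl, hx⟩
      · intro (x : Rloc T1) _
        rw [hk]
        constructor
        · rintro ⟨y, hy⟩
          refine ⟨fun _ => y, ?_, ?_⟩
          · intro g
            funext t
            simp [funρ_apply]
          · exact (key x (fun _ => y) fun _ => rfl).2 hy
        · rintro ⟨(y : ZMod (3 ^ n) → Rloc T1), hy, hy'⟩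
          exact ⟨y 0, (key x y (inv3 n (Rloc T1) rfl hy)).1 hy'⟩
  | succ l ih =>
    obtain ⟨i1, i2, i3, ⟨i4⟩⟩ := ih
    obtain ⟨e1⟩ := H.periodic (4 * l)
    obtain ⟨e2⟩ := H.periodic (4 * l + 1)
    obtain ⟨e3⟩ := H.periodic (4 * l + 2)
    obtain ⟨e4⟩ := H.periodic (4 * l + 3)
    rw [show 4 * l + 1 = 1 + 4 * l by ring, show 4 * l + 5 = 1 + 4 * (l + 1) by ring] at e1
    rw [show 4 * l + 1 + 1 = 2 + 4 * l by ring, show 4 * l + 1 + 5 = 2 + 4 * (l + 1) by ring] at e2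
    rw [show 4 * l + 2 + 1 = 3 + 4 * l by ring, show 4 * l + 2 + 5 = 3 + 4 * (l + 1) by ring] at e3
    rw [show 4 * l + 3 + 1 = 4 + 4 * l by ring, show 4 * l + 3 + 5 = 4 + 4 * (l + 1) by ring] at e4
    exact ⟨e1.symm.toEquiv.subsingleton, e2.symm.toEquiv.subsingleton,
      e3.symm.toEquiv.subsingleton, ⟨e4.symm.trans i4⟩⟩

end Three
end OstarProof

namespace OstarProof
open CategoryTheory CategoryTheory.Limits

/-! Tables for the binary octahedral group, with elements numbered `0, …, 47`:
the element `P^a Q^b R^d X^c` has number `c + 3 * (a + 4 * b + 8 * d)`. -/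

/-- Table lookup, base 64. -/
def look (T : ℕ) (b : Fin 48) : Fin 48 :=
  ⟨(T >>> (6 * b.val)) % 64 % 48, Nat.mod_lt _ (by decide)⟩

/-- Table lookup, base 16. -/
def look16 (T : ℕ) (b : Fin 16) : Fin 16 :=
  ⟨(T >>> (4 * b.val)) % 16, Nat.mod_lt _ (by decide)⟩

/-- The projection onto cosets of `X`. -/
def cst (b : Fin 48) : Fin 16 := ⟨b.val / 3, by omega⟩

/-- Right multiplication by the inverse of `P R`. -/
def rg : Equiv.Perm (Fin 48) where
  toFun := look 78701065753921956751266979923136073197977876509220350504405708262537874369550937667821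
  invFun := look 148250395115332857127857614778589427811929955837757751582754559551708888874218564520347
  left_inv := by decide +kernel
  right_inv := by decide +kernel

/-- Right multiplication by `X`. -/
def rX : Equiv.Perm (Fin 48) where
  toFun := look 355475524492313300872866428095908834769354382973705201979683208323406785845213524918401
  invFun := look 363005292311062774185961617144995523768712406886282204190389584325394060133074520510466
  left_inv := by decide +kernel
  right_inv := by decide +kernel

/-- Left multiplication by `X`. -/
def lpX : Equiv.Perm (Fin 48) where
  toFun := look 268277508502139862874993824500583930713461293655257627459382762400357709839744523042945
  invFun := look 331793284936575547797102477944352951667873096131651532177977138371773429571296849825794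
  left_inv := by decide +kernel
  right_inv := by decide +kernel

/-- Left multiplication by `P`. -/
def lpP : Equiv.Perm (Fin 48) where
  toFun := look 299847805231705095289566828870127999129066485925089482408983328406287811245840361083139
  invFun := look 347211561625477149479306008117158985107669856247964706154785565869060647599095890883209
  left_inv := by decide +kernel
  right_inv := by decide +kernel

/-- Left multiplication by `Q`. -/
def lpQ : Equiv.Perm (Fin 48) where
  toFun := look 276165204316426382864939239794576000976259865161947038253467415405902547692152463614796
  invFun := look 228801447922654328675220119878630640725065022658996509569902117174564639754671500379346
  left_inv := by decide +kernel
  right_inv := by decide +kernel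

/-- Left multiplication by `R`. -/
def lpR : Equiv.Perm (Fin 48) where
  toFun := look 86709275340418062371519912717163848348470179615707088494546106955650627500272954746456
  invFun := look 39345157588483526085717212955378842707521338749304032210285564268447829801934797015006
  left_inv := by decide +kernel
  right_inv := by decide +kernel

/-- Left multiplication by `X` on cosets. -/
def lcX : Equiv.Perm (Fin 16) where
  toFun := look16 13807450178226315840
  invFun := look16 16990386876517020240
  left_inv := by decide +kernel
  right_inv := by decide +kernel

/-- Left multiplication by `P` on cosets. -/
def lcP : Equiv.Perm (Fin 16) where
  toFun := look16 14982785094495044385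
  invFun := look16 17136101523332735235
  left_inv := by decide +kernel
  right_inv := by decide +kernel

/-- Left multiplication by `Q` on cosets. -/
def lcQ : Equiv.Perm (Fin 16) where
  toFun := look16 13302189624111814260
  invFun := look16 11148938908273767510
  left_inv := by decide +kernel
  right_inv := by decide +kernel

/-- Left multiplication by `R` on cosets. -/
def lcR : Equiv.Perm (Fin 16) where
  toFun := look16 3896863077701704440
  invFun := look16 1456442173688707290
  left_inv := by decide +kernel
  right_inv := by decide +kernel

/-- First homotopy. -/
def t1 (k : Fin 16) (j : Fin 48) : ℕ :=
  (3098455492025472716507000865294684129122071639063619869945472646796023504029286456379631739657759451834470291039723268899510820567880617729330435436265188872278606532515870699586834940058541055075843213911287845928812453250880791701885732031791176055442025139689035866814001302341479334560779764185319368834780331161275401864752764126879867174424530238139340822995331590808004566312947063920344791979539661536777075616999408365871855980952064928696144133277636825528561833991489453326473231267787842559499845964465197357545158877707504908414040717739122888390833960426683660659418763763798829387838723728177910488653138319037006456338952643477204596280960281742967247914657190438948812627016963102852999518730897456339779486448026312053440747142146647777457593992368111031597880988162399478454908195388885706270200073636214825110553322945902788868753173895469829983226144351831793906326505419278311746352383717893039594375307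 >>> (4 * (48 * k.val + j.val))) % 16

/-- Second homotopy. -/
def t2 (b : Fin 48) (j : Fin 48) : ℕ :=
  (1045776232142343638483487493718772964905372498664246007748540288058542692668876394421009464254025335704885935344949934450184764548889440195905442572392675968885295046884968427886877163888150709814916779506084618079290662245545078662277203842129424160456935281139261939367999037020484937807858819198642776755138632134717935040860873888369662896132596555532142050763475318249754072885338018986075031629106810758229713451814799619490587937216376697137222422225912006037475629516042657019078232703455736843381453737826098825516714150191777335945476429488932196474997777279856523736780568423813195882554452990690063456751686927728947939438376070654671898571851865094744605331748703526788710538646043210552956805164639110513439303196849759812962934491182435174197642518027772930495807801705543182261042096198930954487680486621201035866795473158259257288987873739607669057658204548717957527443881174108166898120836790918716157910866292678082999476540598050728804423991979985437739446620726129750854455202025550724432826471350658817687041016188037619584642043498372674671645747748270412262145168916542249650886589770156460021616316916044000170224382592811197001898080878888795921585956086715050590388992012037604105734315419882860869008642775015653281082263258397483468276672122408730512934062021668503399452804957450458207946309652212393701200944913861346872844639028071321416166596043775976960977018489423541712352452563171176654381228113490853087033637915404627114186891094668469137457337091968793645867801343932024111578923524066220729902092412063960071256331051455893595402237080900878343258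65933083292160927244915965628288088807075609928689824065699419035690471687581487902815671258450534359248935248220796938405568183879846816760668167444696472302632720832552091323188957902973538523745438270564550652295349771137452318254594966531139671186002266428778225286983581206540248134691959550854508764584409328457369584627080336196815738162516920822717008868592559812729406542728602273176619219909022282555308117688424695830179947245382827477725692189820574750518647230597619240920401378963515271434049930683313714004013412138572967321764917783413138711926142641212373697294821691943942352344563958324096345105719409113273164627663895560472986927269848504980040255058833864324784864761432877181800668573661595497399298386403349304770688015693277355517123347409497306847754084002302685340948325450901761545245756800859858425169185839151471286467550929086222144583317444172347844952327953755379941709320988741110736821822841941377172532662756995760534167430273073709933192518468595955215385780876861562553355478907783860451165429625915017336776916098656918343103277865923185072614022348454285389492897786325488354782477791557366314700533493275004693543036322438699961750339952159787144 >>> (4 * (48 * b.val + j.val))) % 16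

/-- Third homotopy. -/
def t3 (b : Fin 48) (k : Fin 16) : ℕ :=
  (3098456530863977633525068017762439664366386760726877459552792614553175323198458199098155353542869466461078718950525706326714106605975079099480365223265204196130594935208044816691007758079437537459016130864344576850471645991601761189153046317891184137467247443372966748732717769474225796881575441066560127630737292325689859891190544656392118085754943586117035030332231339767460784601853653415278834366872399601695292483152098630128972996862638021788600130201911673741797680061313877222371855450000286047823368561845354677678221571218875151457471181952512324845031746103527686045668617289260657313966393412797712209062643405224910812547552542505442421444423610583070532446137138168932264173049164565712894052945535340939387450317181118245641206910824429719859000454436784007858234476241299997226960670950929129808851624874469043105509144658296424795789982955731965541557380591484871532135331843831422215859803502520330770483336 >>> (4 * (16 * b.val + k.val))) % 16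

lemma tab_id1 : ∀ b j : Fin 48,
    t1 (cst b) j + t2 b j + t2 b (rg.symm j) + t2 b (rg.symm (rg.symm j)) =
      t1 (cst (rg b)) j + t2 b (rX.symm j) + 16 + if b = j then 3 else 0 := by
  decide +kernel

lemma tab_id2 : ∀ b j : Fin 48,
    t2 b j + t2 (rg b) j + t2 (rg (rg b)) j + t3 b (cst (rg.symm j)) =
      t2 (rX b) j + t3 b (cst j) + 16 + if b = j then 3 else 0 := by
  decide +kernel

lemma rg_rX : ∀ b, rg (rg (rg b)) = rX (rg (rX b)) := by decide +kernel
lemma cst_rX : ∀ b, cst (rX b) = cst b := by decide +kernel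

lemma cst_lpX : ∀ b, cst (lpX.symm b) = lcX.symm (cst b) := by decide +kernel
lemma rg_lpX : ∀ b, rg (lpX.symm b) = lpX.symm (rg b) := by decide +kernel
lemma rX_lpX : ∀ b, rX (lpX.symm b) = lpX.symm (rX b) := by decide +kernel
lemma cst_lpP : ∀ b, cst (lpP.symm b) = lcP.symm (cst b) := by decide +kernel
lemma rg_lpP : ∀ b, rg (lpP.symm b) = lpP.symm (rg b) := by decide +kernel
lemma rX_lpP : ∀ b, rX (lpP.symm b) = lpP.symm (rX b) := by decide +kernel
lemma cst_lpQ : ∀ b, cst (lpQ.symm b) = lcQ.symm (cst b) := by decide +kernel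
lemma rg_lpQ : ∀ b, rg (lpQ.symm b) = lpQ.symm (rg b) := by decide +kernel
lemma rX_lpQ : ∀ b, rX (lpQ.symm b) = lpQ.symm (rX b) := by decide +kernel
lemma cst_lpR : ∀ b, cst (lpR.symm b) = lcR.symm (cst b) := by decide +kernel
lemma rg_lpR : ∀ b, rg (lpR.symm b) = lpR.symm (rg b) := by decide +kernel
lemma rX_lpR : ∀ b, rX (lpR.symm b) = lpR.symm (rX b) := by decide +kernel

/-- Rank of a coset in a spanning tree. -/
def rk (k : Fin 16) : ℕ :=
  if k = 0 then 0 else if k = 9 ∨ k = 12 ∨ k = 13 then 1 else if k.val < 8 then 2 else 3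

lemma rk_step : ∀ k, k ≠ 0 → ∃ b, cst b = k ∧ rk (cst (rg b)) < rk k := by decide +kernel

lemma tree_induction {p : Fin 16 → Prop} (h0 : p 0) (hs : ∀ b, p (cst (rg b)) → p (cst b)) (k) :
    p k := by
  induction h : rk k using Nat.strong_induction_on generalizing k with
  | _ m ih =>
    by_cases hk : k = 0
    · rw [hk]; exact h0
    · obtain ⟨b, rfl, hb⟩ := rk_step k hk
      exact hs b (ih _ (h ▸ hb) _ rfl)

/-- The action on 48 points. -/
def φ48 (n : ℕ) (hn : 1 ≤ n) : Ostar n →* Equiv.Perm (Fin 48) :=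
  ostarHom n lpX lpP lpQ lpR
    (by
      obtain ⟨m, rfl⟩ := Nat.exists_eq_add_of_le' hn
      have h : lpX ^ 3 = 1 := Equiv.ext (by decide +kernel)
      rw [pow_succ', pow_mul, h, one_pow])
    (Equiv.ext (by decide +kernel)) (Equiv.ext (by decide +kernel))
    (Equiv.ext (by decide +kernel)) (Equiv.ext (by decide +kernel))
    (Equiv.ext (by decide +kernel)) (Equiv.ext (by decide +kernel))
    (Equiv.ext (by decide +kernel)) (Equiv.ext (by decide +kernel))
    (Equiv.ext (by decide +kernel))

lemma φ48_X (n : ℕ) (hn : 1 ≤ n) (x) : φ48 n hn (gen n .X)⁻¹ x = lpX.symm x := by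
  rw [map_inv]
  rfl

lemma φ48_P (n : ℕ) (hn : 1 ≤ n) (x) : φ48 n hn (gen n .P)⁻¹ x = lpP.symm x := by
  rw [map_inv]
  rfl

lemma φ48_Q (n : ℕ) (hn : 1 ≤ n) (x) : φ48 n hn (gen n .Q)⁻¹ x = lpQ.symm x := by
  rw [map_inv]
  rfl

lemma φ48_R (n : ℕ) (hn : 1 ≤ n) (x) : φ48 n hn (gen n .R)⁻¹ x = lpR.symm x := by
  rw [map_inv]
  rfl

lemma φ48_trans (n : ℕ) (hn : 1 ≤ n) (j) : ∃ g, φ48 n hn g 0 = j := by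
  refine ⟨gen n .P ^ (j.val / 3 % 4) * gen n .Q ^ (j.val / 3 / 4 % 2) * gen n .R ^ (j.val / 3 / 8) * gen n .X ^ (j.val % 3), ?_⟩
  simp only [map_mul, map_pow]
  change (lpP ^ (j.val / 3 % 4) * lpQ ^ (j.val / 3 / 4 % 2) * lpR ^ (j.val / 3 / 8) * lpX ^ (j.val % 3)) 0 = j
  revert j
  decide +kernel

/-- The action on 16 points. -/
def φ16 (n : ℕ) (hn : 1 ≤ n) : Ostar n →* Equiv.Perm (Fin 16) :=
  ostarHom n lcX lcP lcQ lcR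
    (by
      obtain ⟨m, rfl⟩ := Nat.exists_eq_add_of_le' hn
      have h : lcX ^ 3 = 1 := Equiv.ext (by decide +kernel)
      rw [pow_succ', pow_mul, h, one_pow])
    (Equiv.ext (by decide +kernel)) (Equiv.ext (by decide +kernel))
    (Equiv.ext (by decide +kernel)) (Equiv.ext (by decide +kernel))
    (Equiv.ext (by decide +kernel)) (Equiv.ext (by decide +kernel))
    (Equiv.ext (by decide +kernel)) (Equiv.ext (by decide +kernel))
    (Equiv.ext (by decide +kernel))

lemma φ16_X (n : ℕ) (hn : 1 ≤ n) (x) : φ16 n hn (gen n .X)⁻¹ x = lcX.symm x := by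
  rw [map_inv]
  rfl

lemma φ16_P (n : ℕ) (hn : 1 ≤ n) (x) : φ16 n hn (gen n .P)⁻¹ x = lcP.symm x := by
  rw [map_inv]
  rfl

lemma φ16_Q (n : ℕ) (hn : 1 ≤ n) (x) : φ16 n hn (gen n .Q)⁻¹ x = lcQ.symm x := by
  rw [map_inv]
  rfl

lemma φ16_R (n : ℕ) (hn : 1 ≤ n) (x) : φ16 n hn (gen n .R)⁻¹ x = lcR.symm x := by
  rw [map_inv]
  rfl

lemma φ16_trans (n : ℕ) (hn : 1 ≤ n) (j) : ∃ g, φ16 n hn g 0 = j := by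
  refine ⟨gen n .P ^ (j.val % 4) * gen n .Q ^ (j.val / 4 % 2) * gen n .R ^ (j.val / 8), ?_⟩
  simp only [map_mul, map_pow]
  change (lcP ^ (j.val % 4) * lcQ ^ (j.val / 4 % 2) * lcR ^ (j.val / 8)) 0 = j
  revert j
  decide +kernel

end OstarProof

namespace OstarProof
open CategoryTheory CategoryTheory.Limits

section Two
variable (R : Type) [CommRing R]

/-- First differential. -/
def e0lin : (Fin 16 → R) →ₗ[ℤ] (Fin 48 → R) where
  toFun f b := f (cst b) - f (cst (rg b))
  map_add' f f' := by ext x; simp; ring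
  map_smul' c f := by ext x; simp; ring

/-- Second differential. -/
def e1lin : (Fin 48 → R) →ₗ[ℤ] (Fin 48 → R) where
  toFun f b := f b + f (rg b) + f (rg (rg b)) - f (rX b)
  map_add' f f' := by ext x; simp; ring
  map_smul' c f := by ext x; simp; ring

/-- Sum over cosets. -/
def fibsum : (Fin 48 → R) →ₗ[ℤ] (Fin 16 → R) where
  toFun f k := ∑ b, if cst b = k then f b else 0
  map_add' f f' := by
    ext x
    rw [Pi.add_apply, ← Finset.sum_add_distrib]
    refine Finset.sum_congr rfl fun b _ => ?_
    split_ifs <;> simp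
  map_smul' c f := by
    ext x
    simp only [Pi.smul_apply, RingHom.id_apply]
    rw [Finset.smul_sum]
    refine Finset.sum_congr rfl fun b _ => ?_
    split_ifs <;> simp

/-- Difference. -/
def difflin : (Fin 48 → R) →ₗ[ℤ] (Fin 48 → R) where
  toFun f b := f (rg b) - f b
  map_add' f f' := by ext x; simp; ring
  map_smul' c f := by ext x; simp; ring

/-- Third differential. -/
def e2lin : (Fin 48 → R) →ₗ[ℤ] (Fin 16 → R) := (fibsum R).comp (difflin R)

lemma e2_apply (f : Fin 48 → R) (k) :
    e2lin R f k = ∑ b, if cst b = k then f (rg b) - f b else 0 := rfl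

lemma sum_fib (a : Fin 16 → R) (f : Fin 48 → R) :
    ∑ k, a k * fibsum R f k = ∑ b, a (cst b) * f b := by
  simp only [fibsum, LinearMap.coe_mk, AddHom.coe_mk, Finset.mul_sum]
  rw [Finset.sum_comm]
  refine Finset.sum_congr rfl fun b _ => ?_
  simp

lemma fib_rX (f : Fin 48 → R) : fibsum R (fun b => f (rX b)) = fibsum R f := by
  funext k
  change (∑ b, if cst b = k then f (rX b) else 0) = ∑ b, if cst b = k then f b else 0
  rw [← Equiv.sum_comp rX (fun b => if cst b = k then f b else 0)]
  simp only [cst_rX]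

lemma e1_e0 (f : Fin 16 → R) : e1lin R (e0lin R f) = 0 := by
  funext b
  change f (cst b) - f (cst (rg b)) + (f (cst (rg b)) - f (cst (rg (rg b)))) +
    (f (cst (rg (rg b))) - f (cst (rg (rg (rg b))))) - (f (cst (rX b)) - f (cst (rg (rX b)))) = 0
  rw [rg_rX, cst_rX, cst_rX]
  ring

lemma e2_e1 (f : Fin 48 → R) : e2lin R (e1lin R f) = 0 := by
  have h : difflin R (e1lin R f) =
      (fun b => (fun y => f (rX (rg y)) + f y) (rX b)) - (fun y => f (rX (rg y)) + f y) := by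
    funext b
    change f (rg b) + f (rg (rg b)) + f (rg (rg (rg b))) - f (rX (rg b)) -
      (f b + f (rg b) + f (rg (rg b)) - f (rX b)) =
      (f (rX (rg (rX b))) + f (rX b)) - (f (rX (rg b)) + f b)
    rw [rg_rX]
    ring
  rw [e2lin, LinearMap.comp_apply, h, map_sub, fib_rX R (fun y => f (rX (rg y)) + f y), sub_self]

/-- Signed table entries. -/
def s1 (k : Fin 16) (j : Fin 48) : R := (t1 k j : R) - 8
/-- Signed table entries. -/
def s2 (k : Fin 48) (j : Fin 48) : R := (t2 k j : R) - 8
/-- Signed table entries. -/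
def s3 (k : Fin 48) (j : Fin 16) : R := (t3 k j : R) - 8

lemma s_id1 (b j : Fin 48) :
    s1 R (cst b) j - s1 R (cst (rg b)) j + (s2 R b j + s2 R b (rg.symm j) +
      s2 R b (rg.symm (rg.symm j)) - s2 R b (rX.symm j)) = if b = j then 3 else 0 := by
  have h := congrArg (Nat.cast : ℕ → R) (tab_id1 b j)
  push_cast at h
  simp only [s1, s2]
  linear_combination h

lemma s_id2 (b j : Fin 48) :
    s2 R b j + s2 R (rg b) j + s2 R (rg (rg b)) j - s2 R (rX b) j +
      (s3 R b (cst (rg.symm j)) - s3 R b (cst j)) = if b = j then 3 else 0 := by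
  have h := congrArg (Nat.cast : ℕ → R) (tab_id2 b j)
  push_cast at h
  simp only [s2, s3]
  linear_combination h

lemma hom1 (F : Fin 48 → R) (b : Fin 48) :
    e0lin R (fun k => ∑ j, s1 R k j * F j) b + ∑ i, s2 R b i * e1lin R F i = 3 * F b := by
  have h1 : ∑ i, s2 R b i * F (rg i) = ∑ j, s2 R b (rg.symm j) * F j := by
    rw [← Equiv.sum_comp rg (fun j => s2 R b (rg.symm j) * F j)]
    simp
  have h2 : ∑ i, s2 R b i * F (rg (rg i)) = ∑ j, s2 R b (rg.symm (rg.symm j)) * F j := by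
    rw [← Equiv.sum_comp (rg.trans rg) (fun j => s2 R b (rg.symm (rg.symm j)) * F j)]
    simp
  have h3 : ∑ i, s2 R b i * F (rX i) = ∑ j, s2 R b (rX.symm j) * F j := by
    rw [← Equiv.sum_comp rX (fun j => s2 R b (rX.symm j) * F j)]
    simp
  have h4 : ∑ i, s2 R b i * e1lin R F i = ∑ i, s2 R b i * F i + ∑ i, s2 R b i * F (rg i) +
      ∑ i, s2 R b i * F (rg (rg i)) - ∑ i, s2 R b i * F (rX i) := by
    simp only [← Finset.sum_add_distrib, ← Finset.sum_sub_distrib]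
    refine Finset.sum_congr rfl fun i _ => ?_
    change _ * (F i + F (rg i) + F (rg (rg i)) - F (rX i)) = _
    ring
  rw [h4, h1, h2, h3]
  change ∑ j, s1 R (cst b) j * F j - ∑ j, s1 R (cst (rg b)) j * F j + _ = _
  simp only [← Finset.sum_add_distrib, ← Finset.sum_sub_distrib]
  rw [Finset.sum_congr rfl (g := fun j => if b = j then 3 * F j else 0)]
  · simp
  · intro j _
    have := s_id1 R b j
    split_ifs at this ⊢ <;> linear_combination F j * this

lemma hom2 (F : Fin 48 → R) (b : Fin 48) :
    e1lin R (fun k => ∑ j, s2 R k j * F j) b + ∑ k, s3 R b k * e2lin R F k = 3 * F b := by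
  have h1 : ∑ i, s3 R b (cst i) * F (rg i) = ∑ j, s3 R b (cst (rg.symm j)) * F j := by
    rw [← Equiv.sum_comp rg (fun j => s3 R b (cst (rg.symm j)) * F j)]
    simp
  have h4 : ∑ k, s3 R b k * e2lin R F k =
      ∑ j, s3 R b (cst j) * F (rg j) - ∑ j, s3 R b (cst j) * F j := by
    rw [e2lin, LinearMap.comp_apply, sum_fib, ← Finset.sum_sub_distrib]
    refine Finset.sum_congr rfl fun i _ => ?_
    change _ * (F (rg i) - F i) = _
    ring
  rw [h4, h1]
  change ∑ j, s2 R b j * F j + ∑ j, s2 R (rg b) j * F j + ∑ j, s2 R (rg (rg b)) j * F j -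
    ∑ j, s2 R (rX b) j * F j + _ = _
  simp only [← Finset.sum_add_distrib, ← Finset.sum_sub_distrib]
  rw [Finset.sum_congr rfl (g := fun j => if b = j then 3 * F j else 0)]
  · simp
  · intro j _
    have := s_id2 R b j
    split_ifs at this ⊢ <;> linear_combination F j * this

lemma e0_ker {f : Fin 16 → R} (h : e0lin R f = 0) (k) : f k = f 0 := by
  refine tree_induction (p := fun k => f k = f 0) rfl (fun b hb => ?_) k
  have : f (cst b) - f (cst (rg b)) = 0 := congrFun h b
  linear_combination this + hb

lemma fib_single (x : Fin 48) (r : R) : fibsum R (Pi.single x r) = Pi.single (cst x) r := by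
  funext k
  change (∑ b, if cst b = k then (Pi.single x r : Fin 48 → R) b else 0) = _
  rw [Finset.sum_eq_single x]
  · rw [Pi.single_eq_same, Pi.single_apply]
    simp only [eq_comm]
  · intro b _ hb
    rw [Pi.single_eq_of_ne hb, ite_self]
  · intro h
    exact absurd (Finset.mem_univ x) h

lemma e2_single (b : Fin 48) (r : R) : e2lin R (Pi.single (rg b) r) =
    Pi.single (cst b) r - Pi.single (cst (rg b)) r := by
  have h : difflin R (Pi.single (rg b) r) = Pi.single b r - Pi.single (rg b) r := by
    funext x
    change (Pi.single (rg b) r : Fin 48 → R) (rg x) - (Pi.single (rg b) r : Fin 48 → R) x =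
      (Pi.single b r : Fin 48 → R) x - (Pi.single (rg b) r : Fin 48 → R) x
    congr 1
    rw [Pi.single_apply, Pi.single_apply]
    simp only [EmbeddingLike.apply_eq_iff_eq]
  rw [e2lin, LinearMap.comp_apply, h, map_sub, fib_single, fib_single]

lemma e2_range {f : Fin 16 → R} (h : ∑ k, f k = 0) : ∃ F, e2lin R F = f := by
  have h1 : ∀ k, ∀ r : R, (Pi.single k r - Pi.single 0 r : Fin 16 → R) ∈
      LinearMap.range (e2lin R) := by
    intro k
    refine tree_induction (p := fun k => ∀ r : R, (Pi.single k r - Pi.single 0 r : Fin 16 → R) ∈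
      LinearMap.range (e2lin R)) (fun r => by simp) (fun b hb r => ?_) k
    have := Submodule.add_mem _ (hb r) ⟨Pi.single (rg b) r, e2_single R b r⟩
    rwa [add_comm, sub_add_sub_cancel] at this
  have h2 : f = ∑ k, (Pi.single k (f k) - Pi.single 0 (f k) : Fin 16 → R) := by
    rw [Finset.sum_sub_distrib, Finset.univ_sum_single]
    have : ∑ k, (Pi.single 0 (f k) : Fin 16 → R) = Pi.single 0 (∑ k, f k) :=
      (map_sum (AddMonoidHom.single (fun _ : Fin 16 => R) 0) f Finset.univ).symm
    rw [this, h, Pi.single_zero, sub_zero]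
  have h3 : f ∈ LinearMap.range (e2lin R) := by
    rw [h2]
    exact Submodule.sum_mem _ fun k _ => h1 k (f k)
  exact h3

lemma sum_e2 (F : Fin 48 → R) : ∑ k, e2lin R F k = 0 := by
  have h := sum_fib R (fun _ => 1) (difflin R F)
  simp only [one_mul] at h
  refine h.trans ?_
  change ∑ b, (F (rg b) - F b) = 0
  rw [Finset.sum_sub_distrib, Equiv.sum_comp rg F, sub_self]

variable (n : ℕ) (hn : 1 ≤ n)

/-- Functions on cosets. -/
abbrev Vc : Rep.{0} ℤ (Ostar n) := funRep R (φ16 n hn) 1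
/-- Functions on the group. -/
abbrev Vg : Rep.{0} ℤ (Ostar n) := funRep R (φ48 n hn) 1

/-- First map. -/
noncomputable def i2 : Rep.trivial ℤ (Ostar n) R ⟶ Vc R n hn :=
  homOfGens (constlin R) (by
    rintro (_ | _ | _ | _) v <;> funext x <;> rw [funρ_apply] <;> simp [constlin])

/-- Differential. -/
noncomputable def δ0 : Vc R n hn ⟶ Vg R n hn :=
  homOfGens (e0lin R) (by
    rintro (_ | _ | _ | _) v <;> funext x <;> rw [funρ_apply] <;>
      simp only [e0lin, LinearMap.coe_mk, AddHom.coe_mk, funρ_apply, φ16_X, φ16_P, φ16_Q, φ16_R,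
        φ48_X, φ48_P, φ48_Q, φ48_R, MonoidHom.one_apply, Units.val_one, one_smul,
        rg_lpX, rg_lpP, rg_lpQ, rg_lpR, cst_lpX, cst_lpP, cst_lpQ, cst_lpR])

/-- Differential. -/
noncomputable def δ1 : Vg R n hn ⟶ Vg R n hn :=
  homOfGens (e1lin R) (by
    rintro (_ | _ | _ | _) v <;> funext x <;> rw [funρ_apply] <;>
      simp only [e1lin, LinearMap.coe_mk, AddHom.coe_mk, funρ_apply,
        φ48_X, φ48_P, φ48_Q, φ48_R, MonoidHom.one_apply, Units.val_one, one_smul,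
        rg_lpX, rg_lpP, rg_lpQ, rg_lpR, rX_lpX, rX_lpP, rX_lpQ, rX_lpR])

lemma e2_equi (σ : Equiv.Perm (Fin 48)) (τ : Equiv.Perm (Fin 16))
    (h1 : ∀ b, rg (σ b) = σ (rg b)) (h2 : ∀ b, cst (σ b) = τ (cst b)) (f : Fin 48 → R) (k) :
    e2lin R (fun b => f (σ b)) k = e2lin R f (τ k) := by
  rw [e2_apply, e2_apply, ← Equiv.sum_comp σ (fun b => if cst b = τ k then f (rg b) - f b else 0)]
  refine Finset.sum_congr rfl fun b _ => ?_
  simp only [h1, h2, EmbeddingLike.apply_eq_iff_eq]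

/-- Differential. -/
noncomputable def δ2 : Vg R n hn ⟶ Vc R n hn :=
  homOfGens (e2lin R) (by
    rintro (_ | _ | _ | _) v <;> funext x <;> rw [funρ_apply] <;>
      simp only [MonoidHom.one_apply, Units.val_one, one_smul, φ16_X, φ16_P, φ16_Q, φ16_R]
    · rw [← e2_equi R lpX.symm lcX.symm rg_lpX cst_lpX]
      refine congrFun (congrArg (e2lin R) ?_) x; funext y; rw [funρ_apply, φ48_X]; simp
    · rw [← e2_equi R lpP.symm lcP.symm rg_lpP cst_lpP]
      refine congrFun (congrArg (e2lin R) ?_) x; funext y; rw [funρ_apply, φ48_P]; simp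
    · rw [← e2_equi R lpQ.symm lcQ.symm rg_lpQ cst_lpQ]
      refine congrFun (congrArg (e2lin R) ?_) x; funext y; rw [funρ_apply, φ48_Q]; simp
    · rw [← e2_equi R lpR.symm lcR.symm rg_lpR cst_lpR]
      refine congrFun (congrArg (e2lin R) ?_) x; funext y; rw [funρ_apply, φ48_R]; simp)

/-- The sum map. -/
noncomputable def p2 : Vc R n hn ⟶ Rep.trivial ℤ (Ostar n) R :=
  homOfGens (sumlin R) (by
    rintro (_ | _ | _ | _) v <;>
      simp only [sumlin, LinearMap.coe_mk, AddHom.coe_mk,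
        funρ_apply, MonoidHom.one_apply, Units.val_one, one_smul] <;>
      exact Equiv.sum_comp _ _)

lemma card_ostar (hn : 1 ≤ n) [Fintype (Ostar n)] : Fintype.card (Ostar n) = 16 * 3 ^ n := by
  apply le_antisymm
  · rw [← Nat.card_eq_fintype_card]
    exact ostar_card_le n
  · have h1 := fibre_card (φ16 n hn) 0 (φ16_trans n hn) 0
    have h2 := fibre_card (φ3 n) 0 (φ3_trans n) 0
    rw [Fintype.card_fin] at h1
    rw [ZMod.card] at h2
    refine Nat.le_of_dvd Fintype.card_pos ?_
    refine Nat.Coprime.mul_dvd_of_dvd_of_dvd (Nat.Coprime.pow_right _ (by norm_num))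
      (Dvd.intro_left _ h1) (Dvd.intro_left _ h2)

lemma fourTerm2 [Fintype (Ostar n)] (c : R) (hc : 3 * c = 1) :
    FourTerm (i2 R n hn) (δ0 R n hn) (δ1 R n hn) (δ2 R n hn) (p2 R n hn) := by
  have hpow : ∀ m : ℕ, ((3 ^ m : ℕ) : R) * c ^ m = 1 := by
    intro m
    push_cast
    rw [← mul_pow, hc, one_pow]
  have hcard := card_ostar n hn
  have hac : Acyc (Vc R n hn) :=
    funRep_acyc R _ _ 0 (φ16_trans n hn) (3 ^ n) (by rw [Fintype.card_fin, hcard, mul_comm]) _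
      (hpow n)
  have hag : Acyc (Vg R n hn) :=
    funRep_acyc R _ _ 0 (φ48_trans n hn) (3 ^ (n - 1)) (by
      rw [Fintype.card_fin, hcard]
      obtain ⟨m, rfl⟩ := Nat.exists_eq_add_of_le' hn
      rw [Nat.add_sub_cancel, pow_succ]
      ring) _ (hpow _)
  refine ⟨?_, ?_, ?_, ?_, ?_, ?_, hac, hag, hag, hac⟩
  · intro (a : R) (b : R) h
    exact congrFun h (0 : Fin 16)
  · intro (f : Fin 16 → R)
    constructor
    · intro h
      exact ⟨f 0, funext fun x => (e0_ker R h x).symm⟩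
    · rintro ⟨(a : R), rfl⟩
      funext b
      exact sub_self a
  · intro (f : Fin 48 → R)
    constructor
    · intro (h : e1lin R f = 0)
      refine ⟨(fun k => ∑ j, s1 R k j * (c * f j) : Fin 16 → R), funext fun (b : Fin 48) => ?_⟩
      have h1 := hom1 R (fun j => c * f j) b
      have h2 : e1lin R (fun j => c * f j) = 0 := by
        funext x
        have hx : f x + f (rg x) + f (rg (rg x)) - f (rX x) = 0 := congrFun h x
        change c * f x + c * f (rg x) + c * f (rg (rg x)) - c * f (rX x) = 0
        linear_combination c * hx
      rw [h2] at h1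
      simp only [Pi.zero_apply, mul_zero, Finset.sum_const_zero, add_zero] at h1
      exact h1.trans (by rw [← mul_assoc, hc, one_mul])
    · rintro ⟨(f : Fin 16 → R), rfl⟩
      exact e1_e0 R f
  · intro (f : Fin 48 → R)
    constructor
    · intro (h : e2lin R f = 0)
      refine ⟨(fun k => ∑ j, s2 R k j * (c * f j) : Fin 48 → R), funext fun (b : Fin 48) => ?_⟩
      have h1 := hom2 R (fun j => c * f j) b
      have h2 : e2lin R (fun j => c * f j) = 0 := by
        funext k
        have hx := congrFun h k
        rw [e2_apply] at hx ⊢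
        have : ∀ b, (if cst b = k then c * f (rg b) - c * f b else 0) =
            c * (if cst b = k then f (rg b) - f b else 0) := by
          intro b
          split_ifs <;> ring
        rw [Finset.sum_congr rfl fun b _ => this b, ← Finset.mul_sum, hx]
        simp
      rw [h2] at h1
      simp only [Pi.zero_apply, mul_zero, Finset.sum_const_zero, add_zero] at h1
      exact h1.trans (by rw [← mul_assoc, hc, one_mul])
    · rintro ⟨(f : Fin 48 → R), rfl⟩
      exact e2_e1 R f
  · intro (f : Fin 16 → R)
    constructor
    · intro h
      exact e2_range R h
    · rintro ⟨(f : Fin 48 → R), rfl⟩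
      exact sum_e2 R f
  · intro (a : R)
    refine ⟨(Pi.single 0 a : Fin 16 → R), ?_⟩
    change ∑ y, (Pi.single 0 a : Fin 16 → R) y = a
    simp

lemma inv_const {G ι : Type} [Group G] (φ : G →* Equiv.Perm ι) (i0 : ι)
    (ht : ∀ j, ∃ g, φ g i0 = j) {f : ι → R} (hf : f ∈ (funρ R φ 1).invariants) (x : ι) :
    f x = f i0 := by
  obtain ⟨g, rfl⟩ := ht x
  have := funRep_inv R φ 1 hf g (φ g i0)
  simpa using this.symm

lemma const_inv {G ι : Type} [Group G] (φ : G →* Equiv.Perm ι) (r : R) :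
    (fun _ => r : ι → R) ∈ (funρ R φ 1).invariants := by
  intro g
  funext t
  simp [funρ_apply]

lemma Rloc_tf {T : Submonoid ℕ} {m : ℕ} (hm : m ≠ 0) {x : Rloc T} (h : (m : Rloc T) * x = 0) :
    x = 0 := by
  have h' : ((m : Rloc T) : ℚ) * x.1 = 0 := congrArg Subtype.val h
  apply Subtype.ext
  simpa [hm] using h'

theorem part2 (n : ℕ) (hn : 1 ≤ n) [Fintype (Ostar n)] (l : ℕ) :
    Subsingleton (groupCohomology (Rep.trivial ℤ (Ostar n) (Rloc T2)) (1 + 4 * l)) ∧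
    Nonempty (groupCohomology (Rep.trivial ℤ (Ostar n) (Rloc T2)) (2 + 4 * l) ≃+ ZMod 2) ∧
    Subsingleton (groupCohomology (Rep.trivial ℤ (Ostar n) (Rloc T2)) (3 + 4 * l)) ∧
    Nonempty (groupCohomology (Rep.trivial ℤ (Ostar n) (Rloc T2)) (4 + 4 * l) ≃+ ZMod 16) := by
  obtain ⟨c, hc⟩ := Rloc_inv T2 (m := 3) (by change Odd 3; decide) (by norm_num)
  have H := fourTerm2 (Rloc T2) n hn c (by exact_mod_cast hc)
  have k16 : ∀ x : Rloc T2, ∀ y : Fin 16 → Rloc T2, (∀ t, y t = y 0) →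
      (∑ t, y t = x ↔ ((16 : ℕ) : Rloc T2) * y 0 = x) := by
    intro x y hy
    rw [Finset.sum_congr rfl (fun t _ => hy t)]
    simp
  have k48 : ∀ y : Fin 48 → Rloc T2, (∀ t, y t = y 0) →
      ∀ b, e1lin (Rloc T2) y b = ((2 : ℕ) : Rloc T2) * y 0 := by
    intro y hy b
    change y b + y (rg b) + y (rg (rg b)) - y (rX b) = _
    rw [hy b, hy (rg b), hy (rg (rg b)), hy (rX b)]
    push_cast
    ring
  have z48 : ∀ y : Fin 48 → Rloc T2, (∀ t, y t = y 0) → e2lin (Rloc T2) y = 0 := by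
    intro y hy
    funext k
    rw [e2_apply]
    refine Finset.sum_eq_zero fun b _ => ?_
    rw [hy b, hy (rg b)]
    simp
  have hodd : ∀ k, ∀ d ∈ T2, Nat.Coprime d (2 ^ k) := fun k d (hd : Odd d) =>
    Nat.Coprime.pow_right _ (Nat.coprime_two_right.2 hd)
  induction l with
  | zero =>
    refine ⟨H.h1 ?_, ?_, H.h3 ?_, ?_⟩
    · intro (x : Fin 48 → Rloc T2) hx (h : e1lin (Rloc T2) x = 0)
      have hx' := inv_const (Rloc T2) (φ48 n hn) 0 (φ48_trans n hn) hx
      have h0 : x 0 = 0 := Rloc_tf two_ne_zero ((k48 x hx' 0).symm.trans (congrFun h 0))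
      funext t
      exact (hx' t).trans h0
    · obtain ⟨ψ, hψ, hk⟩ := Rloc_quot T2 2 (hodd 1)
      refine H.h2 (ψ.comp (Pi.evalAddMonoidHom (fun _ : Fin 48 => Rloc T2) 0)) (fun c => ?_) ?_
      · obtain ⟨x, hx⟩ := hψ c
        exact ⟨fun _ => x, const_inv _ _ x, z48 (fun _ => x) fun _ => rfl, hx⟩
      · intro (x : Fin 48 → Rloc T2) hx _
        have hx' := inv_const (Rloc T2) (φ48 n hn) 0 (φ48_trans n hn) hx
        refine (hk (x 0)).trans ?_
        constructor
        · rintro ⟨y, hy⟩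
          refine ⟨fun _ => y, const_inv _ _ y, funext fun (t : Fin 48) => ?_⟩
          exact (k48 (fun _ => y) (fun _ => rfl) t).trans (hy.trans (hx' t).symm)
        · rintro ⟨(y : Fin 48 → Rloc T2), hy, hy'⟩
          have hy2 := inv_const (Rloc T2) (φ48 n hn) 0 (φ48_trans n hn) hy
          exact ⟨y 0, (k48 y hy2 0).symm.trans (congrFun hy' (0 : Fin 48))⟩
    · intro (x : Fin 16 → Rloc T2) hx (h : ∑ t, x t = 0)
      have hx' := inv_const (Rloc T2) (φ16 n hn) 0 (φ16_trans n hn) hx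
      rw [k16 0 x hx'] at h
      have h0 : x 0 = 0 := Rloc_tf (by norm_num) h
      funext t
      exact (hx' t).trans h0
    · obtain ⟨ψ, hψ, hk⟩ := Rloc_quot T2 16 (hodd 4)
      refine H.h4 ψ (fun c => ?_) ?_
      · obtain ⟨x, hx⟩ := hψ c
        exact ⟨x, fun g => rfl, hx⟩
      · intro (x : Rloc T2) _
        rw [hk]
        constructor
        · rintro ⟨y, hy⟩
          exact ⟨fun _ => y, const_inv _ _ y, (k16 x (fun _ => y) fun _ => rfl).2 hy⟩
        · rintro ⟨(y : Fin 16 → Rloc T2), hy, hy'⟩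
          exact ⟨y 0, (k16 x y (inv_const (Rloc T2) (φ16 n hn) 0 (φ16_trans n hn) hy)).1 hy'⟩
  | succ l ih =>
    obtain ⟨i1, ⟨i2⟩, i3, ⟨i4⟩⟩ := ih
    obtain ⟨e1⟩ := H.periodic (4 * l)
    obtain ⟨e2⟩ := H.periodic (4 * l + 1)
    obtain ⟨e3⟩ := H.periodic (4 * l + 2)
    obtain ⟨e4⟩ := H.periodic (4 * l + 3)
    rw [show 4 * l + 1 = 1 + 4 * l by ring, show 4 * l + 5 = 1 + 4 * (l + 1) by ring] at e1
    rw [show 4 * l + 1 + 1 = 2 + 4 * l by ring, show 4 * l + 1 + 5 = 2 + 4 * (l + 1) by ring] at e2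
    rw [show 4 * l + 2 + 1 = 3 + 4 * l by ring, show 4 * l + 2 + 5 = 3 + 4 * (l + 1) by ring] at e3
    rw [show 4 * l + 3 + 1 = 4 + 4 * l by ring, show 4 * l + 3 + 5 = 4 + 4 * (l + 1) by ring] at e4
    exact ⟨e1.symm.toEquiv.subsingleton, ⟨e2.symm.trans i2⟩,
      e3.symm.toEquiv.subsingleton, ⟨e4.symm.trans i4⟩⟩

end Two

/-- The Mayer–Vietoris decomposition in any degree at least two. -/
lemma mv' {G : Type} [Group G] [Fintype G] (k : ℕ) (hk : 2 ≤ k) :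
    Nonempty (groupCohomology (Rep.trivial ℤ G ℤ) k ≃+
      groupCohomology (Rep.trivial ℤ G (Rloc T1)) k ×
        groupCohomology (Rep.trivial ℤ G (Rloc T2)) k) := by
  obtain ⟨j, rfl⟩ := Nat.exists_eq_add_of_le' hk
  exact mv j

theorem main (n : ℕ) (hn : 1 ≤ n) (l : ℕ) :
    Subsingleton (intGroupCohomology (Ostar n) (1 + 4 * l)) ∧
    Nonempty (intGroupCohomology (Ostar n) (2 + 4 * l) ≃+ ZMod 2) ∧
    Subsingleton (intGroupCohomology (Ostar n) (3 + 4 * l)) ∧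
    Nonempty (intGroupCohomology (Ostar n) (4 + 4 * l) ≃+ ZMod (16 * 3 ^ n)) := by
  have : Fintype (Ostar n) := Fintype.ofFinite _
  obtain ⟨a1, a2, a3, ⟨a4⟩⟩ := part3 n (card_ostar n hn) l
  obtain ⟨b1, ⟨b2⟩, b3, ⟨b4⟩⟩ := part2 n hn l
  refine ⟨?_, ?_, ?_, ?_⟩
  · rcases l with _ | l
    · exact h1_trivial
    · obtain ⟨e⟩ := mv' (G := Ostar n) (1 + 4 * (l + 1)) (by omega)
      exact e.toEquiv.subsingleton
  · obtain ⟨e⟩ := mv' (G := Ostar n) (2 + 4 * l) (by omega)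
    have : Unique (groupCohomology (Rep.trivial ℤ (Ostar n) (Rloc T1)) (2 + 4 * l)) :=
      { default := 0, uniq := fun x => Subsingleton.elim x 0 }
    exact ⟨(e.trans AddEquiv.uniqueProd).trans b2⟩
  · obtain ⟨e⟩ := mv' (G := Ostar n) (3 + 4 * l) (by omega)
    exact e.toEquiv.subsingleton
  · obtain ⟨e⟩ := mv' (G := Ostar n) (4 + 4 * l) (by omega)
    have hc : Nat.Coprime 16 (3 ^ n) := Nat.Coprime.pow_right _ (by norm_num)
    exact ⟨((e.trans (a4.prodCongr b4)).trans AddEquiv.prodComm).trans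
      (ZMod.chineseRemainder hc).symm.toAddEquiv⟩

end OstarProof

/-- For every n ≥ 1 and l ≥ 0, the integral cohomology of O*ₙ is:
H^(1+4l) = 0, H^(2+4l) ≅ ℤ/2, H^(3+4l) = 0, H^(4+4l) ≅ ℤ/(16·3ⁿ). -/
theorem cohomology_Ostar (n : ℕ) (hn : 1 ≤ n) (l : ℕ) :
    Subsingleton (intGroupCohomology (Ostar n) (1 + 4 * l)) ∧
    Nonempty (intGroupCohomology (Ostar n) (2 + 4 * l) ≃+ ZMod 2) ∧
    Subsingleton (intGroupCohomology (Ostar n) (3 + 4 * l)) ∧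
    Nonempty (intGroupCohomology (Ostar n) (4 + 4 * l) ≃+ ZMod (16 * 3 ^ n)) := by
  exact OstarProof.main n hn l
end

section
/- For every n ≥ 1, the least period of O*ₙ is 4; that is, Hᵏ(O*ₙ) ≅ H^(k+4)(O*ₙ) for all k > 0, and there is no positive integer d < 4 such that Hᵏ(O*ₙ) ≅ H^(k+d)(O*ₙ) for all k > 0. -/
/-- A positive integer d is a period of G if Hᵏ(G) ≅ H^(k+d)(G) for all k > 0. -/
def IsCohomologyPeriod (G : Type) [Group G] (d : ℕ) : Prop :=
  0 < d ∧ ∀ k : ℕ, 0 < k →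
    Nonempty (intGroupCohomology G k ≃+ intGroupCohomology G (k + d))

open CategoryTheory

section general
variable {K G : Type} [CommRing K] [Group G]

instance gc_functor_additive (k : ℕ) : (groupCohomology.functor K G k).Additive := by
  change (groupCohomology.cochainsFunctor K G ⋙ HomologicalComplex.homologyFunctor _ _ k).Additive
  infer_instance

lemma gc_map_smul {A : Rep K G} (f : A ⟶ A) (c : ℕ) (hf : ∀ a : A, f.hom a = c • a) (k : ℕ)
    (x : groupCohomology A k) : groupCohomology.map (MonoidHom.id G) f k x = c • x := by
  have h1 : f = c • 𝟙 A := by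
    apply Rep.hom_ext
    apply Representation.IntertwiningMap.ext
    apply LinearMap.ext
    intro a
    change f.hom a = _
    rw [hf a]; rfl
  subst h1
  change ((groupCohomology.functor K G k).map (c • 𝟙 A)) x = c • x
  rw [Functor.map_nsmul, CategoryTheory.Functor.map_id]
  rfl

lemma gc_kill [Fintype G] (A : Rep K G) (w : A.V →ₗ[K] A.V) (c : ℕ)
    (h : ∀ a, ∑ g : G, A.ρ g⁻¹ (w (A.ρ g a)) = c • a) (k : ℕ)
    (x : groupCohomology A (k + 1)) : c • x = 0 := by
  let B : Rep K (⊥ : Subgroup G) := Rep.trivial K _ A.V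
  let C := Rep.coind (⊥ : Subgroup G).subtype B
  let i : A ⟶ C := Rep.ofHom
    { toFun := fun a => ⟨fun g => A.ρ g a, by
        intro s g
        have : s = 1 := Subsingleton.elim _ _
        subst this; simp⟩
      map_add' := by intros; ext; simp
      map_smul' := by intros; ext; simp
      isIntertwining' := by intro g; ext a h
                            change A.ρ h (A.ρ g a) = A.ρ (h * g) a
                            simp }
  let p : C ⟶ A := Rep.ofHom
    { toFun := fun f => ∑ g : G, A.ρ g⁻¹ (w (f.1 g))
      map_add' := by intros; simp [Finset.sum_add_distrib]
      map_smul' := by intros; simp [Finset.smul_sum]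
      isIntertwining' := by
        intro g; ext f
        change ∑ h : G, A.ρ h⁻¹ (w (f.1 (h * g))) = A.ρ g (∑ h : G, A.ρ h⁻¹ (w (f.1 h)))
        rw [map_sum]
        refine Fintype.sum_equiv (Equiv.mulRight g) _ _ fun a => ?_
        rw [← Module.End.mul_apply (A.ρ g), ← map_mul]
        simp }
  have hz : Limits.IsZero (groupCohomology C (k+1)) :=
    (isZero_groupCohomology_succ_of_subsingleton B k).of_iso (groupCohomology.coindIso B (k+1))
  have hc : ∀ a : A, (i ≫ p).hom a = c • a := by
    intro a
    exact h a
  rw [← gc_map_smul (i ≫ p) c hc, groupCohomology.map_id_comp]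
  have := ModuleCat.subsingleton_of_isZero hz
  simp [Subsingleton.elim (groupCohomology.map (MonoidHom.id G) i (k + 1) x) 0]

/-- the `q`-torsion -/
def tors (M : Type) [AddCommGroup M] (q : ℕ) : AddSubgroup M := (nsmulAddMonoidHom (α := M) q).ker

lemma mem_tors {M : Type} [AddCommGroup M] {q : ℕ} {x : M} : x ∈ tors M q ↔ q • x = 0 := Iff.rfl

/-- coprime devissage -/
lemma tors_equiv {A M N B : Type} [AddCommGroup A] [AddCommGroup M] [AddCommGroup N]
    [AddCommGroup B] (f : A →+ M) (g : M →+ N) (h : N →+ B) (hfg : Function.Exact f g)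
    (hgh : Function.Exact g h) (c q : ℕ) (hcq : Nat.Coprime c q)
    (hA : ∀ a : A, c • a = 0) (hB : ∀ b : B, c • b = 0) :
    Nonempty (tors M q ≃+ tors N q) := by
  obtain ⟨u, v, huv⟩ : ∃ u v : ℤ, u * c + v * q = 1 :=
    Int.isCoprime_iff_gcd_eq_one.2 (by simpa using hcq)
  have key : ∀ {T : Type} [AddCommGroup T] (t : T), c • t = 0 → q • t = 0 → t = 0 := by
    intro T _ t h1 h2
    have : t = (u * c + v * q : ℤ) • t := by rw [huv]; simp
    rw [this, add_smul, mul_smul, mul_smul]; simp [h1, h2]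
  let φ : tors M q →+ tors N q :=
    (g.comp (tors M q).subtype).codRestrict (tors N q) (fun x => by
      have := mem_tors.1 x.2
      rw [mem_tors]; simp [← map_nsmul, this])
  refine ⟨AddEquiv.ofBijective φ ⟨?_, ?_⟩⟩
  · rw [injective_iff_map_eq_zero]
    rintro ⟨x, hx⟩ h0
    have h0 : g x = 0 := congrArg Subtype.val h0
    obtain ⟨a, rfl⟩ := (hfg x).1 h0
    ext
    exact key _ (by rw [← map_nsmul, hA, map_zero]) hx
  · rintro ⟨y, hy⟩
    rw [mem_tors] at hy
    obtain ⟨x, rfl⟩ := (hgh y).1 (key (h y) (hB _) (by rw [← map_nsmul, hy, map_zero]))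
    have h1 : g (q • x) = 0 := by rw [map_nsmul, hy]
    obtain ⟨a, ha⟩ := (hfg _).1 h1
    have h2 : c • q • x = 0 := by rw [← ha, ← map_nsmul, hA, map_zero]
    refine ⟨⟨(u * c) • x, ?_⟩, ?_⟩
    · rw [mem_tors, smul_comm, mul_smul]
      simp [smul_comm q c, h2]
    · ext
      change g ((u * c) • x) = g x
      have : u * c = 1 - v * q := by linarith
      rw [map_zsmul, this, sub_smul, mul_smul]
      simp [hy]

lemma fe_of_exact {S : ShortComplex (ModuleCat K)} (h : S.Exact) :
    Function.Exact S.f.hom S.g.hom := by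
  intro x
  refine ⟨fun hx => (ShortComplex.moduleCat_exact_iff S).1 h x hx, ?_⟩
  rintro ⟨y, rfl⟩
  exact S.moduleCat_zero_apply y

open groupCohomology in
lemma gc_shift {X : ShortComplex (Rep K G)} (hX : X.ShortExact) (c q : ℕ) (hcq : Nat.Coprime c q)
    (hk : ∀ k, ∀ x : groupCohomology X.X₂ (k+1), c • x = 0) (k : ℕ) :
    Nonempty (tors (groupCohomology X.X₃ (k+1)) q ≃+ tors (groupCohomology X.X₁ (k+2)) q) := by
  have h3 := (mapShortComplex₃_exact hX (i := k+1) (j := k+2) rfl)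
  have h1 := (mapShortComplex₁_exact hX (i := k+1) (j := k+2) rfl)
  have h1 := fe_of_exact h1
  have h3 := fe_of_exact h3
  exact tors_equiv (mapShortComplex₃ hX (i := k+1) (j := k+2) rfl).f.hom.toAddMonoidHom
    (δ hX (k+1) (k+2) rfl).hom.toAddMonoidHom 
    (mapShortComplex₁ hX (i := k+1) (j := k+2) rfl).g.hom.toAddMonoidHom h3 h1 c q hcq
    (hk k) (hk (k+1))

/-- kernel of a morphism, concretely -/
noncomputable abbrev kerRep {A B : Rep K G} (f : A ⟶ B) : Rep K G :=
  A.subrepresentation (LinearMap.ker f.hom.toLinearMap) (by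
    intro g a ha
    have ha : f.hom a = 0 := ha
    change f.hom (A.ρ g a) = 0
    rw [Rep.hom_comm_apply, ha, map_zero])

lemma ses_of {A B C : Rep K G} (f : A ⟶ B) (g : B ⟶ C) (hf : Function.Injective f.hom)
    (hg : Function.Surjective g.hom) (h : Function.Exact f.hom g.hom) :
    ∃ w : f ≫ g = 0, (ShortComplex.mk f g w).ShortExact := by
  have w : f ≫ g = 0 := by
    apply Rep.hom_ext
    apply Representation.IntertwiningMap.ext
    apply LinearMap.ext
    intro a
    exact h.apply_apply_eq_zero a
  refine ⟨w, @ShortComplex.ShortExact.mk _ _ _ _ ?_ ((Rep.mono_iff_injective f).2 hf)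
    ((Rep.epi_iff_surjective g).2 hg)⟩
  refine ((ShortComplex.mk f g w).exact_map_iff_of_faithful (forget₂ (Rep K G) (ModuleCat K))).1 ?_
  rw [ShortComplex.moduleCat_exact_iff]
  exact fun x hx => (h x).1 hx

end general

section general2
variable {K G : Type} [CommRing K] [Group G]

/-- corestriction to a kernel -/
noncomputable def toKer {A B C : Rep K G} (f : A ⟶ B) (g : B ⟶ C)
    (h : Function.Exact f.hom g.hom) : A ⟶ kerRep g := Rep.ofHom
  { toLinearMap := f.hom.toLinearMap.codRestrict (LinearMap.ker g.hom.toLinearMap)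
      (fun a => h.apply_apply_eq_zero a)
    isIntertwining' := by
      intro s
      apply LinearMap.ext
      intro a
      apply Subtype.ext
      exact Rep.hom_comm_apply f s a }

lemma toKer_val {A B C : Rep K G} (f : A ⟶ B) (g : B ⟶ C)
    (h : Function.Exact f.hom g.hom) (a : A) : ((toKer f g h).hom a).1 = f.hom a := rfl

/-- inclusion of a kernel -/
noncomputable def kerι {A B : Rep K G} (f : A ⟶ B) : kerRep f ⟶ A := Rep.subtype ..

lemma kerι_apply {A B : Rep K G} (f : A ⟶ B) (x : kerRep f) : (kerι f).hom x = x.1 := rfl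

lemma shift_of {A B C : Rep K G} (f : A ⟶ B) (g : B ⟶ C) (hf : Function.Injective f.hom)
    (hg : Function.Surjective g.hom) (h : Function.Exact f.hom g.hom)
    (c q : ℕ) (hcq : Nat.Coprime c q)
    (hk : ∀ k, ∀ x : groupCohomology B (k+1), c • x = 0) (k : ℕ) :
    Nonempty (tors (groupCohomology C (k+1)) q ≃+ tors (groupCohomology A (k+2)) q) := by
  obtain ⟨w, hX⟩ := ses_of f g hf hg h
  exact gc_shift hX c q hcq hk k

lemma toKer_surj {A B C : Rep K G} (f : A ⟶ B) (g : B ⟶ C)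
    (h : Function.Exact f.hom g.hom) : Function.Surjective (toKer f g h).hom := by
  rintro ⟨b, hb⟩
  obtain ⟨a, rfl⟩ := (h b).1 hb
  exact ⟨a, rfl⟩

lemma kerι_inj {A B : Rep K G} (f : A ⟶ B) : Function.Injective (kerι f).hom :=
  Subtype.val_injective

lemma exact_toKer {Z A B C : Rep K G} (i : Z ⟶ A) (f : A ⟶ B) (g : B ⟶ C)
    (h : Function.Exact f.hom g.hom) (hi : Function.Exact i.hom f.hom) :
    Function.Exact i.hom (toKer f g h).hom := by
  intro x
  rw [← hi x]
  constructor
  · intro h0; exact congrArg Subtype.val h0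
  · intro h0; exact Subtype.ext h0

lemma exact_kerι {A B : Rep K G} (f : A ⟶ B) : Function.Exact (kerι f).hom f.hom := by
  intro x
  constructor
  · intro h0; exact ⟨⟨x, h0⟩, rfl⟩
  · rintro ⟨y, rfl⟩; exact y.2

lemma four_term {Z M3 M2 M1 M0 Z' : Rep K G} (i : Z ⟶ M3) (d3 : M3 ⟶ M2) (d2 : M2 ⟶ M1)
    (d1 : M1 ⟶ M0) (e : M0 ⟶ Z') (hi : Function.Injective i.hom)
    (h3 : Function.Exact i.hom d3.hom) (h2 : Function.Exact d3.hom d2.hom)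
    (h1 : Function.Exact d2.hom d1.hom) (h0 : Function.Exact d1.hom e.hom)
    (he : Function.Surjective e.hom)
    (c q : ℕ) (hcq : Nat.Coprime c q)
    (k3 : ∀ k, ∀ x : groupCohomology M3 (k+1), c • x = 0)
    (k2 : ∀ k, ∀ x : groupCohomology M2 (k+1), c • x = 0)
    (k1 : ∀ k, ∀ x : groupCohomology M1 (k+1), c • x = 0)
    (k0 : ∀ k, ∀ x : groupCohomology M0 (k+1), c • x = 0) :
    (∀ k, Nonempty (tors (groupCohomology (kerRep e) (k+1)) q ≃+
      tors (groupCohomology Z (k+4)) q)) ∧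
    (∀ k, Nonempty (tors (groupCohomology Z' (k+1)) q ≃+
      tors (groupCohomology Z (k+5)) q)) := by
  have A : ∀ k, Nonempty (tors (groupCohomology (kerRep e) (k+1)) q ≃+
      tors (groupCohomology Z (k+4)) q) := by
    intro k
    obtain ⟨e1⟩ := shift_of (kerι d1) (toKer d1 e h0) (kerι_inj _) (toKer_surj _ _ _)
      (exact_toKer _ _ _ _ (exact_kerι _)) c q hcq k1 k
    obtain ⟨e2⟩ := shift_of (kerι d2) (toKer d2 d1 h1) (kerι_inj _) (toKer_surj _ _ _)
      (exact_toKer _ _ _ _ (exact_kerι _)) c q hcq k2 (k+1)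
    obtain ⟨e3⟩ := shift_of i (toKer d3 d2 h2) hi (toKer_surj _ _ _)
      (exact_toKer _ _ _ _ h3) c q hcq k3 (k+2)
    exact ⟨e1.trans (e2.trans e3)⟩
  refine ⟨A, fun k => ?_⟩
  obtain ⟨e1⟩ := A (k+1)
  obtain ⟨e0⟩ := shift_of (kerι e) e (kerι_inj _) he (exact_kerι _) c q hcq k0 k
  exact ⟨e0.trans e1⟩

open groupCohomology in
lemma delta_ne {A C : Rep K G} (g : A ⟶ C)
    (hg : Function.Surjective g.hom) (N : ℕ) (z : C.ρ.invariants)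
    (h1 : ∀ a : A.ρ.invariants, g.hom a.1 ≠ z.1)
    (h2 : ∃ a : A.ρ.invariants, g.hom a.1 = N • z.1) :
    ∃ x : groupCohomology (kerRep g) 1, x ≠ 0 ∧ N • x = 0 := by
  obtain ⟨w, hX⟩ := ses_of (kerι g) g (kerι_inj g) hg (exact_kerι g)
  have h3 := fe_of_exact (mapShortComplex₃_exact hX (i := 0) (j := 1) rfl)
  have key : ∀ y : groupCohomology A 0, (H0Iso C).hom (map (MonoidHom.id G) g 0 y) =
      (Rep.invariantsFunctor K G).map g ((H0Iso A).hom y) := by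
    intro y
    exact congrArg (fun t => t.hom y) (map_id_comp_H0Iso_hom g)
  refine ⟨δ hX 0 1 rfl ((H0Iso C).inv z), ?_, ?_⟩
  · intro h0
    obtain ⟨y, hy⟩ := (h3 _).1 h0
    have hy : map (MonoidHom.id G) g 0 y = (H0Iso C).inv z := hy
    have := key y
    rw [hy] at this
    have e1 : (H0Iso C).hom ((H0Iso C).inv z) = z := by simp
    rw [e1] at this
    exact h1 ((H0Iso A).hom y) (congrArg Subtype.val this).symm
  · obtain ⟨a, ha⟩ := h2
    have e2 : map (MonoidHom.id G) g 0 ((H0Iso A).inv a) = (H0Iso C).inv (N • z) := by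
      have := key ((H0Iso A).inv a)
      have e1 : (H0Iso A).hom ((H0Iso A).inv a) = a := by simp
      rw [e1] at this
      have e3 : (Rep.invariantsFunctor K G).map g a = N • z := Subtype.ext ha
      rw [e3] at this
      have hinv : ∀ t, (H0Iso C).inv ((H0Iso C).hom t) = t := by intro t; simp
      rw [← this]; exact (hinv _).symm
    have e4 : δ hX 0 1 rfl ((H0Iso C).inv (N • z)) = 0 := (h3 _).2 ⟨_, e2⟩
    rw [map_nsmul, map_nsmul] at e4
    exact e4

open groupCohomology in
lemma H1_sub (A : Type) [AddCommGroup A] [Module K A] (h : ∀ f : Additive G →+ A, f = 0)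
    (x : groupCohomology (Rep.trivial K G A) 1) : x = 0 := by
  have : (H1IsoOfIsTrivial (Rep.trivial K G A)).hom x = 0 := h _
  have h2 : (H1IsoOfIsTrivial (Rep.trivial K G A)).inv
    ((H1IsoOfIsTrivial (Rep.trivial K G A)).hom x) = x := by simp
  rw [← h2, this, map_zero]

open groupCohomology in
lemma H2_tors (p : ℕ) [NeZero p] (h : ∀ f : Additive G →+ ZMod p, f = 0)
    (x : groupCohomology (Rep.trivial ℤ G ℤ) 2) (hx : p • x = 0) : x = 0 := by
  let f : Rep.trivial ℤ G ℤ ⟶ Rep.trivial ℤ G ℤ := Rep.ofHom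
    { toLinearMap := (p : ℤ) • LinearMap.id
      isIntertwining' := by intro g; rfl }
  let g : Rep.trivial ℤ G ℤ ⟶ Rep.trivial ℤ G (ZMod p) := Rep.ofHom
    { toLinearMap := (Int.castAddHom (ZMod p)).toIntLinearMap
      isIntertwining' := by intro g; rfl }
  have hf : ∀ a : ℤ, f.hom a = p * a := fun a => rfl
  have hg : ∀ a : ℤ, g.hom a = (a : ZMod p) := fun a => rfl
  have hp : (p : ℤ) ≠ 0 := by exact_mod_cast NeZero.ne p
  obtain ⟨w, hX⟩ := ses_of f g (by
      intro a b hab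
      exact mul_left_cancel₀ hp hab)
    (ZMod.intCast_surjective) (by
      intro a
      change ((a : ℤ) : ZMod p) = 0 ↔ ∃ b : ℤ, p * b = a
      rw [ZMod.intCast_zmod_eq_zero_iff_dvd]
      exact ⟨fun ⟨b, hb⟩ => ⟨b, hb.symm⟩, fun ⟨b, hb⟩ => ⟨b, hb.symm⟩⟩)
  have h1 := fe_of_exact (mapShortComplex₁_exact hX (i := 1) (j := 2) rfl)
  have e1 : map (MonoidHom.id G) f 2 x = 0 := by
    rw [gc_map_smul f p (fun a => by change (p : ℤ) * a = p • a; simp), hx]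
  obtain ⟨y, hy⟩ := (h1 x).1 e1
  have : y = 0 := H1_sub (K := ℤ) (ZMod p) h y
  rw [← hy, this, map_zero]; rfl

/-- signed permutation representation -/
noncomputable abbrev pRep {ι : Type} (χ : G →* ℤˣ) (φ : G →* Equiv.Perm ι) : Rep ℤ G :=
  Rep.of (k := ℤ) (X := ι → ℤ)
    { toFun := fun g =>
        { toFun := fun f i => (χ g : ℤ) * f ((φ g)⁻¹ i)
          map_add' := by intros; ext; simp [mul_add]
          map_smul' := by intros; ext; simp [mul_left_comm] }
      map_one' := by ext; simp
      map_mul' := by intros; ext; simp [mul_assoc] }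

lemma pRep_apply {ι : Type} (χ : G →* ℤˣ) (φ : G →* Equiv.Perm ι) (g : G) (f : ι → ℤ) (i : ι) :
    (pRep χ φ).ρ g f i = (χ g : ℤ) * f ((φ g)⁻¹ i) := rfl

lemma pRep_kill [Fintype G] {ι : Type} [DecidableEq ι] (χ : G →* ℤˣ) (φ : G →* Equiv.Perm ι)
    (S : Finset ι) (c : ℕ) (hS : ∀ j, (Finset.univ.filter fun g => φ g j ∈ S).card = c) (k : ℕ)
    (x : groupCohomology (pRep χ φ) (k+1)) : c • x = 0 := by
  refine gc_kill (pRep χ φ) { toFun := fun f i => if i ∈ S then f i else 0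
                              map_add' := ?_, map_smul' := ?_ } c ?_ k x
  · intros; ext; simp; split_ifs <;> simp
  · intros; ext; simp
  · intro a
    funext j
    rw [Finset.sum_apply]
    have : ∀ g : G, (pRep χ φ).ρ g⁻¹ (fun i => if i ∈ S then ((pRep χ φ).ρ g a) i else 0) j
        = if φ g j ∈ S then a j else 0 := by
      intro g
      rw [pRep_apply]
      simp only [map_inv, inv_inv]
      split_ifs
      · rw [pRep_apply]
        simp [← mul_assoc, ← Units.val_mul]
      · simp
    refine (Finset.sum_congr rfl fun g _ => this g).trans ?_
    rw [← Finset.sum_filter, Finset.sum_const, hS]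
    rfl

lemma triv_kill [Fintype G] (k : ℕ)
    (x : groupCohomology (Rep.trivial ℤ G ℤ) (k+1)) : Fintype.card G • x = 0 := by
  refine gc_kill _ LinearMap.id _ ?_ k x
  intro a
  simp

lemma trans_count [Fintype G] {ι : Type} [DecidableEq ι] [Fintype ι] (φ : G →* Equiv.Perm ι)
    (i₀ : ι) (ht : ∀ j, ∃ g, φ g i₀ = j) (j : ι) :
    Fintype.card ι * (Finset.univ.filter fun g => φ g j = i₀).card = Fintype.card G := by
  have hle : ∀ j k : ι, (Finset.univ.filter fun g => φ g j = i₀).card ≤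
      (Finset.univ.filter fun g => φ g k = i₀).card := by
    intro j k
    obtain ⟨a, ha⟩ := ht j
    obtain ⟨b, hb⟩ := ht k
    refine Finset.card_le_card_of_injOn (fun g => g * (a * b⁻¹)) ?_ ?_
    · intro g hg
      simp only [Finset.coe_filter, Finset.mem_univ, true_and, Set.mem_ofPred_eq] at hg ⊢
      have : (φ b)⁻¹ k = i₀ := by rw [← hb]; simp
      simp only [map_mul, map_inv, Equiv.Perm.mul_apply, this, ha, hg]
    · intro g _ h _ hgh
      exact mul_right_cancel hgh
  have hs : ∑ k : ι, (Finset.univ.filter fun g => φ g k = i₀).card = Fintype.card G := by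
    simp only [Finset.card_filter]
    rw [Finset.sum_comm]
    have : ∀ g : G, (∑ k : ι, if φ g k = i₀ then 1 else 0) = 1 := by
      intro g
      rw [Finset.sum_eq_single ((φ g)⁻¹ i₀)]
      · simp
      · intro b _ hb
        rw [if_neg]
        rintro rfl
        exact hb (by simp)
      · simp
    simp [this]
  have h2 : ∀ k, (Finset.univ.filter fun g => φ g k = i₀).card =
      (Finset.univ.filter fun g => φ g j = i₀).card := fun k => le_antisymm (hle _ _) (hle _ _)
  simpa only [h2, Finset.sum_const, Finset.card_univ, smul_eq_mul] using hs

lemma trans_count' [Fintype G] {ι : Type} [DecidableEq ι] [Fintype ι] (φ : G →* Equiv.Perm ι)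
    (i₀ : ι) (ht : ∀ j, ∃ g, φ g i₀ = j) (c : ℕ) (hc : Fintype.card G = Fintype.card ι * c) (j : ι) :
    (Finset.univ.filter fun g => φ g j = i₀).card = c := by
  have hpos : 0 < Fintype.card ι := Fintype.card_pos_iff.2 ⟨i₀⟩
  exact Nat.eq_of_mul_eq_mul_left hpos ((trans_count φ i₀ ht j).trans hc)
end general2

section sparse

/-- evaluation of a sparse vector -/
def ev (L : List (ℕ × ℤ)) (F : ℕ → ℤ) : ℤ := (L.map fun p => p.2 * F p.1).sum

/-- coefficient in a sparse vector -/
def coef (L : List (ℕ × ℤ)) (k : ℕ) : ℤ := L.foldr (fun p a => if p.1 = k then p.2 + a else a) 0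

/-- check that a sparse vector is zero -/
def nul (L : List (ℕ × ℤ)) : Bool := L.all fun p => decide (coef L p.1 = 0)

/-- decode an entry -/
def dec1 (e : ℕ) : ℕ × ℤ := (e / 2, if e % 2 = 0 then 1 else -1)

/-- row of a table -/
def row (M : List (List ℕ)) (i : ℕ) : List (ℕ × ℤ) := (M.getD i []).map dec1

/-- composition -/
def mcomp (L : List (ℕ × ℤ)) (N : ℕ → List (ℕ × ℤ)) : List (ℕ × ℤ) :=
  L.flatMap fun p => (N p.1).map fun q => (q.1, p.2 * q.2)

lemma ev_nil (F : ℕ → ℤ) : ev [] F = 0 := rfl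

lemma ev_cons (p) (L : List (ℕ × ℤ)) (F : ℕ → ℤ) : ev (p :: L) F = p.2 * F p.1 + ev L F := by
  simp [ev]

lemma ev_append (L L' : List (ℕ × ℤ)) (F : ℕ → ℤ) : ev (L ++ L') F = ev L F + ev L' F := by
  simp [ev]

lemma ev_mcomp (L : List (ℕ × ℤ)) (N : ℕ → List (ℕ × ℤ)) (F : ℕ → ℤ) :
    ev (mcomp L N) F = ev L (fun k => ev (N k) F) := by
  induction L with
  | nil => rfl
  | cons p L ih =>
    have : ∀ l : List (ℕ × ℤ), ev (l.map fun q => (q.1, p.2 * q.2)) F = p.2 * ev l F := by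
      intro l
      induction l with
      | nil => simp [ev]
      | cons q l ih => simp only [List.map_cons, ev_cons, ih]; ring
    rw [ev_cons, ← ih, ← this, ← ev_append]; rfl

lemma ev_map (L : List (ℕ × ℤ)) (r : ℕ → ℕ) (F : ℕ → ℤ) :
    ev (L.map fun p => (r p.1, p.2)) F = ev L (fun k => F (r k)) := by
  simp [ev, Function.comp_def]

lemma ev_neg (L : List (ℕ × ℤ)) (F : ℕ → ℤ) :
    ev (L.map fun p => (p.1, -p.2)) F = - ev L F := by
  induction L with
  | nil => simp [ev]
  | cons p L ih => simp only [List.map_cons, ev_cons, ih]; ring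

lemma ev_eq_sum (L : List (ℕ × ℤ)) (F : ℕ → ℤ) (T : Finset ℕ) (hT : ∀ p ∈ L, p.1 ∈ T) :
    ev L F = ∑ k ∈ T, coef L k * F k := by
  induction L with
  | nil => simp [ev, coef]
  | cons p L ih =>
    have h1 : ∀ k, coef (p :: L) k = (if p.1 = k then p.2 else 0) + coef L k := by
      intro k
      change (if p.1 = k then p.2 + coef L k else coef L k) = _
      split_ifs <;> simp
    rw [ev_cons, ih (fun q hq => hT q (List.mem_cons_of_mem _ hq))]
    simp only [h1, add_mul, Finset.sum_add_distrib]
    congr 1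
    rw [Finset.sum_eq_single p.1]
    · simp
    · intro b _ hb; rw [if_neg (Ne.symm hb)]; simp
    · intro h; exact absurd (hT p List.mem_cons_self) h

lemma ev_nul (L : List (ℕ × ℤ)) (h : nul L = true) (F : ℕ → ℤ) : ev L F = 0 := by
  rw [ev_eq_sum L F (L.map Prod.fst).toFinset (by intro p hp; simp; exact ⟨p.2, hp⟩)]
  apply Finset.sum_eq_zero
  intro k hk
  simp only [List.mem_toFinset, List.mem_map] at hk
  obtain ⟨p, hp, rfl⟩ := hk
  have := List.all_eq_true.1 h p hp
  rw [of_decide_eq_true this, zero_mul]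

/-- an enumerated index type -/
structure Ix (ι : Type) where
  /-- size -/
  m : ℕ
  /-- encoding -/
  en : ι → ℕ
  /-- decoding -/
  dc : ℕ → ι
  lt : ∀ i, en i < m
  h : ∀ i, dc (en i) = i

/-- operator given by a sparse matrix -/
def mat {ι κ : Type} (M : List (List ℕ)) (a : Ix ι) (b : Ix κ) : (κ → ℤ) →ₗ[ℤ] (ι → ℤ) where
  toFun f i := ev (row M (a.en i)) (fun k => f (b.dc k))
  map_add' f g := by ext i; simp [ev, mul_add]
  map_smul' c f := by
    ext i
    simp only [ev, Pi.smul_apply, smul_eq_mul, RingHom.id_apply, mul_left_comm _ c]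
    rw [List.sum_map_mul_left]

/-- rows of a composite -/
def mm {κ : Type} (M N : List (List ℕ)) (b : Ix κ) (i : ℕ) : List (ℕ × ℤ) :=
  mcomp (row M i) (fun k => row N (b.en (b.dc k)))

lemma ev_mm {ι κ τ : Type} (M N : List (List ℕ)) (a : Ix ι) (b : Ix κ) (c : Ix τ)
    (f : τ → ℤ) (i : ι) :
    mat M a b (mat N b c f) i = ev (mm M N b (a.en i)) (fun k => f (c.dc k)) := by
  rw [mm, ev_mcomp]; rfl

lemma mat_comp_zero {ι κ τ : Type} (M N : List (List ℕ)) (a : Ix ι) (b : Ix κ) (c : Ix τ)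
    (h : (List.range a.m).all (fun i => nul (mm M N b i)) = true) (f : τ → ℤ) :
    mat M a b (mat N b c f) = 0 := by
  ext i
  rw [ev_mm]
  exact ev_nul _ (List.all_eq_true.1 h _ (List.mem_range.2 (a.lt i))) _

lemma mat_homotopy {ι κ τ : Type} (M N M' N' : List (List ℕ)) (a : Ix ι) (b : Ix κ) (c : Ix τ)
    (h : (List.range a.m).all
      (fun i => nul ((i, -1) :: (mm M N b i ++ mm M' N' c i))) = true) (f : ι → ℤ) :
    mat M a b (mat N b a f) + mat M' a c (mat N' c a f) = f := by
  ext i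
  rw [Pi.add_apply, ev_mm, ev_mm]
  have := ev_nul _ (List.all_eq_true.1 h _ (List.mem_range.2 (a.lt i))) (fun k => f (a.dc k))
  rw [ev_cons, ev_append] at this
  simp only [a.h] at this
  linarith

lemma mat_homotopy_of {ι κ : Type} (M N : List (List ℕ)) (E : ℕ → List (ℕ × ℤ))
    (a : Ix ι) (b : Ix κ)
    (h : (List.range a.m).all
      (fun i => nul ((i, -1) :: (mm M N b i ++ E i))) = true) (f : ι → ℤ) (i : ι) :
    mat M a b (mat N b a f) i + ev (E (a.en i)) (fun k => f (a.dc k)) = f i := by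
  rw [ev_mm]
  have := ev_nul _ (List.all_eq_true.1 h _ (List.mem_range.2 (a.lt i))) (fun k => f (a.dc k))
  rw [ev_cons, ev_append] at this
  simp only [a.h] at this
  linarith

lemma mat_equiv {ι κ : Type} (M : List (List ℕ)) (a : Ix ι) (b : Ix κ) (σ : ι → ι) (τ : κ → κ)
    (h : (List.range a.m).all
      (fun i => nul (((row M i).map fun p => (b.en (τ (b.dc p.1)), p.2)) ++
        ((row M (a.en (σ (a.dc i)))).map fun p => (p.1, -p.2)))) = true) (f : κ → ℤ) (i : ι) :
    mat M a b (fun k => f (τ k)) i = mat M a b f (σ i) := by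
  have := ev_nul _ (List.all_eq_true.1 h _ (List.mem_range.2 (a.lt i))) (fun k => f (b.dc k))
  rw [ev_append, ev_neg, ev_map (row M (a.en i)) (fun k => b.en (τ (b.dc k)))] at this
  simp only [a.h, b.h] at this
  exact sub_eq_zero.1 this

/-- index type of size 48 -/
def I1 : Ix (Fin 48) := ⟨48, fun i => i.1, fun k => Fin.ofNat 48 k, fun i => i.2, fun i => by
  apply Fin.ext; exact Nat.mod_eq_of_lt i.2⟩

/-- index type of size 96 -/
def I2 : Ix (Fin 2 × Fin 48) :=
  ⟨96, fun i => i.2.1 + 48 * i.1.1, fun k => (Fin.ofNat 2 (k / 48), Fin.ofNat 48 k),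
    fun i => by have := i.1.2; have := i.2.2; omega, fun i => by
      have h1 := i.1.2
      have h2 := i.2.2
      refine Prod.ext (Fin.ext ?_) (Fin.ext ?_)
      · change (i.2.1 + 48 * i.1.1) / 48 % 2 = i.1.1
        omega
      · change (i.2.1 + 48 * i.1.1) % 48 = i.2.1
        omega⟩

end sparse

/-- rows of a sparse matrix; `2 * j` is an entry `1` and `2 * j + 1` an entry `-1` in column `j` -/
def tabD1 : List (List ℕ) :=
  [[1, 80, 97, 182], [3, 42, 99, 168], [5, 60, 101, 174], [7, 34, 103, 160], [9, 88, 105, 166],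
  [11, 14, 107, 188], [13, 44, 109, 170], [15, 30, 111, 132], [0, 17, 113, 138], [19, 94, 100,
  115], [21, 76, 106, 117], [23, 50, 119, 176], [8, 25, 110, 121], [27, 66, 96, 123], [29, 84,
  102, 125], [31, 58, 127, 184], [16, 33, 129, 190], [35, 38, 116, 131], [37, 68, 98, 133], [39,
  54, 135, 156], [24, 41, 137, 162], [22, 43, 124, 139], [4, 45, 130, 141], [47, 74, 104, 143],
  [32, 49, 134, 145], [51, 90, 120, 147], [12, 53, 126, 149], [55, 82, 112, 151], [40, 57, 118,
  153], [59, 62, 140, 155], [61, 92, 122, 157], [63, 78, 159, 180], [48, 65, 161, 186], [46, 67,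
  148, 163], [28, 69, 154, 165], [2, 71, 128, 167], [56, 73, 158, 169], [18, 75, 144, 171], [36,
  77, 150, 173], [10, 79, 136, 175], [64, 81, 142, 177], [83, 86, 164, 179], [20, 85, 146, 181],
  [6, 87, 108, 183], [72, 89, 114, 185], [70, 91, 172, 187], [52, 93, 178, 189], [26, 95, 152,
  191]]

/-- rows of a sparse matrix; `2 * j` is an entry `1` and `2 * j + 1` an entry `-1` in column `j` -/
def tabD2 : List (List ℕ) :=
  [[1, 81, 86, 96, 102], [3, 43, 72, 98, 152], [5, 61, 78, 100, 106], [7, 35, 64, 102, 144], [9,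
  70, 89, 98, 104], [11, 15, 92, 106, 148], [13, 45, 74, 108, 114], [15, 31, 36, 110, 164], [1,
  17, 42, 112, 118], [4, 19, 95, 114, 156], [10, 21, 77, 110, 116], [23, 51, 80, 118, 160], [9,
  14, 25, 120, 126], [0, 27, 67, 122, 176], [6, 29, 85, 124, 130], [31, 59, 88, 126, 168], [17,
  33, 94, 122, 128], [20, 35, 39, 130, 172], [2, 37, 69, 132, 138], [39, 55, 60, 134, 188], [25,
  41, 66, 136, 142], [23, 28, 43, 138, 180], [5, 34, 45, 134, 140], [8, 47, 75, 142, 184], [33,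
  38, 49, 144, 150], [24, 51, 91, 104, 146], [13, 30, 53, 148, 154], [16, 55, 83, 96, 150], [22,
  41, 57, 146, 152], [44, 59, 63, 100, 154], [26, 61, 93, 156, 162], [63, 79, 84, 116, 158],
  [49, 65, 90, 160, 166], [47, 52, 67, 108, 162], [29, 58, 69, 158, 164], [3, 32, 71, 112, 166],
  [57, 62, 73, 168, 174], [19, 48, 75, 128, 170], [37, 54, 77, 172, 178], [11, 40, 79, 120,
  174], [46, 65, 81, 170, 176], [68, 83, 87, 124, 178], [21, 50, 85, 180, 186], [7, 12, 87, 140,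
  182], [18, 73, 89, 184, 190], [71, 76, 91, 132, 186], [53, 82, 93, 182, 188], [27, 56, 95,
  136, 190], [0, 46, 97, 109, 176, 183], [2, 28, 99, 138, 159, 169], [4, 26, 101, 137, 156,
  175], [6, 20, 103, 130, 161, 187], [8, 18, 105, 129, 167, 184], [10, 36, 107, 110, 179, 189],
  [12, 34, 109, 140, 145, 171], [14, 88, 99, 111, 126, 133], [16, 86, 96, 113, 125, 139], [18,
  56, 101, 115, 175, 190], [20, 54, 107, 117, 172, 189], [22, 24, 119, 143, 146, 177], [24, 70,
  104, 111, 121, 133], [26, 52, 97, 123, 162, 183], [28, 50, 103, 125, 161, 180], [30, 44, 115,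
  127, 154, 185], [32, 42, 112, 129, 153, 191], [34, 60, 107, 117, 131, 134], [36, 58, 99, 133,
  164, 169], [16, 38, 123, 135, 150, 157], [14, 40, 120, 137, 149, 163], [42, 80, 103, 118, 125,
  139], [44, 78, 100, 117, 131, 141], [46, 48, 105, 143, 167, 170], [48, 94, 128, 135, 145,
  157], [50, 76, 111, 121, 147, 186], [52, 74, 108, 127, 149, 185], [54, 68, 113, 139, 151,
  178], [56, 66, 119, 136, 153, 177], [58, 84, 131, 141, 155, 158], [60, 82, 97, 123, 157, 188],
  [40, 62, 147, 159, 174, 181], [38, 64, 144, 161, 173, 187], [8, 66, 127, 142, 149, 163], [6,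
  68, 124, 141, 155, 165], [70, 72, 98, 129, 167, 191], [22, 72, 152, 159, 169, 181], [4, 74,
  114, 135, 145, 171], [2, 76, 113, 132, 151, 173], [78, 92, 106, 137, 163, 175], [80, 90, 105,
  143, 160, 177], [12, 82, 155, 165, 179, 182], [10, 84, 116, 121, 147, 181], [64, 86, 102, 109,
  171, 183], [62, 88, 101, 115, 168, 185], [32, 90, 151, 166, 173, 187], [30, 92, 148, 165, 179,
  189], [0, 94, 119, 122, 153, 191]]

/-- rows of a sparse matrix; `2 * j` is an entry `1` and `2 * j + 1` an entry `-1` in column `j` -/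
def tabD3 : List (List ℕ) :=
  [[0, 17], [2, 71], [4, 45], [6, 87], [8, 25], [10, 79], [12, 53], [11, 14], [16, 33], [18,
  75], [20, 85], [22, 43], [24, 41], [26, 95], [28, 69], [15, 30], [32, 49], [7, 34], [36, 77],
  [35, 38], [40, 57], [3, 42], [13, 44], [46, 67], [48, 65], [23, 50], [52, 93], [39, 54], [56,
  73], [31, 58], [5, 60], [59, 62], [64, 81], [27, 66], [37, 68], [70, 91], [72, 89], [47, 74],
  [21, 76], [63, 78], [1, 80], [55, 82], [29, 84], [83, 86], [9, 88], [51, 90], [61, 92], [19,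
  94], [17, 82], [71, 88], [45, 62], [80, 87], [25, 90], [60, 79], [46, 53], [11, 76], [2, 33],
  [44, 75], [78, 85], [0, 43], [10, 41], [16, 95], [69, 86], [8, 15], [18, 49], [7, 84], [70,
  77], [4, 35], [26, 57], [3, 68], [6, 13], [24, 67], [34, 65], [23, 40], [14, 93], [32, 39],
  [42, 73], [12, 31], [5, 94], [28, 59], [50, 81], [27, 92], [30, 37], [48, 91], [58, 89], [47,
  64], [21, 38], [56, 63], [1, 66], [36, 55], [22, 29], [52, 83], [9, 74], [20, 51], [54, 61],
  [19, 72]]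

/-- rows of a sparse matrix; `2 * j` is an entry `1` and `2 * j + 1` an entry `-1` in column `j` -/
def tabS0 : List (List ℕ) :=
  [[], [], [], [7, 47, 65, 81], [24], [], [52, 66], [], [], [74], [11, 17, 21, 55, 83, 93], [],
  [], [1, 27], [], [2, 14, 36, 42], [48], [], [], [], [56], [43], [6, 12, 46, 52, 64, 66, 80,
  86], [], [], [22], [], [], [], [7, 11, 13, 17, 21, 29, 35, 41, 45, 47, 53, 55, 57, 59, 63, 65,
  67, 69, 73, 79, 81, 83, 85, 87, 93], [39, 61], [11, 17, 21, 29, 41, 55, 57, 63, 73, 79, 83,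
  85, 93], [46, 80], [], [], [22, 50, 76, 90], [], [], [], [41, 57, 79], [], [16, 54], [28], [],
  [8, 22, 24, 50, 70, 76, 90], [22, 50], [], [1, 27, 33, 49, 95], [1], [3, 43], [5, 39, 61], [],
  [], [11, 17, 55, 83, 93], [6, 46, 64, 80, 86], [], [17], [1, 5, 19, 27, 33, 39, 49, 61, 75,
  95], [], [], [], [], [], [], [], [35], [3, 37, 43], [], [41, 57], [], [7, 13, 35, 45, 47, 53,
  65, 67, 81, 87], [47], [], [], [66], [], [], [68], [38], [72], [47, 65, 81], [], [], [23, 51,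
  71, 77, 91], [], [], [77], [], [], [17, 55, 83], [11, 17, 21, 29, 55, 83, 85, 93], [], [1, 5,
  9, 19, 23, 25, 27, 33, 39, 49, 51, 61, 71, 75, 77, 89, 91, 95], [], [17, 55, 83, 93], [32,
  48]]

/-- rows of a sparse matrix; `2 * j` is an entry `1` and `2 * j + 1` an entry `-1` in column `j` -/
def tabS1 : List (List ℕ) :=
  [[], [], [], [], [], [11, 23, 25, 119, 163, 174], [86], [22, 24, 52, 66, 80, 86, 118, 162,
  182], [], [], [102], [], [22, 118], [0, 67, 81, 122, 183], [124], [], [14, 17, 22, 24, 52, 66,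
  76, 80, 86, 118, 138, 146, 151, 162, 164, 182, 186], [14, 17, 22, 24, 35, 52, 66, 76, 80, 86,
  102, 118, 138, 146, 151, 162, 164, 182], [14, 22, 24, 52, 66, 80, 86, 118, 146, 162, 164,
  182], [], [23, 57, 153], [], [14, 17, 22, 24, 48, 74, 76, 104, 118, 126, 138, 146, 151, 164,
  170, 177, 186], [], [47, 74, 104, 177], [], [66, 80, 174, 182], [0, 55], [22, 152], [22, 68,
  72, 124, 152, 164, 168], [0, 38, 55, 67, 81, 93, 175, 183], [], [81], [], [], [14, 23, 24, 36,
  52, 66, 80, 86, 120, 138, 162, 164, 176, 182], [], [47, 104, 177], [], [], [], [], [29, 125],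
  [], [2, 14, 23, 36, 52, 66, 80, 86, 110, 138, 162, 164, 182], [], [], [14, 17, 22, 24, 48, 52,
  66, 76, 80, 86, 118, 135, 138, 144, 146, 151, 162, 164, 182, 186], [0], [2], [0, 4, 38, 55,
  67, 81, 93, 175, 183], [], [177], [], [81, 183], [147], [16, 23], [14, 17, 22, 24, 48, 52, 66,
  74, 76, 80, 86, 118, 138, 146, 151, 162, 164, 170, 182, 186], [0, 14, 17, 22, 24, 52, 55, 76,
  86, 93, 102, 117, 118, 138, 146, 151, 162, 164, 175], [22], [], [], [], [53, 67, 81, 87, 163,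
  183], [], [], [14, 24, 36, 52, 66, 80, 86, 118, 138, 146, 162, 164, 182], [], [], [22, 139],
  [], [], [14, 17, 22, 24, 47, 48, 52, 66, 74, 76, 80, 86, 104, 118, 138, 146, 151, 162, 164,
  177, 182, 186], [], [52, 66, 80, 86, 174, 182], [], [], [], [135], [23, 73, 153, 169], [],
  [175], [165], [], [22, 72, 152], [], [14, 17, 22, 24, 52, 66, 76, 80, 86, 118, 138, 146, 151,
  162, 164, 182], [], [], [1, 16, 54, 139, 150], [], [], [104, 177], [], [66, 80, 92, 174, 182],
  [14, 24, 52, 66, 76, 80, 86, 118, 129, 138, 146, 151, 162, 164, 182, 186]]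

/-- rows of a sparse matrix; `2 * j` is an entry `1` and `2 * j + 1` an entry `-1` in column `j` -/
def tabS2 : List (List ℕ) :=
  [[], [23, 43, 51, 80, 160], [1, 17, 39, 134, 151], [6, 80, 103], [8, 142, 176], [51, 80, 120,
  146, 160], [6, 80, 103, 141], [6, 31, 80, 103, 141, 155], [1], [80, 90, 128, 160, 166], [80,
  160, 186], [51, 80, 160], [142, 176], [67, 176], [51, 80, 160, 181], [6, 80, 103, 141, 155],
  [1, 17], [1, 17, 39, 151], [69, 80, 103, 125], [1, 17, 151], [51, 80, 146, 160], [23, 51, 80,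
  160], [1, 5, 17, 39, 134, 151], [46, 176], [80, 90, 160, 166], [80, 160], [80, 87, 103, 182],
  [80, 83, 87, 103], [67, 137, 176], [63, 67, 137, 175, 176], [67, 78, 106, 137, 175, 176], [67,
  137, 175, 176], [46, 170, 176], [176], [80, 103, 125], [3, 23, 43, 51, 80, 160], [23, 51, 80,
  153, 160], [19, 80, 90, 128, 160, 166], [76, 80, 160, 186], [67, 78, 137, 175, 176], [80],
  [80, 87, 103], [6, 80, 103, 130], [80, 103], [23, 51, 73, 80, 153, 160], [80, 90, 160], [67,
  78, 92, 106, 137, 175, 176], [1, 123]]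

/-- table of a translation of the group of order 48 -/
def tabX : List ℕ :=
  [2, 3, 4, 5, 0, 1, 20, 21, 22, 23, 18, 19, 8, 9, 10, 11, 6, 7, 14, 15, 16, 17, 12, 13, 26, 27,
  28, 29, 24, 25, 44, 45, 46, 47, 42, 43, 32, 33, 34, 35, 30, 31, 38, 39, 40, 41, 36, 37]

/-- table of a translation of the group of order 48 -/
def tabXinv : List ℕ :=
  [4, 5, 0, 1, 2, 3, 16, 17, 12, 13, 14, 15, 22, 23, 18, 19, 20, 21, 10, 11, 6, 7, 8, 9, 28, 29,
  24, 25, 26, 27, 40, 41, 36, 37, 38, 39, 46, 47, 42, 43, 44, 45, 34, 35, 30, 31, 32, 33]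

/-- table of a translation of the group of order 48 -/
def tabP : List ℕ :=
  [12, 13, 14, 15, 16, 17, 18, 19, 20, 21, 22, 23, 24, 25, 26, 27, 28, 29, 30, 31, 32, 33, 34,
  35, 36, 37, 38, 39, 40, 41, 42, 43, 44, 45, 46, 47, 0, 1, 2, 3, 4, 5, 6, 7, 8, 9, 10, 11]

/-- table of a translation of the group of order 48 -/
def tabPinv : List ℕ :=
  [36, 37, 38, 39, 40, 41, 42, 43, 44, 45, 46, 47, 0, 1, 2, 3, 4, 5, 6, 7, 8, 9, 10, 11, 12, 13,
  14, 15, 16, 17, 18, 19, 20, 21, 22, 23, 24, 25, 26, 27, 28, 29, 30, 31, 32, 33, 34, 35]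

/-- table of a translation of the group of order 48 -/
def tabQ : List ℕ :=
  [6, 7, 8, 9, 10, 11, 24, 25, 26, 27, 28, 29, 42, 43, 44, 45, 46, 47, 12, 13, 14, 15, 16, 17,
  30, 31, 32, 33, 34, 35, 0, 1, 2, 3, 4, 5, 18, 19, 20, 21, 22, 23, 36, 37, 38, 39, 40, 41]

/-- table of a translation of the group of order 48 -/
def tabQinv : List ℕ :=
  [30, 31, 32, 33, 34, 35, 0, 1, 2, 3, 4, 5, 18, 19, 20, 21, 22, 23, 36, 37, 38, 39, 40, 41, 6,
  7, 8, 9, 10, 11, 24, 25, 26, 27, 28, 29, 42, 43, 44, 45, 46, 47, 12, 13, 14, 15, 16, 17]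

/-- table of a translation of the group of order 48 -/
def tabR : List ℕ :=
  [1, 24, 5, 28, 3, 26, 31, 6, 35, 10, 33, 8, 43, 18, 47, 22, 45, 20, 37, 12, 41, 16, 39, 14,
  25, 0, 29, 4, 27, 2, 7, 30, 11, 34, 9, 32, 19, 42, 23, 46, 21, 44, 13, 36, 17, 40, 15, 38]

/-- table of a translation of the group of order 48 -/
def tabRinv : List ℕ :=
  [25, 0, 29, 4, 27, 2, 7, 30, 11, 34, 9, 32, 19, 42, 23, 46, 21, 44, 13, 36, 17, 40, 15, 38, 1,
  24, 5, 28, 3, 26, 31, 6, 35, 10, 33, 8, 43, 18, 47, 22, 45, 20, 37, 12, 41, 16, 39, 14]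

section checks

lemma homot0 : (List.range 48).all (fun i => nul ((i, -1) :: (mm tabD1 tabS0 I2 i ++
    (if i = 15 then (List.range 48).map (fun j => (j, 1)) else [])))) = true := by decide +kernel

lemma homot1 : (List.range 96).all (fun i => nul ((i, -1) :: (mm tabD2 tabS1 I2 i ++
    mm tabS0 tabD1 I1 i))) = true := by decide +kernel

lemma homot2 : (List.range 96).all (fun i => nul ((i, -1) :: (mm tabD3 tabS2 I1 i ++
    mm tabS1 tabD2 I2 i))) = true := by decide +kernel

lemma homot3 : (List.range 48).all (fun i => nul ((i, -1) :: (mm tabS2 tabD3 I2 i ++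
    [(0, 1)]))) = true := by decide +kernel

lemma zero12 : (List.range 48).all (fun i => nul (mm tabD1 tabD2 I2 i)) = true := by decide +kernel

lemma zero23 : (List.range 96).all (fun i => nul (mm tabD2 tabD3 I2 i)) = true := by decide +kernel

lemma zero3 : (List.range 96).all (fun i => nul ((row tabD3 i).map (fun p => (0, p.2)))) = true := by
  decide +kernel

lemma zero1 : nul ((List.range 48).flatMap (fun i => row tabD1 i)) = true := by
  decide +kernel

/-- a permutation from two tables -/
def tperm (t s : List ℕ) (h : ∀ i : Fin 48, (Fin.ofNat 48 (t.getD i.1 0)).1 < 48 ∧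
    Fin.ofNat 48 (s.getD (Fin.ofNat 48 (t.getD i.1 0)).1 0) = i ∧
    Fin.ofNat 48 (t.getD (Fin.ofNat 48 (s.getD i.1 0)).1 0) = i) : Equiv.Perm (Fin 48) where
  toFun i := Fin.ofNat 48 (t.getD i.1 0)
  invFun i := Fin.ofNat 48 (s.getD i.1 0)
  left_inv i := (h i).2.1
  right_inv i := (h i).2.2

/-- translation by `X` -/
def piX : Equiv.Perm (Fin 48) := tperm tabX tabXinv (by decide +kernel)
/-- translation by `P` -/
def piP : Equiv.Perm (Fin 48) := tperm tabP tabPinv (by decide +kernel)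
/-- translation by `Q` -/
def piQ : Equiv.Perm (Fin 48) := tperm tabQ tabQinv (by decide +kernel)
/-- translation by `R` -/
def piR : Equiv.Perm (Fin 48) := tperm tabR tabRinv (by decide +kernel)

/-- generator images -/
def piGen : OGen → Equiv.Perm (Fin 48)
  | .X => piX
  | .P => piP
  | .Q => piQ
  | .R => piR

lemma pi_rels : piX ^ 3 = 1 ∧ piP ^ 4 = 1 ∧ piP ^ 2 * (piQ ^ 2)⁻¹ = 1 ∧
    piQ ^ 2 * (piR ^ 2)⁻¹ = 1 ∧ piP * piQ * piP⁻¹ * piQ = 1 ∧ piX * piP * piX⁻¹ * piQ⁻¹ = 1 ∧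
    piX * piQ * piX⁻¹ * (piP * piQ)⁻¹ = 1 ∧ piR * piX * piR⁻¹ * piX = 1 ∧
    piR * piP * piR⁻¹ * (piQ * piP)⁻¹ = 1 ∧ piR * piQ * piR⁻¹ * piQ = 1 := by
  refine ⟨?_, ?_, ?_, ?_, ?_, ?_, ?_, ?_, ?_, ?_⟩ <;> decide +kernel

/-- the doubled permutation -/
def dbl : Equiv.Perm (Fin 48) →* Equiv.Perm (Fin 2 × Fin 48) where
  toFun σ := (Equiv.refl (Fin 2)).prodCongr σ
  map_one' := rfl
  map_mul' _ _ := rfl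

/-- equivariance check -/
def eqchk {ι κ : Type} (M : List (List ℕ)) (a : Ix ι) (b : Ix κ) (σ : ι → ι) (τ : κ → κ) : Bool :=
  (List.range a.m).all
      (fun i => nul (((row M i).map fun p => (b.en (τ (b.dc p.1)), p.2)) ++
        ((row M (a.en (σ (a.dc i)))).map fun p => (p.1, -p.2))))

lemma eqv1 (g : OGen) : eqchk tabD1 I1 I2 (piGen g) (dbl (piGen g)) = true := by
  cases g <;> decide +kernel

lemma eqv2 (g : OGen) : eqchk tabD2 I2 I2 (dbl (piGen g)) (dbl (piGen g)) = true := by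
  cases g <;> decide +kernel

lemma eqv3 (g : OGen) : eqchk tabD3 I2 I1 (dbl (piGen g)) (piGen g) = true := by
  cases g <;> decide +kernel

lemma pi_trans (i : Fin 48) : ∃ b ∈ List.range 4, ∃ c ∈ List.range 2, ∃ a ∈ List.range 3,
    ∃ d ∈ List.range 2, (piP ^ b * piQ ^ c * piX ^ a * piR ^ d) 0 = i := by
  revert i
  decide +kernel

end checks

section groupOrder

lemma norm_form {G : Type} [Group G] (X P Q R : G) (N : ℕ) (hN : 0 < N) (hX : X ^ N = 1)
    (hP : P ^ 4 = 1) (hPQ : P ^ 2 = Q ^ 2) (hQR : Q ^ 2 = R ^ 2) (h1 : P * Q * P⁻¹ = Q⁻¹)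
    (h2 : X * P * X⁻¹ = Q) (h3 : X * Q * X⁻¹ = P * Q) (h4 : R * X * R⁻¹ = X⁻¹)
    (h5 : R * P * R⁻¹ = Q * P) (h6 : R * Q * R⁻¹ = Q⁻¹)
    (hgen : Subgroup.closure {X, P, Q, R} = ⊤) (g : G) :
    ∃ b < 4, ∃ c < 2, ∃ a < N, ∃ d < 2, g = P ^ b * Q ^ c * X ^ a * R ^ d := by
  have hQ4 : Q ^ 4 = 1 := by rw [show 4 = 2 * 2 from rfl, pow_mul, ← hPQ, ← pow_mul, hP]
  have hR4 : R ^ 4 = 1 := by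
    rw [show 4 = 2 * 2 from rfl, pow_mul, ← hQR, ← hPQ, ← pow_mul, hP]
  have hQi : Q⁻¹ = Q ^ 3 := by rw [inv_eq_iff_mul_eq_one, ← pow_succ']; exact hQ4
  have hXi : X⁻¹ = X ^ (N - 1) := by
    rw [inv_eq_iff_mul_eq_one, ← pow_succ', Nat.sub_add_cancel hN]; exact hX
  -- commutation rules
  have cQP : Q * P = P * Q ^ 3 := by
    have e : P * Q = Q⁻¹ * P := by rw [← h1]; group
    calc Q * P = Q * (Q⁻¹ * P) * Q⁻¹ := by rw [← e]; group
      _ = P * Q ^ 3 := by rw [mul_inv_cancel_left, hQi]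
  have cXP : X * P = Q * X := by rw [← h2]; group
  have cXQ : X * Q = P * Q * X := by rw [← h3]; group
  have cRX : R * X = X ^ (N - 1) * R := by rw [← hXi, ← h4]; group
  have cRP : R * P = Q * P * R := by rw [← h5]; group
  have cRQ : R * Q = Q ^ 3 * R := by rw [← hQi, ← h6]; group
  have sp : ∀ {u v w : G}, u * v = w * u → ∀ k : ℕ, u * v ^ k = w ^ k * u := by
    intro u v w h k
    exact (SemiconjBy.pow_right (show SemiconjBy u v w from h) k)
  let S : Set G := {g | ∃ b c a d : ℕ, g = P ^ b * Q ^ c * X ^ a * R ^ d}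
  have SP : ∀ g ∈ S, P * g ∈ S := by
    rintro _ ⟨b, c, a, d, rfl⟩
    exact ⟨b + 1, c, a, d, by rw [pow_succ']; simp only [mul_assoc]⟩
  have SQ : ∀ g ∈ S, Q * g ∈ S := by
    rintro _ ⟨b, c, a, d, rfl⟩
    have e : ∀ b : ℕ, ∃ k : ℕ, Q * P ^ b = P ^ b * Q ^ k := by
      intro b
      have cQP' : ∀ k : ℕ, Q ^ k * P = P * Q ^ (3 * k) := by
        intro k
        rw [pow_mul]
        exact (SemiconjBy.pow_right (show SemiconjBy P (Q ^ 3) Q from cQP.symm) k).symm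
      induction b with
      | zero => exact ⟨1, by simp⟩
      | succ b ih =>
        obtain ⟨k, hk⟩ := ih
        exact ⟨3 * k, by rw [pow_succ, ← mul_assoc, hk, mul_assoc, cQP', ← mul_assoc]⟩
    obtain ⟨k, hk⟩ := e b
    refine ⟨b, k + c, a, d, ?_⟩
    rw [← mul_assoc, ← mul_assoc, ← mul_assoc, hk, pow_add]; simp only [mul_assoc]
  have Spow : ∀ u : G, (∀ g ∈ S, u * g ∈ S) → ∀ k : ℕ, ∀ g ∈ S, u ^ k * g ∈ S := by
    intro u hu k
    induction k with
    | zero => intro g hg; simpa using hg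
    | succ k ih => intro g hg; rw [pow_succ, mul_assoc]; exact ih _ (hu _ hg)
  have SXR : ∀ a d : ℕ, X ^ a * R ^ d ∈ S := fun a d => ⟨0, 0, a, d, by simp⟩
  have SX : ∀ g ∈ S, X * g ∈ S := by
    rintro _ ⟨b, c, a, d, rfl⟩
    have e : X * (P ^ b * Q ^ c * X ^ a * R ^ d) =
        Q ^ b * ((P * Q) ^ c * (X ^ (a + 1) * R ^ d)) := by
      rw [← mul_assoc, ← mul_assoc, ← mul_assoc, sp cXP, mul_assoc (Q ^ b) X, sp cXQ, pow_succ']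
      simp only [mul_assoc]
    rw [e]
    refine Spow _ SQ _ _ (Spow _ ?_ _ _ (SXR _ _))
    intro g hg; rw [mul_assoc]; exact SP _ (SQ _ hg)
  have SR : ∀ g ∈ S, R * g ∈ S := by
    rintro _ ⟨b, c, a, d, rfl⟩
    have e : R * (P ^ b * Q ^ c * X ^ a * R ^ d) =
        (Q * P) ^ b * ((Q ^ 3) ^ c * (X ^ ((N - 1) * a) * R ^ (d + 1))) := by
      rw [← mul_assoc, ← mul_assoc, ← mul_assoc, sp cRP, mul_assoc _ R, sp cRQ,
        pow_succ' R d, pow_mul, ← mul_assoc, mul_assoc _ R, sp cRX]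
      simp only [mul_assoc]
    rw [e]
    refine Spow _ ?_ _ _ (Spow _ ?_ _ _ (SXR _ _))
    · intro g hg; rw [mul_assoc]; exact SQ _ (SP _ hg)
    · exact Spow _ SQ 3
  have hgS : g ∈ S := by
    have hg : g ∈ Subgroup.closure {X, P, Q, R} := by rw [hgen]; trivial
    have : ∀ h ∈ S, g * h ∈ S := by
      induction hg using Subgroup.closure_induction'' with
      | mem x hx => 
        rcases hx with rfl | rfl | rfl | rfl <;> assumption
      | inv_mem x hx =>
        rcases hx with hx | hx | hx | hx <;> rw [hx]
        · rw [hXi]; exact Spow _ SX _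
        · have : P⁻¹ = P ^ 3 := by rw [inv_eq_iff_mul_eq_one, ← pow_succ']; exact hP
          rw [this]; exact Spow _ SP _
        · rw [hQi]; exact Spow _ SQ _
        · have : R⁻¹ = R ^ 3 := by rw [inv_eq_iff_mul_eq_one, ← pow_succ']; exact hR4
          rw [this]; exact Spow _ SR _
      | one => intro h hh; simpa using hh
      | mul x y _ _ hx hy => intro h hh; rw [mul_assoc]; exact hx _ (hy _ hh)
    simpa using this 1 ⟨0, 0, 0, 0, by simp⟩
  obtain ⟨b, c, a, d, rfl⟩ := hgS
  have zX : Commute X (P ^ 2) := by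
    have := sp cXP 2
    rw [← hPQ] at this; exact this
  have zQ : Commute Q (P ^ 2) := by rw [hPQ]; exact Commute.self_pow _ _
  refine ⟨(b + 2 * (c / 2) + 2 * (d / 2)) % 4, Nat.mod_lt _ (by norm_num), c % 2,
    Nat.mod_lt _ (by norm_num), a % N, Nat.mod_lt _ hN, d % 2, Nat.mod_lt _ (by norm_num), ?_⟩
  have e1 : P ^ ((b + 2 * (c / 2) + 2 * (d / 2)) % 4) =
      P ^ b * (P ^ 2) ^ (c / 2) * (P ^ 2) ^ (d / 2) := by
    rw [← pow_mul, ← pow_mul, ← pow_add, ← pow_add]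
    exact (pow_eq_pow_mod _ hP).symm
  have e2 : Q ^ c = (P ^ 2) ^ (c / 2) * Q ^ (c % 2) := by
    rw [hPQ, ← pow_mul, ← pow_add, Nat.div_add_mod]
  have e3 : R ^ d = (P ^ 2) ^ (d / 2) * R ^ (d % 2) := by
    rw [hPQ, hQR, ← pow_mul, ← pow_add, Nat.div_add_mod]
  have e4 : X ^ a = X ^ (a % N) := pow_eq_pow_mod _ hX
  have k1 : Commute (X ^ (a % N)) ((P ^ 2) ^ (d / 2)) := zX.pow_pow _ _
  have k2 : Commute (Q ^ (c % 2)) ((P ^ 2) ^ (d / 2)) := zQ.pow_pow _ _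
  rw [e1, e2, e3, e4]
  generalize (P ^ 2) ^ (d / 2) = z at k1 k2
  simp only [mul_assoc]
  rw [← mul_assoc (X ^ _) z, k1.eq, ← mul_assoc (Q ^ _) (z * _), ← mul_assoc (Q ^ _) z, k2.eq]
  simp only [mul_assoc]

/-- action on the group of order 48 -/
def phi (n : ℕ) (hn : 1 ≤ n) : Ostar n →* Equiv.Perm (Fin 48) :=
  PresentedGroup.toGroup (f := piGen) (by
    obtain ⟨h1, h2, h3, h4, h5, h6, h7, h8, h9, h10⟩ := pi_rels
    rintro r (rfl | rfl | rfl | rfl | rfl | rfl | rfl | rfl | rfl | rfl) <;>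
      simp only [map_mul, map_pow, map_inv, FreeGroup.lift_apply_of, piGen] <;> try assumption
    obtain ⟨m, rfl⟩ := Nat.exists_eq_add_of_le hn
    rw [pow_add, pow_one, pow_mul, h1, one_pow])

/-- generator images -/
def psiGen (n : ℕ) : OGen → Equiv.Perm (ZMod (3 ^ n))
  | .X => Equiv.addRight 1
  | .P => 1
  | .Q => 1
  | .R => Equiv.neg _

lemma addRight_pow (n : ℕ) (k : ℕ) (j : ZMod (3 ^ n)) :
    ((Equiv.addRight (1 : ZMod (3 ^ n))) ^ k) j = j + k := by
  induction k with
  | zero => simp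
  | succ k ih => rw [pow_succ', Equiv.Perm.mul_apply, ih]; simp [add_assoc]

/-- dihedral action -/
def psi (n : ℕ) : Ostar n →* Equiv.Perm (ZMod (3 ^ n)) :=
  PresentedGroup.toGroup (f := psiGen n) (by
    have hR : (Equiv.neg (ZMod (3 ^ n))) ^ 2 = 1 := by ext j; simp [pow_two]
    rintro r (rfl | rfl | rfl | rfl | rfl | rfl | rfl | rfl | rfl | rfl) <;>
      simp only [map_mul, map_pow, map_inv, FreeGroup.lift_apply_of, psiGen] <;> 
      try simp [hR]
    all_goals
      apply Equiv.ext
      intro j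
      simp [Equiv.Perm.inv_def])

/-- generator images -/
def sgnGen : OGen → ℤˣ
  | .R => -1
  | _ => 1

/-- sign character -/
def sgn (n : ℕ) : Ostar n →* ℤˣ :=
  PresentedGroup.toGroup (f := sgnGen) (by
    rintro r (rfl | rfl | rfl | rfl | rfl | rfl | rfl | rfl | rfl | rfl) <;>
      simp [FreeGroup.lift_apply_of, sgnGen])

/-- generators -/
def og (n : ℕ) (g : OGen) : Ostar n := PresentedGroup.of g

lemma phi_og (n : ℕ) (hn) (g) : phi n hn (og n g) = piGen g := PresentedGroup.toGroup.of _
lemma psi_og (n : ℕ) (g) : psi n (og n g) = psiGen n g := PresentedGroup.toGroup.of _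
lemma sgn_og (n : ℕ) (g) : sgn n (og n g) = sgnGen g := PresentedGroup.toGroup.of _

lemma og_rel (n : ℕ) (r : FreeGroup OGen) (h : r ∈ ostarRels n) :
    PresentedGroup.mk (ostarRels n) r = 1 := PresentedGroup.one_of_mem h

lemma og_rels (n : ℕ) : (og n .X) ^ 3 ^ n = 1 ∧ (og n .P) ^ 4 = 1 ∧ (og n .P) ^ 2 = (og n .Q) ^ 2 ∧
    (og n .Q) ^ 2 = (og n .R) ^ 2 ∧ og n .P * og n .Q * (og n .P)⁻¹ = (og n .Q)⁻¹ ∧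
    og n .X * og n .P * (og n .X)⁻¹ = og n .Q ∧
    og n .X * og n .Q * (og n .X)⁻¹ = og n .P * og n .Q ∧
    og n .R * og n .X * (og n .R)⁻¹ = (og n .X)⁻¹ ∧
    og n .R * og n .P * (og n .R)⁻¹ = og n .Q * og n .P ∧
    og n .R * og n .Q * (og n .R)⁻¹ = (og n .Q)⁻¹ := by
  have key := og_rel n
  simp only [ostarRels, Set.mem_insert_iff, Set.mem_singleton_iff, forall_eq_or_imp,
    forall_eq] at key
  obtain ⟨h1, h2, h3, h4, h5, h6, h7, h8, h9, h10⟩ := key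
  exact ⟨h1, h2, mul_inv_eq_one.1 h3, mul_inv_eq_one.1 h4, mul_eq_one_iff_eq_inv.1 h5,
    mul_inv_eq_one.1 h6, mul_inv_eq_one.1 h7, mul_eq_one_iff_eq_inv.1 h8,
    mul_inv_eq_one.1 h9, mul_eq_one_iff_eq_inv.1 h10⟩

lemma og_closure (n : ℕ) : Subgroup.closure {og n .X, og n .P, og n .Q, og n .R} = ⊤ := by
  rw [← PresentedGroup.closure_range_of (ostarRels n)]
  congr 1
  ext x
  constructor
  · rintro (rfl | rfl | rfl | rfl) <;> exact ⟨_, rfl⟩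
  · rintro ⟨g, rfl⟩
    cases g
    · left; rfl
    · right; left; rfl
    · right; right; left; rfl
    · right; right; right; rfl

lemma og_norm (n : ℕ) (g : Ostar n) : ∃ b < 4, ∃ c < 2, ∃ a < 3 ^ n, ∃ d < 2,
    g = og n .P ^ b * og n .Q ^ c * og n .X ^ a * og n .R ^ d := by
  obtain ⟨h1, h2, h3, h4, h5, h6, h7, h8, h9, h10⟩ := og_rels n
  exact norm_form _ _ _ _ (3 ^ n) (by positivity) h1 h2 h3 h4 h5 h6 h7 h8 h9 h10 (og_closure n) g

/-- normal form map -/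
def nf (n : ℕ) (t : Fin 4 × Fin 2 × Fin (3 ^ n) × Fin 2) : Ostar n :=
  og n .P ^ t.1.1 * og n .Q ^ t.2.1.1 * og n .X ^ t.2.2.1.1 * og n .R ^ t.2.2.2.1

lemma nf_surj (n : ℕ) : Function.Surjective (nf n) := by
  intro g
  obtain ⟨b, hb, c, hc, a, ha, d, hd, rfl⟩ := og_norm n g
  exact ⟨(⟨b, hb⟩, ⟨c, hc⟩, ⟨a, ha⟩, ⟨d, hd⟩), rfl⟩

noncomputable instance ostarFintype (n : ℕ) : Fintype (Ostar n) :=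
  @Fintype.ofFinite _ (Finite.of_surjective _ (nf_surj n))

lemma phi_trans (n : ℕ) (hn : 1 ≤ n) (j : Fin 48) : ∃ g, phi n hn g 0 = j := by
  obtain ⟨b, _, c, _, a, _, d, _, h⟩ := pi_trans j
  refine ⟨og n .P ^ b * og n .Q ^ c * og n .X ^ a * og n .R ^ d, ?_⟩
  simp only [map_mul, map_pow, phi_og]
  exact h

lemma psi_trans (n : ℕ) (j : ZMod (3 ^ n)) : ∃ g, psi n g 0 = j := by
  refine ⟨og n .X ^ j.val, ?_⟩
  rw [map_pow, psi_og, psiGen, addRight_pow]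
  simp

lemma card_ostar (n : ℕ) (hn : 1 ≤ n) : Fintype.card (Ostar n) = 3 ^ n * 16 := by
  have h1 : Fintype.card (Ostar n) ≤ 3 ^ n * 16 := by
    refine (Fintype.card_le_of_surjective _ (nf_surj n)).trans ?_
    simp only [Fintype.card_prod, Fintype.card_fin]
    apply le_of_eq; ring
  have h2 : 48 ∣ Fintype.card (Ostar n) := by
    have := Dvd.intro _ (trans_count (phi n hn) 0 (phi_trans n hn) 0)
    simpa using this
  have h3 : 3 ^ n ∣ Fintype.card (Ostar n) := by
    have := Dvd.intro _ (trans_count (psi n) 0 (psi_trans n) 0)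
    rwa [ZMod.card] at this
  have h4 : 3 ^ n * 16 ∣ Fintype.card (Ostar n) :=
    Nat.Coprime.mul_dvd_of_dvd_of_dvd (Nat.Coprime.pow_left _ (by norm_num)) h3
      (dvd_trans (by norm_num) h2)
  exact le_antisymm h1 (Nat.le_of_dvd Fintype.card_pos h4)

end groupOrder

section twopart

lemma equiv_of_gens {K : Type} [CommRing K] (n : ℕ) (A B : Rep K (Ostar n)) (T : A.V →ₗ[K] B.V)
    (h : ∀ s : OGen, ∀ f, T (A.ρ (og n s) f) = B.ρ (og n s) (T f)) (g : Ostar n) :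
    ∀ f, T (A.ρ g f) = B.ρ g (T f) := by
  have hg : g ∈ Subgroup.closure (Set.range (og n)) := by
    have := PresentedGroup.closure_range_of (ostarRels n)
    change g ∈ Subgroup.closure (Set.range (PresentedGroup.of (rels := ostarRels n)))
    rw [this]; trivial
  induction hg using Subgroup.closure_induction with
  | mem x hx => obtain ⟨s, rfl⟩ := hx; exact h s
  | one => intro f; simp
  | mul x y _ _ hx hy => intro f; simp [hx, hy]
  | inv x _ hx =>
    intro f
    have := hx (A.ρ x⁻¹ f)
    rw [Representation.self_inv_apply] at this
    rw [this, Representation.inv_self_apply]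

/-- a morphism from a linear map commuting with generators -/
noncomputable def morOf {K : Type} [CommRing K] (n : ℕ) (A B : Rep K (Ostar n)) (T : A.V →ₗ[K] B.V)
    (h : ∀ s : OGen, ∀ f, T (A.ρ (og n s) f) = B.ρ (og n s) (T f)) : A ⟶ B := Rep.ofHom
  { toLinearMap := T
    isIntertwining' := by
      intro g
      apply LinearMap.ext
      intro f
      exact equiv_of_gens n A B T h g f }

lemma morOf_apply {K : Type} [CommRing K] (n : ℕ) (A B : Rep K (Ostar n)) (T : A.V →ₗ[K] B.V) (h) (f : A.V) :
    (morOf n A B T h).hom f = T f := rfl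

lemma mat_pRep {G : Type} [Group G] {ι κ : Type} (φ : G →* Equiv.Perm κ) (ψ : G →* Equiv.Perm ι)
    (M : List (List ℕ)) (a : Ix ι) (b : Ix κ) (g : G) (h : eqchk M a b (ψ g) (φ g) = true)
    (f : κ → ℤ) : mat M a b ((pRep 1 φ).ρ g f) = (pRep 1 ψ).ρ g (mat M a b f) := by
  funext i
  have h1 : (pRep 1 φ).ρ g f = fun k => f ((φ g)⁻¹ k) := by
    funext k; rw [pRep_apply]; simp
  have h2 := mat_equiv M a b (ψ g) (φ g) h (fun k => f ((φ g)⁻¹ k)) ((ψ g)⁻¹ i)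
  rw [h1, pRep_apply]
  have h3 : ∀ k, (φ g)⁻¹ (φ g k) = k := fun k => by simp
  have h4 : (ψ g) ((ψ g)⁻¹ i) = i := by simp
  simp only [h3, h4] at h2
  rw [← h2]; simp

variable (n : ℕ) (hn : 1 ≤ n)

/-- free module of rank one over the quotient of order 48 -/
noncomputable abbrev F1 : Rep ℤ (Ostar n) := pRep 1 (phi n hn)
/-- free module of rank two over the quotient of order 48 -/
noncomputable abbrev F2 : Rep ℤ (Ostar n) := pRep 1 (dbl.comp (phi n hn))

/-- first differential -/
noncomputable def del1 : F2 n hn ⟶ F1 n hn := morOf n _ _ (mat tabD1 I1 I2) (fun s f =>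
  mat_pRep _ _ _ _ _ _ (by
    rw [MonoidHom.comp_apply, phi_og]; exact eqv1 s) f)
/-- second differential -/
noncomputable def del2 : F2 n hn ⟶ F2 n hn := morOf n _ _ (mat tabD2 I2 I2) (fun s f =>
  mat_pRep _ _ _ _ _ _ (by
    rw [MonoidHom.comp_apply, phi_og]; exact eqv2 s) f)
/-- third differential -/
noncomputable def del3 : F1 n hn ⟶ F2 n hn := morOf n _ _ (mat tabD3 I2 I1) (fun s f =>
  mat_pRep _ _ _ _ _ _ (by
    rw [MonoidHom.comp_apply, phi_og]; exact eqv3 s) f)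

/-- constants -/
noncomputable def cst {G : Type} [Group G] {ι : Type} (φ : G →* Equiv.Perm ι) :
    Rep.trivial ℤ G ℤ ⟶ pRep 1 φ := Rep.ofHom
  { toFun := fun c _ => c
    map_add' := by intros; rfl
    map_smul' := by intros; rfl
    isIntertwining' := by
      intro g; apply LinearMap.ext; intro c; funext i
      change c = ((1 : G →* ℤˣ) g : ℤ) * c
      simp }

/-- sum of values -/
noncomputable def aug {G : Type} [Group G] {ι : Type} [Fintype ι] (φ : G →* Equiv.Perm ι) :
    pRep 1 φ ⟶ Rep.trivial ℤ G ℤ := Rep.ofHom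
  { toFun := fun f => ∑ i, f i
    map_add' := by intros; simp [Finset.sum_add_distrib]
    map_smul' := by intros; simp [Finset.mul_sum]
    isIntertwining' := by
      intro g; apply LinearMap.ext; intro f
      change ∑ i, ((1 : G →* ℤˣ) g : ℤ) * f ((φ g)⁻¹ i) = ∑ i, f i
      simp only [MonoidHom.one_apply, Units.val_one, one_mul]
      exact Equiv.sum_comp ((φ g)⁻¹) f }

lemma cst_apply {G : Type} [Group G] {ι : Type} (φ : G →* Equiv.Perm ι) (c : ℤ) (i : ι) :
    (cst φ).hom c i = c := rfl

lemma aug_apply {G : Type} [Group G] {ι : Type} [Fintype ι] (φ : G →* Equiv.Perm ι) (f : ι → ℤ) :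
    (aug φ).hom f = ∑ i, f i := rfl

lemma cst_inj {G : Type} [Group G] {ι : Type} [Inhabited ι] (φ : G →* Equiv.Perm ι) :
    Function.Injective (cst φ).hom := by
  intro c d h
  exact congrFun h default

lemma aug_surj {G : Type} [Group G] {ι : Type} [Fintype ι] [DecidableEq ι] [Inhabited ι]
    (φ : G →* Equiv.Perm ι) : Function.Surjective (aug φ).hom := by
  intro c
  refine ⟨fun i => if i = default then c else 0, ?_⟩
  rw [aug_apply]; simp

lemma ex3 : Function.Exact (cst (phi n hn)).hom (del3 n hn).hom := by
  intro f
  constructor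
  · intro h
    have h : mat tabD3 I2 I1 f = 0 := h
    refine ⟨f 0, ?_⟩
    funext i
    have := mat_homotopy_of tabS2 tabD3 (fun _ => [(0, 1)]) I1 I2 homot3 f i
    rw [h, map_zero, ev_cons] at this
    rw [cst_apply, ← this]
    simp [ev_nil, I1]
  · rintro ⟨c, rfl⟩
    change mat tabD3 I2 I1 (fun _ => c) = 0
    funext i
    have := ev_nul _ (List.all_eq_true.1 zero3 _ (List.mem_range.2 (I2.lt i))) (fun _ => c)
    rw [ev_map _ (fun _ => 0)] at this
    exact this

lemma ex2 : Function.Exact (del3 n hn).hom (del2 n hn).hom := by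
  intro f
  constructor
  · intro h
    have h : mat tabD2 I2 I2 f = 0 := h
    have := mat_homotopy tabD3 tabS2 tabS1 tabD2 I2 I1 I2 homot2 f
    rw [h, map_zero, add_zero] at this
    exact ⟨_, this⟩
  · rintro ⟨c, rfl⟩
    exact mat_comp_zero tabD2 tabD3 I2 I2 I1 zero23 _

lemma ex1 : Function.Exact (del2 n hn).hom (del1 n hn).hom := by
  intro f
  constructor
  · intro h
    have h : mat tabD1 I1 I2 f = 0 := h
    have := mat_homotopy tabD2 tabS1 tabS0 tabD1 I2 I2 I1 homot1 f
    rw [h, map_zero, add_zero] at this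
    exact ⟨_, this⟩
  · rintro ⟨c, rfl⟩
    exact mat_comp_zero tabD1 tabD2 I1 I2 I2 zero12 _

lemma ev_flat (m : ℕ) (E : ℕ → List (ℕ × ℤ)) (F : ℕ → ℤ) :
    ev ((List.range m).flatMap E) F = ∑ i ∈ Finset.range m, ev (E i) F := by
  induction m with
  | zero => simp [ev]
  | succ m ih =>
    rw [List.range_succ, List.flatMap_append, ev_append, ih, Finset.sum_range_succ]
    simp

lemma ex0 : Function.Exact (del1 n hn).hom (aug (phi n hn)).hom := by
  intro f
  constructor
  · intro h
    have h : ∑ i : Fin 48, f i = 0 := h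
    refine ⟨mat tabS0 I2 I1 f, ?_⟩
    change mat tabD1 I1 I2 _ = f
    funext i
    have := mat_homotopy_of tabD1 tabS0
      (fun i => if i = 15 then (List.range 48).map (fun j => (j, 1)) else []) I1 I2 homot0 f i
    rw [← this, eq_comm, add_eq_left]
    split_ifs
    · have e : (List.range 48).map (fun j => (j, (1 : ℤ))) =
        (List.range 48).flatMap (fun j => [(j, (1 : ℤ))]) := by decide
      rw [e, ev_flat]
      simp only [ev_cons, ev_nil, one_mul, add_zero]
      rw [← h, Finset.sum_range]
      refine Finset.sum_congr rfl fun j _ => ?_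
      exact congrArg f (I1.h j)
    · rfl
  · rintro ⟨c, rfl⟩
    change ∑ i : Fin 48, mat tabD1 I1 I2 c i = 0
    have := ev_nul _ zero1 (fun k => c (I2.dc k))
    rw [ev_flat, Finset.sum_range] at this
    exact this

lemma killF1 (k : ℕ) (x : groupCohomology (F1 n hn) (k+1)) : 3 ^ (n - 1) • x = 0 := by
  refine pRep_kill 1 (phi n hn) {0} (3 ^ (n - 1)) ?_ k x
  intro j
  simp only [Finset.mem_singleton]
  refine trans_count' _ _ (phi_trans n hn) _ ?_ j
  rw [card_ostar n hn, Fintype.card_fin]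
  obtain ⟨m, rfl⟩ := Nat.exists_eq_add_of_le hn
  simp [pow_add]; ring

lemma killF2 (k : ℕ) (x : groupCohomology (F2 n hn) (k+1)) : 3 ^ (n - 1) • x = 0 := by
  refine pRep_kill 1 (dbl.comp (phi n hn)) {(0, 0), (1, 0)} (3 ^ (n - 1)) ?_ k x
  rintro ⟨b, j⟩
  have e : ∀ g, dbl.comp (phi n hn) g (b, j) ∈ ({(0, 0), (1, 0)} : Finset (Fin 2 × Fin 48)) ↔
      phi n hn g j = 0 := by
    intro g
    have : dbl.comp (phi n hn) g (b, j) = (b, phi n hn g j) := rfl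
    rw [this]
    fin_cases b <;> simp
  simp only [e]
  refine trans_count' _ _ (phi_trans n hn) _ ?_ j
  rw [card_ostar n hn, Fintype.card_fin]
  obtain ⟨m, rfl⟩ := Nat.exists_eq_add_of_le hn
  simp [pow_add]; ring

lemma two_part (hn : 1 ≤ n) (k : ℕ) :
    Nonempty (tors (groupCohomology (Rep.trivial ℤ (Ostar n) ℤ) (k+1)) 16 ≃+
      tors (groupCohomology (Rep.trivial ℤ (Ostar n) ℤ) (k+5)) 16) :=
  (four_term (cst (phi n hn)) (del3 n hn) (del2 n hn) (del1 n hn) (aug (phi n hn))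
    (cst_inj _) (ex3 n hn) (ex2 n hn) (ex1 n hn) (ex0 n hn) (aug_surj _) (3 ^ (n - 1)) 16
    (Nat.Coprime.pow_left _ (by norm_num)) (killF1 n hn) (killF2 n hn) (killF2 n hn)
    (killF1 n hn)).2 k

end twopart

section threepart
variable (n : ℕ)

/-- half of one -/
def hf : ZMod (3 ^ n) := ((3 ^ n + 1) / 2 : ℕ)

lemma hf_add : hf n + hf n = 1 := by
  have h : (3 ^ n + 1) / 2 + (3 ^ n + 1) / 2 = 3 ^ n + 1 := by
    have : Odd (3 ^ n) := Odd.pow (by decide)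
    obtain ⟨k, hk⟩ := this
    omega
  rw [hf, ← Nat.cast_add, h, Nat.cast_add, ZMod.natCast_self]; simp

/-- symmetric difference operator -/
def uop : (ZMod (3 ^ n) → ℤ) →ₗ[ℤ] (ZMod (3 ^ n) → ℤ) where
  toFun f j := f (j + hf n) - f (j - hf n)
  map_add' f g := by ext; simp; ring
  map_smul' c f := by ext; simp; ring

/-- norm operator -/
def nop : (ZMod (3 ^ n) → ℤ) →ₗ[ℤ] (ZMod (3 ^ n) → ℤ) where
  toFun f _ := ∑ i, f i
  map_add' f g := by ext; simp [Finset.sum_add_distrib]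
  map_smul' c f := by ext; simp [Finset.mul_sum]

lemma uop_apply (f j) : uop n f j = f (j + hf n) - f (j - hf n) := rfl
lemma nop_apply (f j) : nop n f j = ∑ i, f i := rfl

lemma uop_ker (f) (h : uop n f = 0) (j : ZMod (3 ^ n)) : f j = f 0 := by
  have h1 : ∀ j, f (j + 1) = f j := by
    intro j
    have := congrFun h (j + hf n)
    rw [uop_apply, add_assoc, hf_add, add_sub_cancel_right] at this
    exact sub_eq_zero.1 this
  have h2 : ∀ k : ℕ, f k = f 0 := by
    intro k
    induction k with
    | zero => simp
    | succ k ih => rw [Nat.cast_succ, h1, ih]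
  have := h2 j.val
  rwa [ZMod.natCast_zmod_val] at this

lemma uop_const (c : ℤ) : uop n (fun _ => c) = 0 := by
  funext j; rw [uop_apply]; simp

lemma uop_sum (f) : ∑ j, uop n f j = 0 := by
  simp only [uop_apply, Finset.sum_sub_distrib]
  have e1 : ∑ x, f (x + hf n) = ∑ x, f x := Equiv.sum_comp (Equiv.addRight (hf n)) f
  have e2 : ∑ x, f (x - hf n) = ∑ x, f x := Equiv.sum_comp (Equiv.subRight (hf n)) f
  rw [e1, e2, sub_self]

lemma sum_val (h : ZMod (3 ^ n) → ℤ) : ∑ j, h j = ∑ k ∈ Finset.range (3 ^ n), h (k : ℕ) := by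
  refine Finset.sum_bij' (fun j _ => j.val) (fun k _ => (k : ZMod (3 ^ n))) ?_ ?_ ?_ ?_ ?_
  · intro j _; exact Finset.mem_range.2 (ZMod.val_lt j)
  · intro k _; simp
  · intro j _; simp
  · intro k hk; exact ZMod.val_cast_of_lt (Finset.mem_range.1 hk)
  · intro j _; simp

lemma uop_range (f) (hs : ∑ j, f j = 0) : ∃ g, uop n g = f := by
  let h : ZMod (3 ^ n) → ℤ := fun j => f (j + hf n)
  have hh : ∑ j, h j = 0 := by
    rw [← hs]; exact Equiv.sum_comp (Equiv.addRight (hf n)) f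
  let g : ZMod (3 ^ n) → ℤ := fun j => ∑ i ∈ Finset.range j.val, h (i : ℕ)
  have hg : ∀ j, g (j + 1) = g j + h j := by
    intro j
    have e : h j = h (j.val : ℕ) := by simp
    have e2 : g j + h j = ∑ i ∈ Finset.range (j.val + 1), h (i : ℕ) := by
      rw [Finset.sum_range_succ, e]
    rw [e2]
    have e3 : j + 1 = ((j.val + 1 : ℕ) : ZMod (3 ^ n)) := by simp
    by_cases hj : j.val + 1 < 3 ^ n
    · have : (j + 1).val = j.val + 1 := by rw [e3]; exact ZMod.val_cast_of_lt hj
      change ∑ i ∈ Finset.range (j + 1).val, h (i : ℕ) = _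
      rw [this]
    · have hj : j.val + 1 = 3 ^ n := by have := ZMod.val_lt j; omega
      rw [hj, ← sum_val, hh, e3, hj, ZMod.natCast_self]
      change ∑ i ∈ Finset.range (0 : ZMod (3 ^ n)).val, h (i : ℕ) = _
      simp
  refine ⟨g, ?_⟩
  funext j
  rw [uop_apply]
  have := hg (j - hf n)
  have e : j - hf n + 1 = j + hf n := by rw [← hf_add n]; ring
  rw [e] at this
  rw [this]
  simp [h]

/-- untwisted module -/
noncomputable abbrev Ap : Rep ℤ (Ostar n) := pRep 1 (psi n)
/-- twisted module -/
noncomputable abbrev Am : Rep ℤ (Ostar n) := pRep (sgn n) (psi n)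

lemma psiX_inv (j : ZMod (3 ^ n)) : (psi n (og n .X))⁻¹ j = j - 1 := by
  rw [psi_og, Equiv.Perm.inv_eq_iff_eq]
  simp [psiGen]
lemma psiR_inv (j : ZMod (3 ^ n)) : (psi n (og n .R))⁻¹ j = - j := by
  rw [psi_og, Equiv.Perm.inv_eq_iff_eq]
  simp [psiGen]
lemma psiP_inv (j : ZMod (3 ^ n)) : (psi n (og n .P))⁻¹ j = j := by
  rw [psi_og, Equiv.Perm.inv_eq_iff_eq]
  simp [psiGen]
lemma psiQ_inv (j : ZMod (3 ^ n)) : (psi n (og n .Q))⁻¹ j = j := by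
  rw [psi_og, Equiv.Perm.inv_eq_iff_eq]
  simp [psiGen]

/-- first map -/
noncomputable def upm : Ap n ⟶ Am n := morOf n _ _ (uop n) (by
  intro s f
  funext j
  change uop n _ j = _
  rw [uop_apply, pRep_apply, pRep_apply, pRep_apply]
  change _ = ((sgn n (og n s) : ℤˣ) : ℤ) * uop n f _
  rw [uop_apply, sgn_og]
  cases s
  · simp only [psiX_inv, sgnGen]; simp; ring_nf
  · simp only [psiP_inv, sgnGen]; simp
  · simp only [psiQ_inv, sgnGen]; simp
  · simp only [psiR_inv, sgnGen]; simp; ring_nf)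

/-- third map -/
noncomputable def ump : Am n ⟶ Ap n := morOf n _ _ (uop n) (by
  intro s f
  funext j
  change uop n _ j = _
  rw [uop_apply, pRep_apply, pRep_apply, pRep_apply]
  change _ = (((1 : Ostar n →* ℤˣ) (og n s) : ℤˣ) : ℤ) * uop n f _
  rw [uop_apply, sgn_og]
  cases s
  · simp only [psiX_inv, sgnGen]; simp; ring_nf
  · simp only [psiP_inv, sgnGen]; simp
  · simp only [psiQ_inv, sgnGen]; simp
  · simp only [psiR_inv, sgnGen]; simp; ring_nf)

/-- middle map -/
noncomputable def nmm : Am n ⟶ Am n := Rep.ofHom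
  { toLinearMap := nop n
    isIntertwining' := by
      intro g; apply LinearMap.ext; intro f; funext j
      change ∑ i, (sgn n g : ℤ) * f ((psi n g)⁻¹ i) = (sgn n g : ℤ) * ∑ i, f i
      rw [← Finset.mul_sum, Equiv.sum_comp ((psi n g)⁻¹) f] }

lemma tx3 : Function.Exact (cst (psi n)).hom (upm n).hom := by
  intro f
  constructor
  · intro h
    refine ⟨f 0, ?_⟩
    funext j
    exact (uop_ker n f h j).symm
  · rintro ⟨c, rfl⟩
    exact uop_const n c

lemma tx2 : Function.Exact (upm n).hom (nmm n).hom := by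
  intro f
  constructor
  · intro h
    exact uop_range n f (congrFun h 0)
  · rintro ⟨c, rfl⟩
    funext j
    exact uop_sum n c

lemma tx1 : Function.Exact (nmm n).hom (ump n).hom := by
  intro f
  constructor
  · intro h
    refine ⟨fun i => if i = 0 then f 0 else 0, ?_⟩
    funext j
    refine Eq.trans ?_ (uop_ker n f h j).symm
    change ∑ i : ZMod (3 ^ n), (if i = 0 then f 0 else 0) = f 0
    simp
  · rintro ⟨c, rfl⟩
    exact uop_const n _

lemma tx0 : Function.Exact (ump n).hom (aug (psi n)).hom := by
  intro f
  constructor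
  · intro h
    exact uop_range n f h
  · rintro ⟨c, rfl⟩
    exact uop_sum n c

lemma killA (hn : 1 ≤ n) (χ : Ostar n →* ℤˣ) (k : ℕ)
    (x : groupCohomology (pRep χ (psi n)) (k+1)) : 16 • x = 0 := by
  refine pRep_kill χ (psi n) {0} 16 ?_ k x
  intro j
  simp only [Finset.mem_singleton]
  refine trans_count' _ _ (psi_trans n) _ ?_ j
  rw [card_ostar n hn, ZMod.card]

lemma three_part (hn : 1 ≤ n) :
    (∀ k, Nonempty (tors (groupCohomology (kerRep (aug (psi n))) (k+1)) (3 ^ n) ≃+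
      tors (groupCohomology (Rep.trivial ℤ (Ostar n) ℤ) (k+4)) (3 ^ n))) ∧
    (∀ k, Nonempty (tors (groupCohomology (Rep.trivial ℤ (Ostar n) ℤ) (k+1)) (3 ^ n) ≃+
      tors (groupCohomology (Rep.trivial ℤ (Ostar n) ℤ) (k+5)) (3 ^ n))) :=
  four_term (cst (psi n)) (upm n) (nmm n) (ump n) (aug (psi n))
    (cst_inj _) (tx3 n) (tx2 n) (tx1 n) (tx0 n) (aug_surj _) 16 (3 ^ n)
    (Nat.Coprime.pow_right _ (by norm_num)) (killA n hn _) (killA n hn _) (killA n hn _)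
    (killA n hn _)

lemma H4_ne (hn : 1 ≤ n) : ∃ x : groupCohomology (Rep.trivial ℤ (Ostar n) ℤ) 4,
    x ≠ 0 ∧ 3 ^ n • x = 0 := by
  have h := delta_ne (aug (psi n)) (aug_surj _) (3 ^ n) ⟨(1 : ℤ), fun g => rfl⟩ (by
    rintro ⟨a, ha⟩ h
    have h : ∑ i, a i = 1 := h
    have hc : ∀ j, a j = a 0 := by
      intro j
      obtain ⟨g, rfl⟩ := psi_trans n j
      have := congrFun (ha g) (psi n g 0)
      rw [pRep_apply] at this
      rw [← this]; simp
    simp only [hc, Finset.sum_const, Finset.card_univ, ZMod.card] at h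
    have h3 : (3 : ℤ) ∣ 1 := by
      rw [← h]
      obtain ⟨m, rfl⟩ := Nat.exists_eq_add_of_le hn
      exact ⟨3 ^ m * a 0, by simp [pow_add]; ring⟩
    norm_num at h3) ⟨⟨fun _ => 1, by
      intro g; funext j; rw [pRep_apply]; simp⟩, by
      change ∑ i : ZMod (3 ^ n), (1 : ℤ) = 3 ^ n • (1 : ℤ)
      simp [ZMod.card]⟩
  obtain ⟨x, hx, hx'⟩ := h
  obtain ⟨e⟩ := (three_part n hn).1 0
  let y := e ⟨x, mem_tors.2 hx'⟩
  refine ⟨y.1, ?_, mem_tors.1 y.2⟩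
  intro h0
  apply hx
  have : y = 0 := Subtype.ext h0
  exact congrArg Subtype.val ((map_eq_zero_iff e e.injective).1 this)

lemma H1_zero (x : groupCohomology (Rep.trivial ℤ (Ostar n) ℤ) 1) : x = 0 := by
  refine H1_sub ℤ (fun f => ?_) x
  apply AddMonoidHom.ext
  intro g
  have h1 : Fintype.card (Ostar n) • f g = 0 := by
    rw [← map_nsmul]
    have : Fintype.card (Ostar n) • g = 0 := (pow_card_eq_one : (Additive.toMul g) ^ _ = 1)
    rw [this, map_zero]
  have h2 := (smul_eq_zero.1 h1).resolve_left (Fintype.card_ne_zero)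
  exact h2

lemma hom3_zero (f : Additive (Ostar n) →+ ZMod 3) : f = 0 := by
  obtain ⟨h1, h2, h3, h4, h5, h6, h7, h8, h9, h10⟩ := og_rels n
  let F : OGen → ZMod 3 := fun s => f (Additive.ofMul (og n s))
  have c2 := congrArg (fun g => f (Additive.ofMul g)) h2
  have c4 := congrArg (fun g => f (Additive.ofMul g)) h4
  have c6 := congrArg (fun g => f (Additive.ofMul g)) h6
  have c8 := congrArg (fun g => f (Additive.ofMul g)) h8
  have c7 := congrArg (fun g => f (Additive.ofMul g)) h7
  simp only [ofMul_mul, ofMul_pow, ofMul_inv, map_add, map_nsmul, map_neg, ofMul_one, map_zero]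
    at c2 c4 c6 c7 c8
  have hz : ∀ s, f (Additive.ofMul (og n s)) = 0 := by
    revert c2 c4 c6 c7 c8
    generalize hX : f (Additive.ofMul (og n .X)) = x
    generalize hP : f (Additive.ofMul (og n .P)) = p
    generalize hQ : f (Additive.ofMul (og n .Q)) = q
    generalize hR : f (Additive.ofMul (og n .R)) = r
    intro c2 c4 c6 c7 c8
    have : x = 0 ∧ p = 0 ∧ q = 0 ∧ r = 0 := by
      clear hX hP hQ hR
      revert x p q r
      decide
    obtain ⟨rfl, rfl, rfl, rfl⟩ := this
    intro s
    cases s <;> assumption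
  apply AddMonoidHom.ext
  intro g
  have hg : Additive.toMul g ∈ Subgroup.closure {og n .X, og n .P, og n .Q, og n .R} := by
    rw [og_closure]; trivial
  change f (Additive.ofMul (Additive.toMul g)) = 0
  generalize Additive.toMul g = g' at hg
  induction hg using Subgroup.closure_induction with
  | mem x hx => rcases hx with rfl | rfl | rfl | rfl <;> exact hz _
  | one => simp
  | mul x y _ _ hx hy => rw [ofMul_mul, map_add, hx, hy, add_zero]
  | inv x _ hx => rw [ofMul_inv, map_neg, hx, neg_zero]

lemma H2_no3 (x : groupCohomology (Rep.trivial ℤ (Ostar n) ℤ) 2) (m : ℕ) (hx : 3 ^ m • x = 0) :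
    x = 0 := by
  induction m with
  | zero => simpa using hx
  | succ m ih =>
    rw [pow_succ', mul_smul] at hx
    exact ih (H2_tors 3 (hom3_zero n) _ hx)

/-- coprime splitting -/
lemma split_equiv {M : Type} [AddCommGroup M] (a b : ℕ) (hab : Nat.Coprime a b)
    (h : ∀ x : M, (a * b) • x = 0) : Nonempty (M ≃+ tors M a × tors M b) := by
  obtain ⟨u, v, huv⟩ : ∃ u v : ℤ, u * a + v * b = 1 :=
    Int.isCoprime_iff_gcd_eq_one.2 (by simpa using hab)
  let f : tors M a × tors M b →+ M := (tors M a).subtype.coprod (tors M b).subtype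
  refine ⟨(AddEquiv.ofBijective f ⟨?_, ?_⟩).symm⟩
  · rw [injective_iff_map_eq_zero]
    rintro ⟨⟨x, hx⟩, ⟨y, hy⟩⟩ h0
    have h0 : x + y = 0 := h0
    rw [mem_tors] at hx hy
    have hxy : y = -x := by rw [eq_neg_iff_add_eq_zero, add_comm]; exact h0
    have hx' : b • x = 0 := by rw [hxy] at hy; simpa using hy
    have : x = 0 := by
      have : x = (u * a + v * b : ℤ) • x := by rw [huv]; simp
      rw [this, add_smul, mul_smul, mul_smul]; simp [hx, hx']
    subst this
    simp at hxy
    subst hxy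
    rfl
  · intro x
    refine ⟨(⟨v • b • x, ?_⟩, ⟨u • a • x, ?_⟩), ?_⟩
    · rw [mem_tors, smul_comm, ← mul_smul a b, h, smul_zero]
    · rw [mem_tors, smul_comm, ← mul_smul b a, mul_comm, h, smul_zero]
    · change v • b • x + u • a • x = x
      have : x = (u * a + v * b : ℤ) • x := by rw [huv]; simp
      conv_rhs => rw [this, add_smul, mul_smul, mul_smul]
      simp [add_comm]

lemma period4 (hn : 1 ≤ n) (k : ℕ) :
    Nonempty (groupCohomology (Rep.trivial ℤ (Ostar n) ℤ) (k+1) ≃+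
      groupCohomology (Rep.trivial ℤ (Ostar n) ℤ) (k+5)) := by
  have hc : Nat.Coprime (3 ^ n) 16 := Nat.Coprime.pow_left _ (by norm_num)
  have hk : ∀ k, ∀ x : groupCohomology (Rep.trivial ℤ (Ostar n) ℤ) (k+1), (3 ^ n * 16) • x = 0 := by
    intro k x
    rw [← card_ostar n hn]; exact triv_kill k x
  obtain ⟨e1⟩ := split_equiv _ _ hc (hk k)
  obtain ⟨e2⟩ := split_equiv _ _ hc (hk (k+4))
  obtain ⟨e3⟩ := two_part n hn k
  obtain ⟨e4⟩ := (three_part n hn).2 k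
  exact ⟨e1.trans ((e4.prodCongr e3).trans e2.symm)⟩

end threepart

/-- For every n ≥ 1, the least period of O*ₙ is 4: Hᵏ(O*ₙ) ≅ H^(k+4)(O*ₙ) for all k > 0,
and no positive d < 4 is a period. -/
theorem least_period_Ostar (n : ℕ) (hn : 1 ≤ n) :
    IsCohomologyPeriod (Ostar n) 4 ∧
      ¬ ∃ d : ℕ, 0 < d ∧ d < 4 ∧ IsCohomologyPeriod (Ostar n) d := by
  obtain ⟨y, hy, hy'⟩ := H4_ne n hn
  have no2 : ¬ Nonempty (intGroupCohomology (Ostar n) 2 ≃+ intGroupCohomology (Ostar n) 4) := by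
    rintro ⟨e⟩
    apply hy
    have : e.symm y = 0 := H2_no3 n (e.symm y) n (by rw [← map_nsmul, hy', map_zero])
    exact (map_eq_zero_iff e.symm e.symm.injective).1 this
  refine ⟨⟨by norm_num, ?_⟩, ?_⟩
  · intro k hk
    obtain ⟨m, rfl⟩ := Nat.exists_eq_add_of_le' hk
    exact period4 n hn m
  · rintro ⟨d, hd, hd4, _, h⟩
    interval_cases d
    · obtain ⟨e1⟩ := h 2 (by norm_num)
      obtain ⟨e2⟩ := h 3 (by norm_num)
      exact no2 ⟨e1.trans e2⟩
    · exact no2 (h 2 (by norm_num))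
    · obtain ⟨e⟩ := h 1 (by norm_num)
      apply hy
      have : e.symm y = 0 := H1_zero n _
      exact (map_eq_zero_iff e.symm e.symm.injective).1 this
end
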